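/- arXiv:1011.5339 — 3 statements merged into one kernel-verified Lean document; each statement's English description precedes it below -/
import Mathlib

section
/- The set of pairs {(ζ(1/2+it), ζ'(1/2+it)) : t ∈ ℝ} is not dense in ℂ²; that is, there exists a point (z,w) ∈ ℂ² and an ε > 0 such that for every real t, either |ζ(1/2+it) − z| ≥ ε or |ζ'(1/2+it) − w| ≥ ε. -/
open Complex

open Filter Topology Set ComplexConjugate

lemma ne_neg_natCast_of_re_pos {s : ℂ} (hs : 0 < s.re) (m : ℕ) : s ≠ -m := by
  rintro rfl
  have : (0 : ℝ) ≤ m := m.cast_nonneg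
  simp at hs
  linarith

lemma norm_add_natCast_pos {s : ℂ} (hs : 0 < s.re) (n : ℕ) : 0 < ‖s + n‖ :=
  norm_pos_iff.2 fun h ↦ ne_neg_natCast_of_re_pos hs n (eq_neg_of_add_eq_zero_left h)

/-- The norm of Euler's approximation to `Γ (x + y * I)`. -/
lemma norm_GammaSeq_mul_prod {x : ℝ} (hx : 0 < x) (y : ℝ) {n : ℕ} (hn : 0 < n) :
    ‖GammaSeq (x + y * I) n‖ * ∏ j ∈ Finset.range (n + 1), ‖(x + y * I + j : ℂ)‖ =
      (n : ℝ) ^ x * n.factorial := by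
  have hne : ∏ j ∈ Finset.range (n + 1), ‖(x + y * I + j : ℂ)‖ ≠ 0 :=
    (Finset.prod_pos fun j _ ↦ norm_add_natCast_pos (by simpa using hx) j).ne'
  rw [GammaSeq, norm_div, norm_prod, div_mul_cancel₀ _ hne, norm_mul, norm_natCast,
    norm_natCast_cpow_of_pos hn]
  simp

/-- For fixed `y`, the quotient `‖Γ (x + y * I)‖ / ‖Γ x‖` is nondecreasing in `x > 0`. -/
lemma norm_Gamma_mul_norm_Gamma_le {a b : ℝ} (ha : 0 < a) (hab : a ≤ b) (y : ℝ) :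
    ‖Gamma (a + y * I)‖ * ‖Gamma b‖ ≤ ‖Gamma (b + y * I)‖ * ‖Gamma a‖ := by
  have hb := ha.trans_le hab
  refine le_of_tendsto_of_tendsto
    ((GammaSeq_tendsto_Gamma _).norm.mul (GammaSeq_tendsto_Gamma _).norm)
    ((GammaSeq_tendsto_Gamma _).norm.mul (GammaSeq_tendsto_Gamma _).norm) ?_
  filter_upwards [eventually_gt_atTop 0] with n hn
  have h1 := norm_GammaSeq_mul_prod ha y hn
  have h2 := norm_GammaSeq_mul_prod hb y hn
  have h3 := norm_GammaSeq_mul_prod ha 0 hn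
  have h4 := norm_GammaSeq_mul_prod hb 0 hn
  simp only [ofReal_zero, zero_mul, add_zero] at h3 h4
  have hprod : (∏ j ∈ Finset.range (n + 1), ‖(b + y * I + j : ℂ)‖) *
        ∏ j ∈ Finset.range (n + 1), ‖(a + j : ℂ)‖ ≤
      (∏ j ∈ Finset.range (n + 1), ‖(a + y * I + j : ℂ)‖) *
        ∏ j ∈ Finset.range (n + 1), ‖(b + j : ℂ)‖ := by
    rw [← Finset.prod_mul_distrib, ← Finset.prod_mul_distrib]
    refine Finset.prod_le_prod (fun j _ ↦ by positivity) fun j _ ↦ ?_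
    rw [← abs_of_nonneg (mul_nonneg (norm_nonneg (b + y * I + j : ℂ)) (norm_nonneg _)),
      ← abs_of_nonneg (mul_nonneg (norm_nonneg (a + y * I + j : ℂ)) (norm_nonneg _)),
      ← sq_le_sq, mul_pow, mul_pow, ← normSq_eq_norm_sq, ← normSq_eq_norm_sq,
      ← normSq_eq_norm_sq, ← normSq_eq_norm_sq]
    simp only [normSq_apply, add_re, ofReal_re, mul_re, I_re, mul_zero, ofReal_im, I_im, mul_one,
      sub_self, add_zero, natCast_re, add_im, mul_im, zero_add, natCast_im]
    have hj : (0 : ℝ) ≤ j := j.cast_nonneg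
    have : (a + j) ^ 2 ≤ (b + j) ^ 2 := by gcongr
    nlinarith [mul_le_mul_of_nonneg_left this (sq_nonneg y)]
  have hA := Finset.prod_pos fun j (_ : j ∈ Finset.range (n + 1)) ↦
    norm_add_natCast_pos (s := a + y * I) (by simpa using ha) j
  have hB := Finset.prod_pos fun j (_ : j ∈ Finset.range (n + 1)) ↦
    norm_add_natCast_pos (s := b + y * I) (by simpa using hb) j
  have hC := Finset.prod_pos fun j (_ : j ∈ Finset.range (n + 1)) ↦
    norm_add_natCast_pos (s := a) (by simpa using ha) j
  have hD := Finset.prod_pos fun j (_ : j ∈ Finset.range (n + 1)) ↦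
    norm_add_natCast_pos (s := b) (by simpa using hb) j
  rw [← eq_div_iff hA.ne'] at h1
  rw [← eq_div_iff hB.ne'] at h2
  rw [← eq_div_iff hC.ne'] at h3
  rw [← eq_div_iff hD.ne'] at h4
  rw [h1, h2, h3, h4, div_mul_div_comm, div_mul_div_comm, mul_comm ((n : ℝ) ^ b * _)]
  gcongr

lemma hasDerivAt_log_norm {f : ℂ → ℂ} {x : ℝ} {c : ℂ} (hf : DifferentiableAt ℂ f (x + c))
    (h0 : f (x + c) ≠ 0) :
    HasDerivAt (fun u : ℝ ↦ Real.log ‖f (u + c)‖) (logDeriv f (x + c)).re x := by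
  have h1 : HasDerivAt (fun u : ℝ ↦ f (u + c)) (deriv f (x + c)) x := by
    have := hf.hasDerivAt.comp_add_const (x : ℂ) c
    exact this.comp_ofReal
  have h2 := (h1.norm_sq.log (by positivity)).div_const 2
  refine (h2.congr_of_eventuallyEq (.of_forall fun u ↦ ?_)).congr_deriv ?_
  · simp
  · rw [logDeriv_apply, Complex.inner, div_re, mul_re, ← normSq_eq_norm_sq]
    have := normSq_pos.2 h0
    simp only [conj_re, conj_im]
    field_simp
    ring

/-- On the right half-plane, `re ψ` on each vertical line is smallest on the real axis. -/
lemma re_digamma_ofReal_le {x : ℝ} (hx : 0 < x) (y : ℝ) :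
    (digamma x).re ≤ (digamma (x + y * I)).re := by
  have hd (y : ℝ) : HasDerivAt (fun u : ℝ ↦ Real.log ‖Gamma (u + y * I)‖)
      (digamma (x + y * I)).re x :=
    hasDerivAt_log_norm
      (differentiableAt_Gamma _ (ne_neg_natCast_of_re_pos (by simpa using hx)))
      (Gamma_ne_zero_of_re_pos (by simpa using hx))
  have h0 := hd 0
  simp only [ofReal_zero, zero_mul, add_zero] at h0
  have hsub := (hd y).sub h0
  rw [← sub_nonneg]
  have hmono : MonotoneOn ((fun u : ℝ ↦ Real.log ‖Gamma (u + y * I)‖) -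
      fun u : ℝ ↦ Real.log ‖Gamma u‖) (Ioi 0) := by
    intro a (ha : 0 < a) b (hb : 0 < b) hab
    have hpos {u : ℝ} (hu : 0 < u) (v : ℝ) : 0 < ‖Gamma (u + v * I)‖ :=
      norm_pos_iff.2 (Gamma_ne_zero_of_re_pos (by simpa using hu))
    have hpos' {u : ℝ} (hu : 0 < u) : 0 < ‖Gamma u‖ := by simpa using hpos hu 0
    have := Real.log_le_log (mul_pos (hpos ha y) (hpos' hb))
      (norm_Gamma_mul_norm_Gamma_le ha hab y)
    rw [Real.log_mul (hpos ha y).ne' (hpos' hb).ne',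
      Real.log_mul (hpos hb y).ne' (hpos' ha).ne'] at this
    simp only [Pi.sub_apply]
    linarith
  have hmem : Ioi (0 : ℝ) ∈ 𝓝 x := Ioi_mem_nhds hx
  rw [← hsub.deriv, ← derivWithin_of_mem_nhds hmem]
  exact hmono.derivWithin_nonneg

lemma log_le_re_digamma_add_one {x : ℝ} (hx : 0 < x) :
    Real.log x ≤ (digamma ((x + 1 : ℝ) : ℂ)).re := by
  have hx1 : 0 < x + 1 := by linarith
  have hd : HasDerivAt (Real.log ∘ Real.Gamma) (digamma ((x + 1 : ℝ) : ℂ)).re (x + 1) := by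
    have := hasDerivAt_log_norm (f := Gamma) (x := x + 1) (c := 0)
      (differentiableAt_Gamma _ (ne_neg_natCast_of_re_pos (by simpa using hx1)))
      (Gamma_ne_zero_of_re_pos (by simpa using hx1))
    simpa [Gamma_ofReal, Function.comp_def, digamma_def] using this
  have := Real.convexOn_log_Gamma.slope_le_of_hasDerivAt (x := x) (y := x + 1) hx hx1
    (by linarith) hd
  rwa [slope_def_field, Function.comp_apply, Function.comp_apply, Real.Gamma_add_one hx.ne',
    Real.log_mul hx.ne' (Real.Gamma_pos_of_pos hx).ne', add_sub_cancel_right,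
    add_sub_cancel_left, div_one] at this

lemma digamma_add_natCast {s : ℂ} (hs : 0 < s.re) (n : ℕ) :
    digamma (s + n) = digamma s + ∑ k ∈ Finset.range n, (s + k)⁻¹ := by
  induction n with
  | zero => simp
  | succ n ih =>
    rw [Finset.sum_range_succ, ← add_assoc, ← ih, Nat.cast_succ, ← add_assoc]
    refine digamma_apply_add_one _ (ne_neg_natCast_of_re_pos ?_)
    have : (0 : ℝ) ≤ n := n.cast_nonneg
    simp
    linarith

lemma tendsto_re_digamma_cocompact {x : ℝ} (hx : 0 < x) :
    Tendsto (fun y : ℝ ↦ (digamma (x + y * I)).re) (cocompact ℝ) atTop := by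
  refine tendsto_atTop.2 fun C ↦ ?_
  obtain ⟨n, hn, hn0⟩ : ∃ n : ℕ, C + 1 ≤ Real.log n ∧ 0 < n :=
    (((Real.tendsto_log_atTop.comp tendsto_natCast_atTop_atTop).eventually_ge_atTop (C + 1)).and
      (eventually_gt_atTop 0)).exists
  have hlim : Tendsto (fun y : ℝ ↦ (∑ k ∈ Finset.range (n + 1), (x + y * I + k : ℂ)⁻¹).re)
      (cocompact ℝ) (𝓝 0) := by
    rw [← zero_re, ← Finset.sum_const_zero (s := Finset.range (n + 1))]
    refine (continuous_re.tendsto _).comp (tendsto_finsetSum _ fun k _ ↦ ?_)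
    refine tendsto_inv₀_cobounded.comp ?_
    rw [tendsto_norm_atTop_iff_cobounded.symm]
    refine tendsto_atTop_mono (fun y ↦ ?_) (tendsto_norm_cocompact_atTop (E := ℝ))
    simpa using abs_im_le_norm (x + y * I + k : ℂ)
  filter_upwards [hlim.eventually_lt_const zero_lt_one] with y hy
  have h1 := congrArg re (digamma_add_natCast (s := x + y * I) (by simpa using hx) (n + 1))
  have h2 := re_digamma_ofReal_le (x := x + n + 1) (by positivity) y
  have h3 := log_le_re_digamma_add_one (x := x + n) (by positivity)
  have h4 : Real.log n ≤ Real.log (x + n) :=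
    Real.log_le_log (by exact_mod_cast hn0) (by linarith)
  have h5 : ((x + n + 1 : ℝ) : ℂ) + y * I = x + y * I + (n + 1 : ℕ) := by push_cast; ring
  rw [h5] at h2
  rw [add_re] at h1
  linarith

lemma logDeriv_Gammaℝ {s : ℂ} (hs : 0 < s.re) :
    logDeriv Gammaℝ s = (digamma (s / 2) - Real.log Real.pi) / 2 := by
  have hpi : (Real.pi : ℂ) ≠ 0 := ofReal_ne_zero.2 Real.pi_ne_zero
  have hs2 : 0 < (s / 2).re := by simpa using hs
  have h1 : HasDerivAt (fun z : ℂ ↦ (Real.pi : ℂ) ^ (-z / 2))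
      ((Real.pi : ℂ) ^ (-s / 2) * log Real.pi * (-1 / 2)) s :=
    ((hasDerivAt_id s).neg.div_const 2).const_cpow (.inl hpi)
  have h2 : HasDerivAt (fun z : ℂ ↦ Gamma (z / 2)) (deriv Gamma (s / 2) * (1 / 2)) s :=
    (differentiableAt_Gamma _ (ne_neg_natCast_of_re_pos hs2)).hasDerivAt.comp s
      ((hasDerivAt_id s).div_const 2)
  have h3 : HasDerivAt Gammaℝ _ s := h1.mul h2
  have hG := Gamma_ne_zero_of_re_pos hs2
  have hc : (Real.pi : ℂ) ^ (-s / 2) ≠ 0 := by simp [cpow_eq_zero_iff, hpi]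
  rw [logDeriv_apply, h3.deriv, Gammaℝ_def, digamma_def, logDeriv_apply,
    ofReal_log Real.pi_nonneg]
  field_simp
  ring

lemma Gammaℝ_conj (s : ℂ) : Gammaℝ (conj s) = conj (Gammaℝ s) := by
  have h : (Real.pi : ℂ) ^ conj (-s / 2) = conj ((Real.pi : ℂ) ^ (-s / 2)) := by
    rw [cpow_conj _ _ (by simp [arg_ofReal_of_nonneg Real.pi_nonneg, Real.pi_ne_zero.symm]),
      conj_ofReal]
  rw [Gammaℝ_def, Gammaℝ_def, map_mul, ← Gamma_conj, ← h]
  simp only [map_div₀, map_neg, map_ofNat]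

/-- On the critical line, the completed zeta function is real and its derivative is imaginary. -/
lemma re_logDeriv_riemannZeta {s : ℂ} (hs : s.re = 1 / 2) (h0 : riemannZeta s ≠ 0) :
    (logDeriv riemannZeta s).re = -(logDeriv Gammaℝ s).re := by
  set F : ℂ → ℂ := fun z ↦ Gammaℝ z * riemannZeta z with hF
  have hFΛ {z : ℂ} (hz : 0 < z.re) : F z = completedRiemannZeta z := by
    have : z ≠ 0 := by rintro rfl; simp at hz
    simp only [hF, riemannZeta_def_of_ne_zero this]
    exact mul_div_cancel₀ _ (Gammaℝ_ne_zero_of_re_pos hz)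
  have hFΛ' {z : ℂ} (hz : 0 < z.re) : deriv F z = deriv completedRiemannZeta z :=
    EventuallyEq.deriv_eq <| eventually_of_mem
      ((isOpen_lt continuous_const continuous_re).mem_nhds hz) fun w hw ↦ hFΛ hw
  have hconj : conj ∘ F ∘ conj = F := by
    ext z
    simp [hF, Gammaℝ_conj]
  have hs1 : conj s = 1 - s := by
    apply Complex.ext <;> simp [hs]
    norm_num
  have hpos : 0 < s.re := by rw [hs]; norm_num
  have hpos' : 0 < (1 - s).re := by simp [hs]; norm_num
  have hFs : conj (F s) = F s := by
    conv_lhs => rw [← hconj]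
    simp [hs1, hFΛ hpos, hFΛ hpos', completedRiemannZeta_one_sub]
  have hF's : conj (deriv F s) = -deriv F s := by
    have h1 : deriv completedRiemannZeta s = -deriv completedRiemannZeta (1 - s) := by
      rw [← deriv_comp_const_sub]
      simp [completedRiemannZeta_one_sub]
    rw [← hFΛ' hpos, ← hFΛ' hpos', ← hs1] at h1
    have h2 := congrFun (deriv_conj_conj (f := F)) s
    rw [hconj, Function.comp_apply, Function.comp_apply, neg_eq_iff_eq_neg.1 h1.symm,
      map_neg] at h2
    rw [h2, neg_neg]
    simp [← h2]
  have hre : (logDeriv F s).re = 0 := by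
    have : conj (logDeriv F s) = -logDeriv F s := by
      rw [logDeriv_apply, map_div₀, hFs, hF's, neg_div]
    have := congrArg re this
    simp at this
    linarith
  have hs_ne : s ≠ 1 := by rintro rfl; norm_num at hs
  have hG : Gammaℝ s ≠ 0 := Gammaℝ_ne_zero_of_re_pos hpos
  have hGd : DifferentiableAt ℂ Gammaℝ s := by
    simpa [Pi.inv_def] using (differentiable_Gammaℝ_inv s).inv (inv_ne_zero hG)
  rw [hF, logDeriv_mul s hG h0 hGd (differentiableAt_riemannZeta hs_ne), add_re] at hre
  linarith

/-- For `t` outside a bounded set, `ζ'` dominates `ζ` on the critical line. -/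
lemma eventually_norm_riemannZeta_le_norm_deriv (C : ℝ) :
    ∀ᶠ t : ℝ in cocompact ℝ,
      C * ‖riemannZeta (1 / 2 + t * I)‖ ≤ ‖deriv riemannZeta (1 / 2 + t * I)‖ := by
  have hlim : Tendsto (fun t : ℝ ↦ (digamma ((1 / 4 : ℝ) + (t / 2 : ℝ) * I)).re)
      (cocompact ℝ) atTop :=
    (tendsto_re_digamma_cocompact (by norm_num)).comp
      (Homeomorph.mulRight₀ (2⁻¹ : ℝ) (by norm_num)).isClosedEmbedding.tendsto_cocompact
  filter_upwards [hlim.eventually_ge_atTop (2 * C + Real.log Real.pi)] with t ht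
  set s : ℂ := 1 / 2 + t * I with hs
  rcases eq_or_ne (riemannZeta s) 0 with h0 | h0
  · simp [h0]
  have hre : s.re = 1 / 2 := by simp [hs]
  have h1 := re_logDeriv_riemannZeta hre h0
  rw [logDeriv_Gammaℝ (by rw [hre]; norm_num)] at h1
  have hs2 : ((1 / 4 : ℝ) + (t / 2 : ℝ) * I : ℂ) = s / 2 := by
    rw [hs]; push_cast; ring
  rw [hs2] at ht
  have h2 : C ≤ ‖logDeriv riemannZeta s‖ := by
    refine le_trans ?_ (abs_re_le_norm _)
    rw [h1, abs_neg]
    refine le_trans ?_ (le_abs_self _)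
    simp
    linarith
  rwa [logDeriv_apply, norm_div, le_div_iff₀ (norm_pos_iff.2 h0)] at h2

/-- The set of pairs `(ζ(1/2+it), ζ'(1/2+it))` for real `t` is not dense in `ℂ²`:
there is a point `(z, w)` and an `ε > 0` such that for every real `t`, either
`|ζ(1/2+it) − z| ≥ ε` or `|ζ'(1/2+it) − w| ≥ ε`. -/
theorem zeta_pair_not_dense :
    ∃ (z w : ℂ) (ε : ℝ), 0 < ε ∧ ∀ t : ℝ,
      ε ≤ ‖riemannZeta (1 / 2 + t * I) - z‖ ∨
      ε ≤ ‖deriv riemannZeta (1 / 2 + t * I) - w‖ := by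
  have hne (t : ℝ) : (1 / 2 + t * I : ℂ) ≠ 1 := fun h ↦ by
    have := congrArg re h
    norm_num at this
  let φ : ℝ → ℂ × ℂ := fun t ↦
    (riemannZeta (1 / 2 + t * I), deriv riemannZeta (1 / 2 + t * I))
  have hφ : ContDiff ℝ 1 φ := by
    have hl : ContDiff ℝ 1 fun t : ℝ ↦ (1 / 2 + t * I : ℂ) :=
      contDiff_const.add (ofRealCLM.contDiff.mul contDiff_const)
    have hζ (t : ℝ) : AnalyticAt ℂ riemannZeta (1 / 2 + t * I) :=
      analyticOn_riemannZeta _ (hne t)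
    refine contDiff_iff_contDiffAt.2 fun t ↦ ContDiffAt.prodMk ?_ ?_
    · exact ((hζ t).contDiffAt.restrict_scalars ℝ).comp t hl.contDiffAt
    · exact ((hζ t).deriv.contDiffAt.restrict_scalars ℝ).comp t hl.contDiffAt
  obtain ⟨K, hK, hKφ⟩ := mem_cocompact.1 (eventually_norm_riemannZeta_le_norm_deriv 1)
  have hdense : Dense (range φ)ᶜ :=
    hφ.dense_compl_range_of_finrank_lt_finrank (by simp [Module.finrank_prod])
  let U : Set (ℂ × ℂ) := {p | ‖p.2‖ < ‖p.1‖}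
  have hU : IsOpen U := isOpen_lt continuous_snd.norm continuous_fst.norm
  obtain ⟨p, hpU, hp⟩ := hdense.inter_open_nonempty U hU ⟨(1, 0), by simp [U]⟩
  have hV : IsOpen (U ∩ (φ '' K)ᶜ) :=
    hU.inter (hK.image hφ.continuous).isClosed.isOpen_compl
  obtain ⟨ε, hε, hball⟩ := Metric.isOpen_iff.1 hV p
    ⟨hpU, fun h ↦ hp (image_subset_range φ K h)⟩
  refine ⟨p.1, p.2, ε, hε, fun t ↦ ?_⟩
  by_contra! h
  have hmem : φ t ∈ Metric.ball p ε := by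
    rw [Metric.mem_ball, Prod.dist_eq, dist_eq_norm, dist_eq_norm]
    exact max_lt h.1 h.2
  obtain ⟨h1, h2⟩ := hball hmem
  have htK : t ∉ K := fun ht ↦ h2 (mem_image_of_mem φ ht)
  have h3 : 1 * ‖riemannZeta (1 / 2 + t * I)‖ ≤ ‖deriv riemannZeta (1 / 2 + t * I)‖ := hKφ htK
  rw [one_mul] at h3
  exact h3.not_gt h1
end

section
/- There exists a real number A₀ > 0 such that for every real number a ≥ A₀ there exists ε > 0 such that no t ∈ ℝ satisfies both |ζ(1/2+it) − a| < ε and |ζ'(1/2+it) − a| < ε. -/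
open Complex

open Filter Topology ComplexConjugate

/-- The sum `∑_{j ≤ n} 1 / max(y, j)` falls short of `log n` by at least `log m - 2`
whenever `y ≥ m`. -/
lemma sum_inv_max_le {m : ℕ} (hm : 1 ≤ m) {y : ℝ} (hy : (m : ℝ) ≤ y) {n : ℕ} (hn : m ≤ n) :
    ∑ j ∈ Finset.range (n + 1), (max y (j : ℝ))⁻¹ ≤ 2 + Real.log n - Real.log m := by
  have hm' : (1 : ℝ) ≤ m := by exact_mod_cast hm
  induction n, hn using Nat.le_induction with
  | base =>
    have hterm : ∀ j ∈ Finset.range (m + 1), (max y (j : ℝ))⁻¹ ≤ (m : ℝ)⁻¹ := fun j _ =>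
      inv_anti₀ (by linarith) (hy.trans (le_max_left _ _))
    have hsum := Finset.sum_le_card_nsmul _ _ _ hterm
    have hinv : (m : ℝ)⁻¹ ≤ 1 := inv_le_one_of_one_le₀ hm'
    have hcancel : (m : ℝ) * (m : ℝ)⁻¹ = 1 := mul_inv_cancel₀ (by linarith)
    simp only [Finset.card_range, nsmul_eq_mul, Nat.cast_add, Nat.cast_one, add_mul] at hsum
    linarith
  | succ n hn ih =>
    rw [Finset.sum_range_succ]
    have hn' : (1 : ℝ) ≤ n := by exact_mod_cast hm.trans hn
    have hterm : (max y ((n + 1 : ℕ) : ℝ))⁻¹ ≤ ((n : ℝ) + 1)⁻¹ :=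
      inv_anti₀ (by linarith) (by push_cast; exact le_max_right _ _)
    have hlog := Real.one_sub_inv_le_log_of_pos (x := ((n : ℝ) + 1) / n) (by positivity)
    rw [Real.log_div (by positivity) (by positivity), inv_div] at hlog
    have hfrac : 1 - (n : ℝ) / (n + 1) = ((n : ℝ) + 1)⁻¹ := by field_simp; ring
    push_cast at *
    linarith

/-- A vertical shift far from the real axis forces `‖Γ‖` to grow at an exponential rate along
horizontal lines in the right half-plane. -/
lemma exp_mul_norm_Gamma_le {m : ℕ} (hm : 1 ≤ m) {x₁ x₂ y : ℝ} (hx₁ : 0 < x₁) (hx : x₁ ≤ x₂)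
    (hy : (m : ℝ) ≤ |y|) :
    Real.exp ((Real.log m - 2) * (x₂ - x₁)) * ‖Gamma (x₁ + y * I)‖ ≤ ‖Gamma (x₂ + y * I)‖ := by
  refine le_of_tendsto_of_tendsto
    (((GammaSeq_tendsto_Gamma (x₁ + y * I)).norm).const_mul _)
    ((GammaSeq_tendsto_Gamma (x₂ + y * I)).norm) ?_
  filter_upwards [eventually_ge_atTop m] with n hn
  have hm' : (1 : ℝ) ≤ m := by exact_mod_cast hm
  have hn0 : 0 < n := by omega
  have hnpos : (0 : ℝ) < n := by exact_mod_cast hn0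
  have hmax (x : ℝ) (hx : 0 < x) (j : ℕ) :
      max |y| (j : ℝ) ≤ ‖(x : ℂ) + y * I + j‖ := by
    refine max_le ?_ ?_
    · simpa using abs_im_le_norm ((x : ℂ) + y * I + j)
    · refine le_trans ?_ ((le_abs_self _).trans (abs_re_le_norm _))
      simp [hx.le]
  have hpos (j : ℕ) : 0 < max |y| (j : ℝ) := lt_of_lt_of_le (by linarith) (le_max_left _ _)
  have hfactor (j : ℕ) : ‖(x₂ : ℂ) + y * I + j‖ ≤
      Real.exp ((max |y| (j : ℝ))⁻¹ * (x₂ - x₁)) * ‖(x₁ : ℂ) + y * I + j‖ := by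
    have htri : ‖(x₂ : ℂ) + y * I + j‖ ≤ ‖(x₁ : ℂ) + y * I + j‖ + (x₂ - x₁) := by
      have h := norm_add_le ((x₁ : ℂ) + y * I + j) ((x₂ - x₁ : ℝ) : ℂ)
      rw [norm_real, Real.norm_of_nonneg (by linarith)] at h
      refine le_trans (le_of_eq ?_) h
      push_cast
      ring_nf
    have hone : 1 ≤ (max |y| (j : ℝ))⁻¹ * ‖(x₁ : ℂ) + y * I + j‖ := by
      rw [inv_mul_eq_div, one_le_div (hpos j)]
      exact hmax x₁ hx₁ j
    calc _ ≤ _ := htri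
      _ ≤ ((max |y| (j : ℝ))⁻¹ * (x₂ - x₁) + 1) * ‖(x₁ : ℂ) + y * I + j‖ := by
        nlinarith [mul_le_mul_of_nonneg_right hone (sub_nonneg.2 hx)]
      _ ≤ _ := by gcongr; exact Real.add_one_le_exp _
  have hprod : ∏ j ∈ Finset.range (n + 1), ‖(x₂ : ℂ) + y * I + j‖ ≤
      Real.exp ((2 + Real.log n - Real.log m) * (x₂ - x₁)) *
        ∏ j ∈ Finset.range (n + 1), ‖(x₁ : ℂ) + y * I + j‖ := by
    calc _ ≤ ∏ j ∈ Finset.range (n + 1),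
          (Real.exp ((max |y| (j : ℝ))⁻¹ * (x₂ - x₁)) * ‖(x₁ : ℂ) + y * I + j‖) :=
          Finset.prod_le_prod (fun _ _ => norm_nonneg _) fun j _ => hfactor j
      _ = Real.exp ((∑ j ∈ Finset.range (n + 1), (max |y| (j : ℝ))⁻¹) * (x₂ - x₁)) *
          ∏ j ∈ Finset.range (n + 1), ‖(x₁ : ℂ) + y * I + j‖ := by
        rw [Finset.prod_mul_distrib, ← Real.exp_sum, Finset.sum_mul]
      _ ≤ _ := by
        gcongr
        exact sum_inv_max_le hm hy hn
  have hprodpos (x : ℝ) (hx : 0 < x) :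
      0 < ∏ j ∈ Finset.range (n + 1), ‖(x : ℂ) + y * I + j‖ :=
    Finset.prod_pos fun j _ => (hpos j).trans_le (hmax x hx j)
  have hnorm (x : ℝ) : ‖GammaSeq ((x : ℂ) + y * I) n‖ =
      Real.exp (Real.log n * x) * (n.factorial : ℝ) /
        ∏ j ∈ Finset.range (n + 1), ‖(x : ℂ) + y * I + j‖ := by
    rw [GammaSeq, norm_div, norm_mul, norm_prod, norm_natCast_cpow_of_pos hn0,
      Real.rpow_def_of_pos hnpos, Complex.norm_natCast]
    simp
  rw [hnorm, hnorm, ← mul_div_assoc, div_le_div_iff₀ (hprodpos _ hx₁)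
    (hprodpos _ (hx₁.trans_le hx))]
  calc _ ≤ Real.exp ((Real.log m - 2) * (x₂ - x₁)) *
        (Real.exp (Real.log n * x₁) * (n.factorial : ℝ)) *
        (Real.exp ((2 + Real.log n - Real.log m) * (x₂ - x₁)) *
        ∏ j ∈ Finset.range (n + 1), ‖(x₁ : ℂ) + y * I + j‖) := by gcongr
    _ = Real.exp ((Real.log m - 2) * (x₂ - x₁) + Real.log n * x₁ +
        (2 + Real.log n - Real.log m) * (x₂ - x₁)) * (n.factorial : ℝ) *
        ∏ j ∈ Finset.range (n + 1), ‖(x₁ : ℂ) + y * I + j‖ := by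
      rw [Real.exp_add, Real.exp_add]; ring
    _ = _ := by ring_nf

/-- Far from the real axis, `‖Gammaℝ‖` is nondecreasing along horizontal lines in the right
half-plane. -/
lemma exists_norm_Gammaℝ_mono : ∃ T : ℝ, ∀ t : ℝ, T ≤ |t| → ∀ σ₁ σ₂ : ℝ, 0 < σ₁ → σ₁ ≤ σ₂ →
    ‖Gammaℝ (σ₁ + t * I)‖ ≤ ‖Gammaℝ (σ₂ + t * I)‖ := by
  obtain ⟨m, hm⟩ := exists_nat_ge (Real.exp (2 + Real.log Real.pi))
  have hmpos : (0 : ℝ) < m := (Real.exp_pos _).trans_le hm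
  have hm1 : 1 ≤ m := by exact_mod_cast hmpos
  have hlog : 2 + Real.log Real.pi ≤ Real.log m := (Real.le_log_iff_exp_le hmpos).2 hm
  refine ⟨2 * m, fun t ht σ₁ σ₂ hσ₁ hσ => ?_⟩
  have hnorm (σ : ℝ) : ‖Gammaℝ (σ + t * I)‖ =
      Real.exp (Real.log Real.pi * (-σ / 2)) *
        ‖Gamma (((σ / 2 : ℝ) : ℂ) + ((t / 2 : ℝ) : ℂ) * I)‖ := by
    rw [Gammaℝ_def, norm_mul, norm_cpow_eq_rpow_re_of_pos Real.pi_pos,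
      Real.rpow_def_of_pos Real.pi_pos]
    congr 3
    · simp
    · push_cast; ring
  have hΓ := exp_mul_norm_Gamma_le hm1 (x₁ := σ₁ / 2) (x₂ := σ₂ / 2) (y := t / 2) (by linarith)
    (by linarith) (by rw [abs_div, abs_two]; linarith)
  rw [hnorm, hnorm]
  calc _ ≤ Real.exp (Real.log Real.pi * (-σ₂ / 2) + (Real.log m - 2) * (σ₂ / 2 - σ₁ / 2)) *
        ‖Gamma (((σ₁ / 2 : ℝ) : ℂ) + ((t / 2 : ℝ) : ℂ) * I)‖ := by
        gcongr
        nlinarith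
    _ ≤ _ := by
      rw [Real.exp_add, mul_assoc]
      gcongr

lemma norm_riemannZeta_le_of_norm_Gammaℝ_le {t δ : ℝ} (hδ : 0 < δ) (hδ' : δ < 1 / 2)
    (h : ‖Gammaℝ ((1 / 2 - δ : ℝ) + t * I)‖ ≤ ‖Gammaℝ ((1 / 2 + δ : ℝ) + t * I)‖) :
    ‖riemannZeta ((1 / 2 + δ : ℝ) + t * I)‖ ≤ ‖riemannZeta ((1 / 2 - δ : ℝ) + t * I)‖ := by
  have hΓconj (s : ℂ) : ‖Gammaℝ (conj s)‖ = ‖Gammaℝ s‖ := by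
    rw [Gammaℝ_def, Gammaℝ_def, norm_mul, norm_mul, norm_cpow_eq_rpow_re_of_pos Real.pi_pos,
      norm_cpow_eq_rpow_re_of_pos Real.pi_pos,
      show conj s / 2 = conj (s / 2) by rw [map_div₀, conj_ofNat], Gamma_conj, norm_conj]
    simp
  have hre (σ : ℝ) : ((σ : ℂ) + t * I).re = σ := by simp
  have hmul (σ : ℝ) (hσ : 0 < σ) :
      ‖riemannZeta (σ + t * I)‖ * ‖Gammaℝ (σ + t * I)‖ =
        ‖completedRiemannZeta (σ + t * I)‖ := by
    have hs : (σ : ℂ) + t * I ≠ 0 := fun h0 => by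
      have := congrArg re h0
      rw [hre, zero_re] at this
      linarith
    rw [riemannZeta_def_of_ne_zero hs, norm_div, div_mul_cancel₀]
    exact norm_ne_zero_iff.2 (Gammaℝ_ne_zero_of_re_pos (by rwa [hre]))
  have hsym : ‖completedRiemannZeta ((1 / 2 + δ : ℝ) + t * I)‖ =
      ‖riemannZeta ((1 / 2 - δ : ℝ) + t * I)‖ * ‖Gammaℝ ((1 / 2 - δ : ℝ) + t * I)‖ := by
    have hrefl : (1 : ℂ) - ((1 / 2 + δ : ℝ) + t * I) = conj (((1 / 2 - δ : ℝ) : ℂ) + t * I) := by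
      rw [map_add, map_mul, conj_ofReal, conj_ofReal, conj_I]
      push_cast
      ring
    have hs : conj (((1 / 2 - δ : ℝ) : ℂ) + t * I) ≠ 0 := fun h0 => by
      have := congrArg re h0
      rw [conj_re, hre, zero_re] at this
      linarith
    have hΓ : ‖Gammaℝ (conj (((1 / 2 - δ : ℝ) : ℂ) + t * I))‖ ≠ 0 :=
      norm_ne_zero_iff.2 (Gammaℝ_ne_zero_of_re_pos (by rw [conj_re, hre]; linarith))
    rw [← completedRiemannZeta_one_sub, hrefl, ← hΓconj,
      ← norm_conj (riemannZeta _), ← riemannZeta_conj, riemannZeta_def_of_ne_zero hs, norm_div,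
      div_mul_cancel₀ _ hΓ]
  have hpos : 0 < ‖Gammaℝ ((1 / 2 + δ : ℝ) + t * I)‖ :=
    norm_pos_iff.2 (Gammaℝ_ne_zero_of_re_pos (by rw [hre]; linarith))
  refine le_of_mul_le_mul_right ?_ hpos
  rw [hmul _ (by linarith), hsym]
  gcongr

/-- A function which is at most its own reflection on the right of the origin has nonpositive
derivative there. -/
lemma deriv_nonpos_of_le_reflection {h : ℝ → ℝ} {h' : ℝ} (hd : HasDerivAt h h' 0)
    (hle : ∀ᶠ δ in 𝓝[>] (0 : ℝ), h δ ≤ h (-δ)) : h' ≤ 0 := by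
  have hneg : HasDerivAt (fun δ => h (-δ)) (-h') 0 := by
    have := HasDerivAt.scomp (𝕜 := ℝ) (0 : ℝ) (g₁ := h) (h := fun δ => -δ) (h' := -1)
      (g₁' := h') (by simpa using hd) (hasDerivAt_neg 0)
    simpa [Function.comp_def] using this
  have hdiff := (hd.sub hneg).hasDerivWithinAt (s := Set.Ioi 0)
  rw [hasDerivWithinAt_iff_tendsto_slope' (by simp)] at hdiff
  have hlim : h' - -h' ≤ 0 := by
    refine le_of_tendsto hdiff ?_
    filter_upwards [hle, self_mem_nhdsWithin] with δ hδ hδ0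
    have hδ0 : 0 < δ := hδ0
    rw [slope_def_field]
    refine div_nonpos_of_nonpos_of_nonneg ?_ (by linarith)
    simpa using hδ
  linarith

/-- High on the critical line, `‖ζ‖²` is nonincreasing in the horizontal direction. -/
lemma exists_re_conj_zeta_mul_deriv_zeta_nonpos : ∃ T : ℝ, ∀ t : ℝ, T ≤ |t| →
    (riemannZeta (1 / 2 + t * I)).re * (deriv riemannZeta (1 / 2 + t * I)).re +
      (riemannZeta (1 / 2 + t * I)).im * (deriv riemannZeta (1 / 2 + t * I)).im ≤ 0 := by
  obtain ⟨T, hT⟩ := exists_norm_Gammaℝ_mono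
  refine ⟨T, fun t ht => ?_⟩
  have hs : (1 / 2 + t * I : ℂ) ≠ 1 := fun h => by
    have := congrArg re h
    norm_num at this
  have hζ : HasDerivAt (fun δ : ℝ => riemannZeta ((1 / 2 + δ : ℝ) + t * I))
      (deriv riemannZeta (1 / 2 + t * I)) 0 := by
    have hin : HasDerivAt (fun δ : ℝ => (((1 / 2 + δ : ℝ) : ℂ) + t * I)) 1 0 :=
      (((hasDerivAt_id (0 : ℝ)).const_add (1 / 2)).ofReal_comp).add_const _
    have := HasDerivAt.scomp (𝕜 := ℝ) (𝕜' := ℂ) (0 : ℝ) (g₁ := riemannZeta)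
      (g₁' := deriv riemannZeta (1 / 2 + t * I))
      (h := fun δ : ℝ => (((1 / 2 + δ : ℝ) : ℂ) + t * I))
      (by simpa using! (differentiableAt_riemannZeta hs).hasDerivAt) hin
    simpa [Function.comp_def] using this
  have hsq := hζ.norm_sq
  have hle := deriv_nonpos_of_le_reflection hsq (by
    filter_upwards [Ioo_mem_nhdsGT (show (0 : ℝ) < 1 / 2 by norm_num)] with δ hδ
    have := norm_riemannZeta_le_of_norm_Gammaℝ_le (t := t) hδ.1 hδ.2
      (hT t ht _ _ (by linarith [hδ.2]) (by linarith [hδ.1]))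
    rw [← sub_eq_add_neg]
    gcongr)
  simp only [Complex.inner, mul_re, conj_re, conj_im, add_zero] at hle
  push_cast at hle
  linarith

/-- There exists `A₀ > 0` such that for every real `a ≥ A₀` there is an `ε > 0` such
that no real `t` satisfies both `|ζ(1/2+it) − a| < ε` and `|ζ'(1/2+it) − a| < ε`. -/
theorem zeta_pair_avoids_large_real_diagonal :
    ∃ A₀ : ℝ, 0 < A₀ ∧ ∀ a : ℝ, A₀ ≤ a → ∃ ε : ℝ, 0 < ε ∧ ∀ t : ℝ,
      ¬ (‖riemannZeta (1 / 2 + t * I) - (a : ℂ)‖ < ε ∧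
         ‖deriv riemannZeta (1 / 2 + t * I) - (a : ℂ)‖ < ε) := by
  obtain ⟨T, hT⟩ := exists_re_conj_zeta_mul_deriv_zeta_nonpos
  have hcont : Continuous fun t : ℝ => riemannZeta (1 / 2 + t * I) := by
    refine continuous_iff_continuousAt.2 fun t => ?_
    have hs : (1 / 2 + t * I : ℂ) ≠ 1 := fun h => by
      have := congrArg re h
      norm_num at this
    exact ContinuousAt.comp (f := fun t : ℝ => (1 / 2 + t * I : ℂ))
      (differentiableAt_riemannZeta hs).continuousAt (by fun_prop)
  obtain ⟨M, hM⟩ := (isCompact_Icc (a := -T) (b := T)).exists_bound_of_continuousOn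
    hcont.continuousOn
  refine ⟨max M 1 + 1, by positivity, fun a ha => ⟨1 / 2, by norm_num, fun t ⟨h₁, h₂⟩ => ?_⟩⟩
  have haM : M + 1 ≤ a := le_trans (by gcongr; exact le_max_left _ _) ha
  have ha2 : 2 ≤ a := le_trans (by linarith [le_max_right M 1]) ha
  rcases le_or_gt T |t| with ht | ht
  · have hle := hT t ht
    have r₁ := abs_le.1 ((abs_re_le_norm _).trans h₁.le)
    have r₂ := abs_le.1 ((abs_re_le_norm _).trans h₂.le)
    have i₁ := abs_le.1 ((abs_im_le_norm _).trans h₁.le)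
    have i₂ := abs_le.1 ((abs_im_le_norm _).trans h₂.le)
    simp only [sub_re, sub_im, ofReal_re, ofReal_im, sub_zero] at r₁ r₂ i₁ i₂
    nlinarith
  · have hbound := hM t (abs_le.1 ht.le)
    have htri := norm_sub_norm_le (a : ℂ) (riemannZeta (1 / 2 + t * I))
    rw [norm_sub_rev, norm_real, Real.norm_of_nonneg (by linarith)] at htri
    linarith
end

section
/- For every complex number a there exist infinitely many simple a-values of the Riemann zeta function with arbitrarily large imaginary part; that is, for every real number T there exists s ∈ ℂ with Im s > T, ζ(s) = a, and ζ'(s) ≠ 0. -/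
open Complex

section

open Metric MeasureTheory Set

lemma log_norm_le_circleAverage {f : ℂ → ℂ} {c : ℂ} {R : ℝ} (hR : 0 < R)
    (hf : AnalyticOnNhd ℂ f (closedBall c R)) (hfc : f c ≠ 0) :
    Real.log ‖f c‖ ≤ Real.circleAverage (fun z ↦ Real.log ‖f z‖) c R := by
  have hf' : AnalyticOnNhd ℂ f (closedBall c |R|) := by rwa [abs_of_pos hR]
  rw [hf'.circleAverage_log_norm hR.ne' hfc]
  refine le_add_of_nonneg_left (finsum_nonneg fun u ↦ ?_)
  by_cases hu : u ∈ closedBall c |R|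
  · refine mul_nonneg (by exact_mod_cast MeromorphicOn.AnalyticOnNhd.divisor_nonneg hf' u) ?_
    rcases eq_or_ne u c with rfl | hne
    · simp
    · refine Real.log_nonneg ?_
      rw [← div_eq_mul_inv, one_le_div (norm_pos_iff.2 (sub_ne_zero.2 hne.symm))]
      rwa [abs_of_pos hR, mem_closedBall, dist_comm, dist_eq_norm] at hu
  · simp [hu]

lemma lintegral_circleMap_eq {v : ℂ → ℝ} {c : ℂ} {ρ : ℝ} (hv : CircleIntegrable v c ρ)
    (hv0 : ∀ z ∈ sphere c |ρ|, 0 ≤ v z) :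
    ∫⁻ θ in Ioo (-Real.pi) Real.pi, ENNReal.ofReal (v (circleMap c ρ θ)) =
      ENNReal.ofReal (2 * Real.pi * Real.circleAverage v c ρ) := by
  have hpi := Real.pi_pos
  have hper : Function.Periodic (fun θ ↦ v (circleMap c ρ θ)) (2 * Real.pi) :=
    fun x ↦ by simp [periodic_circleMap c ρ x]
  have hgi : IntervalIntegrable (fun θ ↦ v (circleMap c ρ θ)) volume (-Real.pi) Real.pi :=
    hper.intervalIntegrable₀ (by positivity) hv _ _
  rw [setLIntegral_congr Ioo_ae_eq_Ioc, ← ofReal_integral_eq_lintegral_ofReal]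
  · congr 1
    rw [Real.circleAverage_eq_integral_add (-Real.pi),
      intervalIntegral.integral_comp_add_right (fun θ ↦ v (circleMap c ρ θ)),
      ← intervalIntegral.integral_of_le (by linarith)]
    rw [show (0 : ℝ) + -Real.pi = -Real.pi by ring,
      show 2 * Real.pi + -Real.pi = Real.pi by ring, smul_eq_mul]
    field_simp
  · exact hgi.1
  · exact Filter.Eventually.of_forall fun θ ↦ hv0 _ (circleMap_mem_sphere' c ρ θ)

lemma setLIntegral_closedBall_eq_polar {g : ℂ → ENNReal} (hg : Measurable g) (c : ℂ) (R : ℝ) :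
    ∫⁻ z in closedBall c R, g z =
      ∫⁻ ρ in Ioc 0 R, ENNReal.ofReal ρ *
        ∫⁻ θ in Ioo (-Real.pi) Real.pi, g (circleMap c ρ θ) := by
  have h1 : ∫⁻ z in closedBall c R, g z
      = ∫⁻ z, (closedBall (0 : ℂ) R).indicator (fun w ↦ g (c + w)) z := by
    rw [← lintegral_indicator measurableSet_closedBall,
      ← lintegral_add_left_eq_self (μ := volume) _ c]
    refine lintegral_congr fun z ↦ ?_
    simp [Set.indicator]
  rw [h1, ← Complex.lintegral_comp_polarCoord_symm, polarCoord_target,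
    Measure.volume_eq_prod, ← Measure.prod_restrict, lintegral_prod]
  · rw [show Ioc 0 R = Ioi 0 ∩ Iic R from Ioi_inter_Iic.symm, inter_comm,
      ← Measure.restrict_restrict measurableSet_Iic, ← lintegral_indicator measurableSet_Iic]
    refine setLIntegral_congr_fun measurableSet_Ioi fun ρ hρ ↦ ?_
    have hρ' : 0 < ρ := hρ
    by_cases h : ρ ≤ R
    · simp only [Set.indicator, mem_Iic, h, if_true, smul_eq_mul]
      rw [← lintegral_const_mul' _ _ ENNReal.ofReal_ne_top]
      refine lintegral_congr fun θ ↦ ?_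
      have : ‖(Complex.polarCoord.symm (ρ, θ))‖ = ρ := by
        rw [Complex.norm_polarCoord_symm, abs_of_pos hρ']
      rw [if_pos (by rw [mem_closedBall_zero_iff, this]; exact h)]
      congr 2
      simp [circleMap, Complex.exp_mul_I]
    · simp only [Set.indicator, mem_Iic, h, if_false, smul_eq_mul]
      rw [lintegral_eq_zero_of_ae_eq_zero]
      refine Filter.Eventually.of_forall fun θ ↦ ?_
      have : ‖(Complex.polarCoord.symm (ρ, θ))‖ = ρ := by
        rw [Complex.norm_polarCoord_symm, abs_of_pos hρ']
      have hn : Complex.polarCoord.symm (ρ, θ) ∉ closedBall (0 : ℂ) R := by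
        rw [mem_closedBall_zero_iff, this]; exact h
      simp only [hn, if_false, mul_zero, Pi.zero_apply]
  · refine Measurable.aemeasurable ?_
    refine Measurable.smul (f := fun p : ℝ × ℝ ↦ ENNReal.ofReal p.1) (by fun_prop) ?_
    refine Measurable.comp (g := (closedBall (0 : ℂ) R).indicator (fun w ↦ g (c + w)))
      (Measurable.indicator (by fun_prop) measurableSet_closedBall) ?_
    have : (fun p : ℝ × ℝ ↦ Complex.polarCoord.symm p)
        = fun p ↦ (p.1 * (Real.cos p.2 + Real.sin p.2 * I) : ℂ) := by
      ext p; simp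
    change Measurable (fun p : ℝ × ℝ ↦ Complex.polarCoord.symm p)
    rw [this]
    fun_prop

lemma lintegral_Ioc_ofReal_mul {R : ℝ} (hR : 0 ≤ R) (A : ℝ) :
    ∫⁻ ρ in Ioc 0 R, ENNReal.ofReal ρ * ENNReal.ofReal (2 * Real.pi * A) =
      ENNReal.ofReal (Real.pi * R ^ 2 * A) := by
  have h : ∫⁻ ρ in Ioc 0 R, ENNReal.ofReal ρ = ENNReal.ofReal (R ^ 2 / 2) := by
    rw [← ofReal_integral_eq_lintegral_ofReal]
    · rw [← intervalIntegral.integral_of_le hR, integral_id]; simp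
    · exact (continuous_id.intervalIntegrable 0 R).1
    · filter_upwards [ae_restrict_mem measurableSet_Ioc] with x hx using hx.1.le
  rw [lintegral_mul_const _ (by fun_prop), h, ← ENNReal.ofReal_mul (by positivity)]
  congr 1
  ring

lemma exists_circleAverage_sub_log_norm_le {f : ℂ → ℂ} {s₀ s : ℂ} {R r M : ℝ} (hM : 0 ≤ M)
    (hr : 0 < r) (hf : AnalyticOnNhd ℂ f (closedBall s₀ R))
    (hsub : closedBall s r ⊆ closedBall s₀ R) (hfM : ∀ z ∈ closedBall s₀ R, ‖f z‖ ≤ Real.exp M)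
    (hf0 : f s₀ ≠ 0) :
    ∃ ρ ∈ Ioc 0 r, Real.circleAverage (fun z ↦ M - Real.log ‖f z‖) s ρ ≤
      R ^ 2 / r ^ 2 * (M - Real.log ‖f s₀‖) + 1 := by
  set v : ℂ → ℝ := fun z ↦ M - Real.log ‖f z‖ with hv
  have hR : 0 ≤ R := by
    have := hsub (mem_closedBall_self hr.le)
    rw [mem_closedBall] at this
    exact dist_nonneg.trans this
  have hv0 : ∀ z ∈ closedBall s₀ R, 0 ≤ v z := by
    intro z hz
    rcases eq_or_ne (f z) 0 with h | h
    · simp [hv, h, hM]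
    · have := Real.log_le_log (norm_pos_iff.2 h) (hfM z hz)
      rw [Real.log_exp] at this
      simp only [hv]; linarith
  have hci : ∀ c ρ, 0 < ρ → closedBall c ρ ⊆ closedBall s₀ R → CircleIntegrable v c ρ := by
    intro c ρ hρ hc
    refine CircleIntegrable.sub (circleIntegrable_const _ _ _) ?_
    refine MeromorphicOn.circleIntegrable_log_norm fun z hz ↦ (hf z (hc ?_)).meromorphicAt
    rw [abs_of_pos hρ] at hz
    exact sphere_subset_closedBall hz
  set G : ℂ → ENNReal := (closedBall s₀ R).indicator fun z ↦ ENNReal.ofReal (v z) with hG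
  have hGm : Measurable G := by
    have hfm : Measurable ((closedBall s₀ R).indicator f) := by
      classical
      rw [← Set.piecewise_eq_indicator]
      exact ContinuousOn.measurable_piecewise hf.continuousOn continuousOn_const
        measurableSet_closedBall
    have hGe : G = (closedBall s₀ R).indicator fun z ↦
        ENNReal.ofReal (M - Real.log ‖(closedBall s₀ R).indicator f z‖) := by
      rw [hG]
      refine Set.indicator_congr fun z hz ↦ ?_
      rw [Set.indicator_of_mem hz]
    rw [hGe]
    exact Measurable.indicator (by fun_prop) measurableSet_closedBall
  have key : ∀ c ρ, 0 < ρ → closedBall c ρ ⊆ closedBall s₀ R →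
      ∫⁻ θ in Ioo (-Real.pi) Real.pi, G (circleMap c ρ θ) =
        ENNReal.ofReal (2 * Real.pi * Real.circleAverage v c ρ) := by
    intro c ρ hρ hc
    have hs : sphere c |ρ| ⊆ closedBall s₀ R := by
      rw [abs_of_pos hρ]; exact sphere_subset_closedBall.trans hc
    rw [← lintegral_circleMap_eq (hci c ρ hρ hc) fun z hz ↦ hv0 z (hs hz)]
    refine lintegral_congr fun θ ↦ ?_
    rw [hG, Set.indicator_of_mem (hs (circleMap_mem_sphere' c ρ θ))]
  by_contra! hcon
  have hlow : ENNReal.ofReal (Real.pi * r ^ 2 * (R ^ 2 / r ^ 2 * v s₀ + 1)) ≤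
      ∫⁻ z in closedBall s r, G z := by
    rw [setLIntegral_closedBall_eq_polar hGm, ← lintegral_Ioc_ofReal_mul hr.le]
    refine setLIntegral_mono' measurableSet_Ioc fun ρ hρ ↦ ?_
    rw [key s ρ hρ.1 ((closedBall_subset_closedBall hρ.2).trans hsub)]
    gcongr
    exact (hcon ρ hρ).le
  have hup : ∫⁻ z in closedBall s₀ R, G z ≤ ENNReal.ofReal (Real.pi * R ^ 2 * v s₀) := by
    rw [setLIntegral_closedBall_eq_polar hGm, ← lintegral_Ioc_ofReal_mul hR]
    refine setLIntegral_mono' measurableSet_Ioc fun ρ hρ ↦ ?_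
    have hc : closedBall s₀ ρ ⊆ closedBall s₀ R := closedBall_subset_closedBall hρ.2
    rw [key s₀ ρ hρ.1 hc]
    gcongr
    have h1 := log_norm_le_circleAverage hρ.1 (hf.mono hc) hf0
    have h2 : Real.circleAverage v s₀ ρ
        = M - Real.circleAverage (fun z ↦ Real.log ‖f z‖) s₀ ρ := by
      have := Real.circleAverage_sub (c := s₀) (R := ρ) (f₁ := fun _ ↦ M)
        (f₂ := fun z ↦ Real.log ‖f z‖) (circleIntegrable_const _ _ _)
        (MeromorphicOn.circleIntegrable_log_norm fun z hz ↦ (hf z (hc (by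
          rw [abs_of_pos hρ.1] at hz
          exact sphere_subset_closedBall hz))).meromorphicAt)
      rw [Real.circleAverage_const] at this
      exact this
    rw [h2]
    simp only [hv]
    linarith
  have h3 := hlow.trans ((lintegral_mono_set hsub).trans hup)
  have hv00 : 0 ≤ v s₀ := hv0 _ (mem_closedBall_self hR)
  rw [ENNReal.ofReal_le_ofReal_iff (by positivity)] at h3
  have h4 : Real.pi * r ^ 2 * (R ^ 2 / r ^ 2 * v s₀ + 1)
      = Real.pi * R ^ 2 * v s₀ + Real.pi * r ^ 2 := by field_simp
  have : 0 < Real.pi * r ^ 2 := by positivity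
  linarith

/-- An analytic function `g` is controlled by upper bounds for `f` and `g * f` and the value of
`f` at a single point. -/
lemma norm_le_exp_of_norm_mul_le {f g : ℂ → ℂ} {s₀ s : ℂ} {R r M : ℝ} (hM : 0 ≤ M)
    (hr : 0 < r) (hf : AnalyticOnNhd ℂ f (closedBall s₀ R))
    (hg : AnalyticOnNhd ℂ g (closedBall s₀ R))
    (hsub : closedBall s r ⊆ closedBall s₀ R) (hfM : ∀ z ∈ closedBall s₀ R, ‖f z‖ ≤ Real.exp M)
    (hhM : ∀ z ∈ closedBall s₀ R, ‖g z * f z‖ ≤ Real.exp M) (hf0 : f s₀ ≠ 0) :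
    ‖g s‖ ≤ Real.exp (M + (R ^ 2 / r ^ 2 * (M - Real.log ‖f s₀‖) + 1)) := by
  obtain ⟨ρ, ⟨hρ0, hρr⟩, hρ⟩ := exists_circleAverage_sub_log_norm_le hM hr hf hsub hfM hf0
  rcases eq_or_ne (g s) 0 with h0 | h0
  · rw [h0, norm_zero]; positivity
  have hcs : closedBall s ρ ⊆ closedBall s₀ R := (closedBall_subset_closedBall hρr).trans hsub
  have hss : sphere s |ρ| ⊆ closedBall s₀ R := by
    rw [abs_of_pos hρ0]; exact sphere_subset_closedBall.trans hcs
  rw [← Real.log_le_iff_le_exp (norm_pos_iff.2 h0)]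
  refine (log_norm_le_circleAverage hρ0 (hg.mono hcs) h0).trans ?_
  have hif : CircleIntegrable (fun z ↦ M - Real.log ‖f z‖) s ρ :=
    CircleIntegrable.sub (circleIntegrable_const _ _ _)
      (MeromorphicOn.circleIntegrable_log_norm fun z hz ↦ (hf z (hss hz)).meromorphicAt)
  have hne : ∀ᶠ z in Filter.codiscreteWithin (sphere s |ρ|), f z ≠ 0 := by
    have hR : 0 ≤ R := dist_nonneg.trans (mem_closedBall.1 (hsub (mem_closedBall_self hr.le)))
    have := hf.preimage_zero_mem_codiscreteWithin (x := s₀) hf0 (mem_closedBall_self hR)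
      ⟨⟨s₀, mem_closedBall_self hR⟩, (convex_closedBall s₀ R).isPreconnected⟩
    exact Filter.codiscreteWithin_mono hss this
  have hcongr : Real.circleAverage (fun z ↦ Real.log ‖g z‖) s ρ
      = Real.circleAverage (fun z ↦ Real.log ‖g z * f z / f z‖) s ρ := by
    refine Real.circleAverage_congr_codiscreteWithin ?_ hρ0.ne'
    filter_upwards [hne, Filter.self_mem_codiscreteWithin _] with z hz hz'
    rw [mul_div_cancel_right₀ _ hz]
  have hadd : Real.circleAverage (fun z ↦ M + (M - Real.log ‖f z‖)) s ρ
      = M + Real.circleAverage (fun z ↦ M - Real.log ‖f z‖) s ρ := by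
    have := Real.circleAverage_add (c := s) (R := ρ) (f₁ := fun _ ↦ M)
      (circleIntegrable_const _ _ _) hif
    rw [Real.circleAverage_const] at this
    exact this
  rw [hcongr]
  refine (Real.circleAverage_mono ?_ ((circleIntegrable_const M _ _).add hif) ?_).trans
    (hadd.le.trans (by gcongr))
  · refine MeromorphicOn.circleIntegrable_log_norm fun z hz ↦
      MeromorphicAt.div ((hg z (hss hz)).mul (hf z (hss hz))).meromorphicAt
        (hf z (hss hz)).meromorphicAt
  · intro z hz
    have hz' := hss hz
    have hlf : Real.log ‖f z‖ ≤ M := by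
      rcases eq_or_ne (f z) 0 with h | h
      · simp [h, hM]
      · rw [Real.log_le_iff_le_exp (norm_pos_iff.2 h)]; exact hfM z hz'
    by_cases hq : g z * f z / f z = 0
    · simp only [hq, norm_zero, Real.log_zero, Pi.add_apply]; linarith
    · have hh : g z * f z ≠ 0 := fun h' ↦ hq (by simp [h'])
      have hf' : f z ≠ 0 := fun h' ↦ hq (by simp [h'])
      rw [norm_div, Real.log_div (norm_ne_zero_iff.2 hh) (norm_ne_zero_iff.2 hf')]
      have := (Real.log_le_iff_le_exp (norm_pos_iff.2 hh)).2 (hhM z hz')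
      simp only [Pi.add_apply]; linarith

end

section

open MeasureTheory Set Filter Topology

lemma integral_boundary_half_strip_eq_zero {G : ℂ → ℂ} {a b T : ℝ} {u : ℝ → ℝ} (hab : a ≤ b)
    (hG : DifferentiableOn ℂ G (Icc a b ×ℂ Ici T))
    (hu : Tendsto u atTop (𝓝 0))
    (hGu : ∀ x ∈ Icc a b, ∀ y ≥ T, ‖G (x + y * I)‖ ≤ u y)
    (ha : IntegrableOn (fun t : ℝ ↦ G (a + t * I)) (Ioi T))
    (hb : IntegrableOn (fun t : ℝ ↦ G (b + t * I)) (Ioi T)) :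
    (∫ x in a..b, G (x + T * I)) + I * (∫ t in Ioi T, G (b + t * I))
      - I * (∫ t in Ioi T, G (a + t * I)) = 0 := by
  have hrect : ∀ Y ≥ T, (∫ x in a..b, G (x + T * I)) - (∫ x in a..b, G (x + Y * I))
      + I * (∫ t in T..Y, G (b + t * I)) - I * (∫ t in T..Y, G (a + t * I)) = 0 := by
    intro Y hY
    have := Complex.integral_boundary_rect_eq_zero_of_differentiableOn G (a + T * I) (b + Y * I)
      (hG.mono (by
        intro z hz
        rw [mem_reProdIm] at hz ⊢
        simp only [add_re, ofReal_re, mul_re, I_re, mul_zero, ofReal_im, I_im, mul_one, sub_self,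
          add_zero, add_im, mul_im, zero_add, uIcc_of_le hab, uIcc_of_le hY] at hz
        exact ⟨hz.1, hz.2.1⟩))
    simpa using this
  have htop : Tendsto (fun Y : ℝ ↦ ∫ x in a..b, G (x + Y * I)) atTop (𝓝 0) := by
    refine squeeze_zero_norm' (a := fun Y ↦ u Y * |b - a|) ?_ (by simpa using hu.mul_const _)
    filter_upwards [eventually_ge_atTop T] with Y hY
    refine intervalIntegral.norm_integral_le_of_norm_le_const fun x hx ↦ ?_
    rw [uIoc_of_le hab] at hx
    exact hGu x ⟨hx.1.le, hx.2⟩ Y hY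
  have hlim := ((htop.const_sub (∫ x in a..b, G (x + T * I))).add
    ((intervalIntegral_tendsto_integral_Ioi T hb tendsto_id).const_mul I)).sub
    ((intervalIntegral_tendsto_integral_Ioi T ha tendsto_id).const_mul I)
  rw [sub_zero] at hlim
  refine tendsto_nhds_unique hlim (tendsto_const_nhds.congr' ?_)
  filter_upwards [eventually_ge_atTop T] with Y hY
  exact (hrect Y hY).symm

/-- Comparison of the integrals of `G` along the two vertical sides of a half-strip. -/
lemma norm_integral_half_line_le {G : ℂ → ℂ} {a b T K : ℝ} (hab : a ≤ b)
    (hG : DifferentiableOn ℂ G (Icc a b ×ℂ Ici T))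
    (hGK : ∀ x ∈ Icc a b, ∀ y ≥ T, ‖G (x + y * I)‖ ≤ Real.exp (K * (1 + y)))
    (ha : IntegrableOn (fun t : ℝ ↦ G (a + t * I)) (Ioi T))
    (hb : IntegrableOn (fun t : ℝ ↦ G (b + t * I)) (Ioi T)) :
    ‖∫ t in Ioi T, G (a + t * I)‖ ≤
      ‖∫ t in Ioi T, G (b + t * I)‖ + ‖∫ x in a..b, G (x + T * I)‖ := by
  set B : ℝ := max (a ^ 2) (b ^ 2) with hB
  have hxB : ∀ x ∈ Icc a b, x ^ 2 ≤ B := by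
    intro x hx
    rcases le_total 0 x with h | h
    · exact le_max_of_le_right (by nlinarith [hx.1, hx.2])
    · exact le_max_of_le_left (by nlinarith [hx.1, hx.2])
  have hB0 : 0 ≤ B := le_max_of_le_left (sq_nonneg a)
  have hexp : ∀ ε : ℝ, 0 ≤ ε → ∀ x ∈ Icc a b, ∀ y : ℝ,
      ‖exp (ε * (x + y * I) ^ 2)‖ ≤ Real.exp (ε * (B - y ^ 2)) := by
    intro ε hε x hx y
    rw [norm_exp]
    refine Real.exp_le_exp.2 ?_
    have : (ε * (x + y * I) ^ 2 : ℂ).re = ε * (x ^ 2 - y ^ 2) := by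
      simp [sq]
    rw [this]
    exact mul_le_mul_of_nonneg_left (by linarith [hxB x hx]) hε
  have hexp1 : ∀ ε : ℝ, 0 ≤ ε → ε ≤ 1 → ∀ x ∈ Icc a b, ∀ y : ℝ,
      ‖exp (ε * (x + y * I) ^ 2)‖ ≤ Real.exp B := by
    intro ε hε hε1 x hx y
    refine (hexp ε hε x hx y).trans (Real.exp_le_exp.2 ?_)
    nlinarith [sq_nonneg y, mul_nonneg hε (sq_nonneg y)]
  have haI : a ∈ Icc a b := ⟨le_rfl, hab⟩
  have hbI : b ∈ Icc a b := ⟨hab, le_rfl⟩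
  have hgi : ∀ ε : ℝ, 0 ≤ ε → ε ≤ 1 → ∀ x ∈ Icc a b,
      IntegrableOn (fun t : ℝ ↦ G (x + t * I)) (Ioi T) →
      IntegrableOn (fun t : ℝ ↦ exp (ε * (x + t * I) ^ 2) * G (x + t * I)) (Ioi T) := by
    intro ε hε hε1 x hx hi
    refine Integrable.bdd_mul (c := Real.exp B) hi ?_ ?_
    · exact (by fun_prop : Continuous fun t : ℝ ↦ exp (ε * (x + t * I) ^ 2)).aestronglyMeasurable
    · exact Eventually.of_forall fun t ↦ hexp1 ε hε hε1 x hx t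
  have hzero : ∀ ε : ℝ, 0 < ε → ε ≤ 1 →
      (∫ x in a..b, exp (ε * (x + T * I) ^ 2) * G (x + T * I))
      + I * (∫ t in Ioi T, exp (ε * (b + t * I) ^ 2) * G (b + t * I))
      - I * (∫ t in Ioi T, exp (ε * (a + t * I) ^ 2) * G (a + t * I)) = 0 := by
    intro ε hε hε1
    refine integral_boundary_half_strip_eq_zero (G := fun s ↦ exp (ε * s ^ 2) * G s)
      (u := fun y ↦ Real.exp (ε * (B - y ^ 2)) * Real.exp (K * (1 + y))) hab
      (DifferentiableOn.mul (by fun_prop) hG) ?_ ?_ (hgi ε hε.le hε1 a haI ha)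
      (hgi ε hε.le hε1 b hbI hb)
    · simp_rw [← Real.exp_add]
      refine Real.tendsto_exp_atBot.comp ?_
      have h1 : Tendsto (fun y : ℝ ↦ y * (-ε * y + K)) atTop atBot := by
        refine tendsto_id.atTop_mul_atBot₀ ?_
        exact tendsto_atBot_add_const_right _ _
          (tendsto_id.const_mul_atTop_of_neg (by linarith))
      refine (tendsto_atBot_add_const_right _ (ε * B + K) h1).congr fun y ↦ ?_
      ring
    · intro x hx y hy
      rw [norm_mul]
      exact mul_le_mul (hexp ε hε.le x hx y) (hGK x hx y hy) (norm_nonneg _) (Real.exp_nonneg _)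
  have hpt : ∀ z : ℂ, ∀ w : ℂ, Tendsto (fun ε : ℝ ↦ exp (ε * z ^ 2) * w) (𝓝[>] 0) (𝓝 w) := by
    intro z w
    have : Continuous fun ε : ℝ ↦ exp (ε * z ^ 2) * w := by fun_prop
    have h := this.tendsto 0
    simp only [ofReal_zero, zero_mul, Complex.exp_zero, one_mul] at h
    exact h.mono_left nhdsWithin_le_nhds
  have hev : ∀ᶠ ε : ℝ in 𝓝[>] 0, 0 < ε ∧ ε ≤ 1 := by
    filter_upwards [Ioc_mem_nhdsGT (zero_lt_one' ℝ)] with ε hε using hε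
  have hlimv : ∀ x ∈ Icc a b, IntegrableOn (fun t : ℝ ↦ G (x + t * I)) (Ioi T) →
      Tendsto (fun ε : ℝ ↦ ∫ t in Ioi T, exp (ε * (x + t * I) ^ 2) * G (x + t * I)) (𝓝[>] 0)
        (𝓝 (∫ t in Ioi T, G (x + t * I))) := by
    intro x hx hi
    refine tendsto_integral_filter_of_dominated_convergence
      (fun t ↦ Real.exp B * ‖G (x + t * I)‖) ?_ ?_ (hi.norm.const_mul _) ?_
    · filter_upwards [hev] with ε hε using (hgi ε hε.1.le hε.2 x hx hi).aestronglyMeasurable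
    · filter_upwards [hev] with ε hε
      refine Eventually.of_forall fun t ↦ ?_
      rw [norm_mul]
      gcongr
      exact hexp1 ε hε.1.le hε.2 x hx t
    · exact Eventually.of_forall fun t ↦ hpt _ _
  have hcontb : ContinuousOn (fun x : ℝ ↦ G (x + T * I)) (Icc a b) := by
    refine hG.continuousOn.comp (by fun_prop) fun x hx ↦ ?_
    rw [mem_reProdIm]
    simpa using hx
  have hib : IntervalIntegrable (fun x : ℝ ↦ G (x + T * I)) volume a b :=
    hcontb.intervalIntegrable_of_Icc hab
  have hlimb : Tendsto (fun ε : ℝ ↦ ∫ x in a..b, exp (ε * (x + T * I) ^ 2) * G (x + T * I))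
      (𝓝[>] 0) (𝓝 (∫ x in a..b, G (x + T * I))) := by
    refine intervalIntegral.tendsto_integral_filter_of_dominated_convergence
      (fun x ↦ Real.exp B * ‖G (x + T * I)‖) ?_ ?_ (hib.norm.const_mul _) ?_
    · refine Eventually.of_forall fun ε ↦ ?_
      refine (Continuous.aestronglyMeasurable (by fun_prop)).mul ?_
      rw [uIoc_of_le hab]
      exact hib.1.aestronglyMeasurable
    · filter_upwards [hev] with ε hε
      refine Eventually.of_forall fun x hx ↦ ?_
      rw [uIoc_of_le hab] at hx
      rw [norm_mul]
      gcongr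
      exact hexp1 ε hε.1.le hε.2 x ⟨hx.1.le, hx.2⟩ T
    · exact Eventually.of_forall fun x _ ↦ hpt _ _
  have hlim := (hlimb.add ((hlimv b hbI hb).const_mul I)).sub ((hlimv a haI ha).const_mul I)
  have h0 : (∫ x in a..b, G (x + T * I)) + I * (∫ t in Ioi T, G (b + t * I))
      - I * (∫ t in Ioi T, G (a + t * I)) = 0 := by
    refine tendsto_nhds_unique hlim (tendsto_const_nhds.congr' ?_)
    filter_upwards [hev] with ε hε
    exact (hzero ε hε.1 hε.2).symm
  have h1 := congrArg norm (sub_eq_zero.1 h0)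
  rw [norm_mul, norm_I, one_mul] at h1
  rw [← h1, add_comm]
  refine (norm_add_le _ _).trans ?_
  rw [norm_mul, norm_I, one_mul, add_comm]

end

section

open Filter Topology Set

/-- The summands of the logarithm of Euler's limit formula for `z * Γ(z)`. -/
noncomputable def logGammaTerm (j : ℕ) (z : ℂ) : ℂ :=
  z * (Real.log (j + 1) - Real.log j : ℝ) - log (1 + z / (j + 1))

/-- The derivative of `logGammaTerm j`. -/
noncomputable def digammaTerm (j : ℕ) (z : ℂ) : ℂ :=
  (Real.log (j + 1) - Real.log j : ℝ) - (j + 1 + z)⁻¹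

lemma half_le_norm_natCast_add {z : ℂ} (hz : -(1 / 2) < z.re) (j : ℕ) :
    ((j : ℝ) + 1) / 2 ≤ ‖(j + 1 + z : ℂ)‖ := by
  refine le_trans ?_ (re_le_norm _)
  simp only [add_re, natCast_re, one_re]
  have : (0 : ℝ) ≤ j := j.cast_nonneg
  linarith

lemma natCast_add_ne_zero {z : ℂ} (hz : -(1 / 2) < z.re) (j : ℕ) : (j + 1 + z : ℂ) ≠ 0 := by
  rw [← norm_pos_iff]
  exact lt_of_lt_of_le (by positivity) (half_le_norm_natCast_add hz j)

lemma hasDerivAt_logGammaTerm (j : ℕ) {z : ℂ} (hz : -(1 / 2) < z.re) :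
    HasDerivAt (logGammaTerm j) (digammaTerm j z) z := by
  have hj : ((j : ℂ) + 1) ≠ 0 := by exact_mod_cast j.succ_ne_zero
  have hslit : 1 + z / (j + 1) ∈ slitPlane := by
    left
    have : (z / (j + 1)).re = z.re / (j + 1) := by
      have := div_ofReal_re z (j + 1)
      push_cast at this
      exact this
    rw [add_re, one_re, this]
    have hj0 : (0 : ℝ) ≤ j := j.cast_nonneg
    rw [← sub_neg_eq_add, sub_pos, ← neg_div, div_lt_one (by positivity)]
    linarith
  have h1 : HasDerivAt (fun w : ℂ ↦ 1 + w / (j + 1)) (1 / (j + 1)) z :=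
    ((hasDerivAt_id z).div_const _).const_add _
  have h2 := ((hasDerivAt_id z).mul_const ((Real.log (j + 1) - Real.log j : ℝ) : ℂ)).sub
    (h1.clog hslit)
  refine h2.congr_deriv ?_
  have := natCast_add_ne_zero hz j
  rw [digammaTerm, one_mul, div_div, mul_add, mul_one, mul_div_cancel₀ _ hj, one_div]

lemma hasDerivAt_digammaTerm (j : ℕ) {z : ℂ} (hz : -(1 / 2) < z.re) :
    HasDerivAt (digammaTerm j) ((j + 1 + z) ^ 2)⁻¹ z := by
  have h1 : HasDerivAt (fun w : ℂ ↦ (j + 1 + w : ℂ)) 1 z := (hasDerivAt_id z).const_add _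
  refine ((h1.inv (natCast_add_ne_zero hz j)).const_sub _).congr_deriv ?_
  simp [neg_div]

lemma summable_inv_natCast_add_one_sq : Summable fun j : ℕ ↦ (((j : ℝ) + 1) ^ 2)⁻¹ := by
  have := (summable_nat_add_iff 1).2 (Real.summable_nat_pow_inv.2 (one_lt_two))
  simpa using this

lemma norm_digammaTerm_le (j : ℕ) {z : ℂ} (hz : -(1 / 2) < z.re) :
    ‖digammaTerm j z‖ ≤ (2 + 2 * ‖z‖) * (((j : ℝ) + 1) ^ 2)⁻¹ := by
  have hj0 : (0 : ℝ) ≤ j := j.cast_nonneg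
  have hsplit : digammaTerm j z = ((Real.log (j + 1) - Real.log j - ((j : ℝ) + 1)⁻¹ : ℝ) : ℂ)
      + z / ((j + 1) * (j + 1 + z)) := by
    have h1 := natCast_add_ne_zero hz j
    have h2 : ((j : ℂ) + 1) ≠ 0 := by exact_mod_cast j.succ_ne_zero
    rw [digammaTerm]
    push_cast
    field_simp
    ring
  have hreal : |Real.log (j + 1) - Real.log j - ((j : ℝ) + 1)⁻¹| ≤ 2 * (((j : ℝ) + 1) ^ 2)⁻¹ := by
    rcases Nat.eq_zero_or_pos j with rfl | hj
    · norm_num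
    have hj1 : (1 : ℝ) ≤ j := by exact_mod_cast hj
    have hj' : (0 : ℝ) < j := by linarith
    rw [← Real.log_div (by positivity) (by positivity)]
    have hup := Real.log_le_sub_one_of_pos (show 0 < ((j : ℝ) + 1) / j by positivity)
    have hlo := Real.one_sub_inv_le_log_of_pos (show 0 < ((j : ℝ) + 1) / j by positivity)
    rw [abs_le]
    constructor
    · have : 1 - (((j : ℝ) + 1) / j)⁻¹ = ((j : ℝ) + 1)⁻¹ := by field_simp; ring
      have : (0 : ℝ) ≤ 2 * (((j : ℝ) + 1) ^ 2)⁻¹ := by positivity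
      linarith
    · have : ((j : ℝ) + 1) / j - 1 - ((j : ℝ) + 1)⁻¹ ≤ 2 * (((j : ℝ) + 1) ^ 2)⁻¹ := by
        have : ((j : ℝ) + 1) / j - 1 - ((j : ℝ) + 1)⁻¹ = 1 / (j * (j + 1)) := by
          field_simp; ring
        rw [this, ← div_eq_mul_inv, div_le_div_iff₀ (by positivity) (by positivity)]
        nlinarith
      linarith
  rw [hsplit, add_mul 2]
  refine (norm_add_le _ _).trans (add_le_add ?_ ?_)
  · rw [norm_real]; exact hreal
  · have hn : ‖((j : ℂ) + 1)‖ = (j : ℝ) + 1 := by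
      have := norm_natCast (j + 1); push_cast at this; exact this
    rw [norm_div, norm_mul, hn, div_eq_mul_inv]
    have := half_le_norm_natCast_add hz j
    have h3 : (((j : ℝ) + 1) * ‖(j + 1 + z : ℂ)‖)⁻¹ ≤ 2 * (((j : ℝ) + 1) ^ 2)⁻¹ := by
      rw [show 2 * (((j : ℝ) + 1) ^ 2)⁻¹ = (((j : ℝ) + 1) * (((j : ℝ) + 1) / 2))⁻¹ by
        field_simp]
      gcongr
    nlinarith [norm_nonneg z]

lemma norm_inv_natCast_add_sq_le (j : ℕ) {z : ℂ} (hz : -(1 / 2) < z.re) :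
    ‖(((j + 1 + z : ℂ)) ^ 2)⁻¹‖ ≤ 4 * (((j : ℝ) + 1) ^ 2)⁻¹ := by
  have := half_le_norm_natCast_add hz j
  rw [norm_inv, norm_pow, show 4 * (((j : ℝ) + 1) ^ 2)⁻¹ = ((((j : ℝ) + 1) / 2) ^ 2)⁻¹ by
    field_simp; norm_num]
  gcongr

lemma isOpen_re_gt_inter_ball (A : ℝ) :
    IsOpen ({z : ℂ | -(1 / 2) < z.re} ∩ Metric.ball 0 A) :=
  (isOpen_lt continuous_const continuous_re).inter Metric.isOpen_ball

lemma isPreconnected_re_gt_inter_ball (A : ℝ) :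
    IsPreconnected ({z : ℂ | -(1 / 2) < z.re} ∩ Metric.ball 0 A) :=
  ((convex_halfSpace_re_gt _).inter (convex_ball _ _)).isPreconnected

lemma mem_re_gt_inter_ball {z : ℂ} (hz : -(1 / 2) < z.re) :
    z ∈ {z : ℂ | -(1 / 2) < z.re} ∩ Metric.ball 0 (‖z‖ + 1) := ⟨hz, by simp⟩

lemma summable_digammaTerm {z : ℂ} (hz : -(1 / 2) < z.re) :
    Summable fun j ↦ digammaTerm j z :=
  Summable.of_norm_bounded (summable_inv_natCast_add_one_sq.mul_left _)
    fun j ↦ norm_digammaTerm_le j hz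

lemma zero_mem_re_gt_inter_ball {z : ℂ} :
    0 ∈ {z : ℂ | -(1 / 2) < z.re} ∩ Metric.ball 0 (‖z‖ + 1) := by
  refine ⟨by simp, ?_⟩
  rw [Metric.mem_ball, dist_self]; positivity

lemma summable_logGammaTerm_zero : Summable fun j ↦ logGammaTerm j 0 := by
  simp [logGammaTerm, summable_zero]

lemma norm_digammaTerm_le_of_mem_ball {A : ℝ} (j : ℕ) {z : ℂ}
    (hz : z ∈ {z : ℂ | -(1 / 2) < z.re} ∩ Metric.ball 0 A) :
    ‖digammaTerm j z‖ ≤ (2 + 2 * A) * (((j : ℝ) + 1) ^ 2)⁻¹ := by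
  refine (norm_digammaTerm_le j hz.1).trans ?_
  have := hz.2
  rw [mem_ball_zero_iff] at this
  gcongr

lemma summable_logGammaTerm {z : ℂ} (hz : -(1 / 2) < z.re) :
    Summable fun j ↦ logGammaTerm j z :=
  summable_of_summable_hasDerivAt_of_isPreconnected
    (summable_inv_natCast_add_one_sq.mul_left (2 + 2 * (‖z‖ + 1)))
    (isOpen_re_gt_inter_ball (‖z‖ + 1)) (isPreconnected_re_gt_inter_ball _)
    (fun j _ hw ↦ hasDerivAt_logGammaTerm j hw.1)
    (fun j _ hw ↦ norm_digammaTerm_le_of_mem_ball j hw)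
    zero_mem_re_gt_inter_ball summable_logGammaTerm_zero (mem_re_gt_inter_ball hz)

lemma hasDerivAt_tsum_logGammaTerm {z : ℂ} (hz : -(1 / 2) < z.re) :
    HasDerivAt (fun z ↦ ∑' j, logGammaTerm j z) (∑' j, digammaTerm j z) z :=
  hasDerivAt_tsum_of_isPreconnected
    (summable_inv_natCast_add_one_sq.mul_left (2 + 2 * (‖z‖ + 1)))
    (isOpen_re_gt_inter_ball (‖z‖ + 1)) (isPreconnected_re_gt_inter_ball _)
    (fun j _ hw ↦ hasDerivAt_logGammaTerm j hw.1)
    (fun j _ hw ↦ norm_digammaTerm_le_of_mem_ball j hw)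
    zero_mem_re_gt_inter_ball summable_logGammaTerm_zero (mem_re_gt_inter_ball hz)

lemma hasDerivAt_tsum_digammaTerm {z : ℂ} (hz : -(1 / 2) < z.re) :
    HasDerivAt (fun z ↦ ∑' j, digammaTerm j z) (∑' j : ℕ, ((j + 1 + z : ℂ) ^ 2)⁻¹) z :=
  hasDerivAt_tsum_of_isPreconnected
    (summable_inv_natCast_add_one_sq.mul_left 4)
    (isOpen_re_gt_inter_ball (‖z‖ + 1)) (isPreconnected_re_gt_inter_ball _)
    (fun j _ hw ↦ hasDerivAt_digammaTerm j hw.1)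
    (fun j _ hw ↦ norm_inv_natCast_add_sq_le j hw.1)
    (mem_re_gt_inter_ball hz) (summable_digammaTerm hz) (mem_re_gt_inter_ball hz)

lemma exp_sum_logGammaTerm {z : ℂ} (hz : 0 < z.re) (n : ℕ) (hn : n ≠ 0) :
    exp (∑ j ∈ Finset.range n, logGammaTerm j z) / z = GammaSeq z n := by
  have hz' : -(1 / 2) < z.re := by linarith
  have hz0 : z ≠ 0 := by rintro rfl; simp at hz
  have hlog : ∑ j ∈ Finset.range n, ((Real.log (j + 1) - Real.log j : ℝ) : ℂ) = log n := by
    rw [← ofReal_sum]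
    have := Finset.sum_range_sub (fun j : ℕ ↦ Real.log j) n
    push_cast at this
    rw [this]
    simp [natCast_log]
  have hprod : ∏ j ∈ Finset.range n, exp (log (1 + z / (j + 1)))
      = (∏ j ∈ Finset.range n, (z + (j + 1 : ℕ))) / n.factorial := by
    rw [← Finset.prod_range_add_one_eq_factorial, Nat.cast_prod, ← Finset.prod_div_distrib]
    refine Finset.prod_congr rfl fun j _ ↦ ?_
    have h1 := natCast_add_ne_zero hz' j
    have h2 : ((j : ℂ) + 1) ≠ 0 := by exact_mod_cast j.succ_ne_zero
    rw [exp_log]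
    · push_cast; field_simp; ring
    · rw [show 1 + z / (j + 1) = (j + 1 + z) / (j + 1) by field_simp]
      exact div_ne_zero h1 h2
  simp only [logGammaTerm]
  rw [Finset.sum_sub_distrib, ← Finset.mul_sum, hlog, exp_sub, exp_sum, hprod, GammaSeq,
    Finset.prod_range_succ', cpow_def_of_ne_zero (by exact_mod_cast hn), mul_comm z]
  have hp : ∏ j ∈ Finset.range n, (z + (j + 1 : ℕ)) ≠ 0 := by
    refine Finset.prod_ne_zero_iff.2 fun j _ ↦ ?_
    have h1 := natCast_add_ne_zero hz' j
    rw [add_comm]; push_cast; exact h1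
  have hf : (n.factorial : ℂ) ≠ 0 := by exact_mod_cast n.factorial_ne_zero
  push_cast at hp ⊢
  field_simp
  simp [hz0]

lemma Gamma_eq_exp_tsum_logGammaTerm {z : ℂ} (hz : 0 < z.re) :
    Gamma z = exp (∑' j, logGammaTerm j z) / z := by
  have h1 := (summable_logGammaTerm (z := z) (by linarith)).hasSum.tendsto_sum_nat
  have h2 := ((continuous_exp.tendsto _).comp h1).div_const z
  refine tendsto_nhds_unique (GammaSeq_tendsto_Gamma z) (h2.congr' ?_)
  filter_upwards [eventually_ne_atTop 0] with n hn using exp_sum_logGammaTerm hz n hn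

lemma digamma_eq_tsum {z : ℂ} (hz : 0 < z.re) :
    digamma z = ∑' j, digammaTerm j z - z⁻¹ := by
  have hz0 : z ≠ 0 := by rintro rfl; simp at hz
  have hd := ((hasDerivAt_tsum_logGammaTerm (z := z) (by linarith)).cexp.div
    (hasDerivAt_id z) hz0)
  have heq : Gamma =ᶠ[𝓝 z] fun w ↦ exp (∑' j, logGammaTerm j w) / w := by
    filter_upwards [(isOpen_lt continuous_const continuous_re).mem_nhds hz] with w hw
    exact Gamma_eq_exp_tsum_logGammaTerm hw
  rw [digamma_def, logDeriv_apply, (hd.congr_of_eventuallyEq heq).deriv,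
    Gamma_eq_exp_tsum_logGammaTerm hz]
  have := exp_ne_zero (∑' j, logGammaTerm j z)
  simp only [id]
  field_simp

lemma hasDerivAt_digamma {z : ℂ} (hz : 0 < z.re) :
    HasDerivAt digamma (∑' j : ℕ, ((j + 1 + z : ℂ) ^ 2)⁻¹ + (z ^ 2)⁻¹) z := by
  have hz0 : z ≠ 0 := by rintro rfl; simp at hz
  have hd := (hasDerivAt_tsum_digammaTerm (z := z) (by linarith)).sub (hasDerivAt_inv hz0)
  rw [sub_neg_eq_add] at hd
  refine hd.congr_of_eventuallyEq ?_
  filter_upwards [(isOpen_lt continuous_const continuous_re).mem_nhds hz] with w hw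
  exact digamma_eq_tsum hw

lemma hasSum_inv_sub_inv {t : ℝ} (ht : 0 < t) :
    HasSum (fun j : ℕ ↦ ((j : ℝ) + t)⁻¹ - ((j : ℝ) + 1 + t)⁻¹) t⁻¹ := by
  rw [hasSum_iff_tendsto_nat_of_nonneg]
  · have h := fun n ↦ Finset.sum_range_sub' (fun j : ℕ ↦ ((j : ℝ) + t)⁻¹) n
    push_cast at h
    simp only [h]
    have : Tendsto (fun n : ℕ ↦ ((n : ℝ) + t)⁻¹) atTop (𝓝 0) :=
      tendsto_inv_atTop_zero.comp (tendsto_atTop_add_const_right _ _ tendsto_natCast_atTop_atTop)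
    simpa using this.const_sub (((0 : ℝ) + t)⁻¹)
  · intro j
    rw [sub_nonneg]
    gcongr
    linarith

lemma norm_deriv_digamma_le {z : ℂ} (hz : 0 < z.re) {t : ℝ} (ht : 1 ≤ t) (hzt : |z.im| = t) :
    ‖∑' j : ℕ, ((j + 1 + z : ℂ) ^ 2)⁻¹ + (z ^ 2)⁻¹‖ ≤ 3 / t := by
  have ht0 : 0 < t := by linarith
  have hbound : ∀ j : ℕ, ‖((j + 1 + z : ℂ) ^ 2)⁻¹‖ ≤
      2 * (((j : ℝ) + t)⁻¹ - ((j : ℝ) + 1 + t)⁻¹) := by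
    intro j
    have hj0 : (0 : ℝ) ≤ j := j.cast_nonneg
    have h1 : ‖(j + 1 + z : ℂ)‖ ^ 2 = (j + 1 + z.re) ^ 2 + t ^ 2 := by
      rw [← hzt, sq_abs, ← normSq_eq_norm_sq, normSq_apply]
      simp; ring
    have h2 : 2 * (((j : ℝ) + t)⁻¹ - ((j : ℝ) + 1 + t)⁻¹)
        = ((((j : ℝ) + t) * ((j : ℝ) + 1 + t)) / 2)⁻¹ := by field_simp; ring
    rw [norm_inv, norm_pow, h1, h2]
    gcongr
    nlinarith [sq_nonneg ((j : ℝ) + 1 - t)]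
  have h1 : ‖∑' j : ℕ, ((j + 1 + z : ℂ) ^ 2)⁻¹‖ ≤ 2 * t⁻¹ :=
    tsum_of_norm_bounded ((hasSum_inv_sub_inv ht0).mul_left 2) hbound
  have h2 : ‖(z ^ 2)⁻¹‖ ≤ t⁻¹ := by
    rw [norm_inv, norm_pow]
    have : t ≤ ‖z‖ := hzt ▸ abs_im_le_norm z
    gcongr
    nlinarith
  refine (norm_add_le _ _).trans ((add_le_add h1 h2).trans (le_of_eq ?_))
  field_simp; norm_num

end

section

open MeasureTheory Set Filter Topology

lemma norm_Gamma_le {z : ℂ} (hz : 0 < z.re) : ‖Gamma z‖ ≤ Real.Gamma z.re := by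
  rw [Gamma_eq_integral hz, Real.Gamma_eq_integral hz, GammaIntegral]
  refine (norm_integral_le_integral_norm _).trans (le_of_eq ?_)
  refine setIntegral_congr_fun measurableSet_Ioi fun x hx ↦ ?_
  have hx' : (0 : ℝ) < x := hx
  simp only [norm_mul, norm_real, norm_cpow_eq_rpow_re_of_pos hx', sub_re, one_re,
    Real.norm_eq_abs, Real.abs_exp]

lemma exists_norm_mellin_le {f : ℝ → ℂ} (hf : ∀ s, MellinConvergent f s) (A B : ℝ) :
    ∃ M, ∀ s : ℂ, A ≤ s.re → s.re ≤ B → ‖mellin f s‖ ≤ M := by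
  refine ⟨(∫ t in Ioi (0 : ℝ), ‖(t : ℂ) ^ ((A : ℂ) - 1) • f t‖)
    + ∫ t in Ioi (0 : ℝ), ‖(t : ℂ) ^ ((B : ℂ) - 1) • f t‖, fun s hA hB ↦ ?_⟩
  rw [mellin, ← integral_add (hf A).norm (hf B).norm]
  refine (norm_integral_le_integral_norm _).trans ?_
  refine setIntegral_mono_on (hf s).norm ((hf A).norm.add (hf B).norm) measurableSet_Ioi
    fun t ht ↦ ?_
  have ht' : (0 : ℝ) < t := ht
  simp only [norm_smul, norm_cpow_eq_rpow_re_of_pos ht', sub_re, one_re, ofReal_re, ← add_mul]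
  refine mul_le_mul_of_nonneg_right ?_ (norm_nonneg _)
  rcases le_total t 1 with h | h
  · have := Real.rpow_le_rpow_of_exponent_ge ht' h (show A - 1 ≤ s.re - 1 by linarith)
    have := Real.rpow_nonneg ht'.le (B - 1)
    linarith
  · have := Real.rpow_le_rpow_of_exponent_le h (show s.re - 1 ≤ B - 1 by linarith)
    have := Real.rpow_nonneg ht'.le (A - 1)
    linarith

lemma exists_norm_completedRiemannZeta₀_le (A B : ℝ) :
    ∃ M, ∀ s : ℂ, A ≤ s.re → s.re ≤ B → ‖completedRiemannZeta₀ s‖ ≤ M := by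
  obtain ⟨M, hM⟩ := exists_norm_mellin_le (f := (HurwitzZeta.hurwitzEvenFEPair 0).f_modif)
    (fun s ↦ ((HurwitzZeta.hurwitzEvenFEPair 0).isStrongFEPair_toStrongFEPair.hasMellin s).1)
    (A / 2) (B / 2)
  refine ⟨M / 2, fun s hA hB ↦ ?_⟩
  have hre : (s / 2).re = s.re / 2 := by simp
  have := hM (s / 2) (by rw [hre]; linarith) (by rw [hre]; linarith)
  rw [completedRiemannZeta₀, HurwitzZeta.completedHurwitzZetaEven₀, WeakFEPair.Λ₀, norm_div,
    Complex.norm_two]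
  gcongr

lemma norm_sin_le_exp (z : ℂ) : ‖sin z‖ ≤ Real.exp |z.im| := by
  rw [Complex.sin, norm_div, norm_mul, norm_I, mul_one, Complex.norm_two, div_le_iff₀ two_pos]
  refine (norm_sub_le _ _).trans ?_
  rw [norm_exp, norm_exp, mul_two]
  have h1 : (-z * I).re = z.im := by simp
  have h2 : (z * I).re = -z.im := by simp
  rw [h1, h2]
  exact add_le_add (Real.exp_le_exp.2 (le_abs_self _)) (Real.exp_le_exp.2 (neg_le_abs _))

lemma exists_norm_inv_Gammaℝ_le (A : ℝ) :
    ∃ M, ∀ s : ℂ, A ≤ s.re → s.re ≤ 3 / 2 → ‖(Gammaℝ s)⁻¹‖ ≤ M * Real.exp (Real.pi * |s.im|) := by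
  have hpi := Real.pi_pos
  have hcont : ContinuousOn (fun x : ℝ ↦ Real.Gamma (1 - x / 2)) (Icc A (3 / 2)) := by
    intro x hx
    refine ContinuousAt.continuousWithinAt ?_
    refine ContinuousAt.comp (g := Real.Gamma) ?_ (by fun_prop)
    refine (Real.differentiableAt_Gamma fun m ↦ ?_).continuousAt
    have : (0 : ℝ) ≤ m := m.cast_nonneg
    have := hx.2
    intro h
    linarith
  obtain ⟨M, hM⟩ := (isCompact_Icc (a := A) (b := (3 : ℝ) / 2)).exists_bound_of_continuousOn hcont
  refine ⟨Real.pi * M, fun s hA hB ↦ ?_⟩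
  have hre : (1 - s / 2).re = 1 - s.re / 2 := by simp
  have hG : ‖Gamma (1 - s / 2)‖ ≤ M := by
    refine (norm_Gamma_le (by rw [hre]; linarith)).trans ?_
    rw [hre]
    exact (le_abs_self _).trans (hM s.re ⟨hA, hB⟩)
  have hM0 : 0 ≤ M := (norm_nonneg _).trans hG
  by_cases h0 : Gamma (s / 2) = 0
  · rw [Gammaℝ_def, h0, mul_zero, inv_zero, norm_zero]
    positivity
  have hrefl : (Gamma (s / 2))⁻¹ = Gamma (1 - s / 2) * sin (Real.pi * (s / 2)) / Real.pi := by
    have h := Gamma_mul_Gamma_one_sub (s / 2)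
    have hG0 : Gamma (1 - s / 2) ≠ 0 := Gamma_ne_zero_of_re_pos (by rw [hre]; linarith)
    have hs : sin (Real.pi * (s / 2)) ≠ 0 := by
      intro hs
      rw [hs, div_zero] at h
      exact (mul_ne_zero h0 hG0) h
    have hpi' : (Real.pi : ℂ) ≠ 0 := by exact_mod_cast hpi.ne'
    rw [eq_div_iff hs] at h
    rw [eq_div_iff hpi', inv_mul_eq_iff_eq_mul₀ h0, ← mul_assoc]
    exact h.symm
  rw [Gammaℝ_def, mul_inv, hrefl, norm_mul, norm_inv, norm_cpow_eq_rpow_re_of_pos hpi, norm_div,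
    norm_mul, norm_real, Real.norm_eq_abs, abs_of_pos hpi]
  have h1 : (Real.pi ^ ((-s / 2).re))⁻¹ ≤ Real.pi := by
    rw [← Real.rpow_neg hpi.le]
    refine (Real.rpow_le_rpow_of_exponent_le (y := -(-s / 2).re) (z := 1) ?_ ?_).trans
      (Real.rpow_one _).le
    · linarith [Real.two_le_pi]
    · simp only [neg_re, div_ofNat_re]; linarith
  have h2 : ‖sin (Real.pi * (s / 2))‖ ≤ Real.exp (Real.pi * |s.im|) := by
    refine (norm_sin_le_exp _).trans (Real.exp_le_exp.2 ?_)
    have : (Real.pi * (s / 2) : ℂ).im = Real.pi * (s.im / 2) := by simp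
    rw [this, abs_mul, abs_of_pos hpi, abs_div, abs_two]
    have := abs_nonneg s.im
    gcongr
    linarith
  have h3 : ‖Gamma (1 - s / 2)‖ * ‖sin (Real.pi * (s / 2))‖ / Real.pi ≤
      M * Real.exp (Real.pi * |s.im|) := by
    refine (div_le_self (by positivity) (by linarith [Real.two_le_pi])).trans ?_
    gcongr
  calc _ ≤ Real.pi * (M * Real.exp (Real.pi * |s.im|)) := by gcongr
    _ = _ := by ring

lemma norm_riemannZeta_le_tsum {σ : ℝ} (hσ : 1 < σ) {s : ℂ} (hs : σ ≤ s.re) :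
    ‖riemannZeta s‖ ≤ ∑' n : ℕ, 1 / ((n : ℝ) + 1) ^ σ := by
  rw [zeta_eq_tsum_one_div_nat_add_one_cpow (by linarith)]
  have hsum : Summable fun n : ℕ ↦ 1 / ((n : ℝ) + 1) ^ σ := by
    have := (summable_nat_add_iff 1).2 (Real.summable_one_div_nat_rpow.2 hσ)
    simpa using this
  refine tsum_of_norm_bounded hsum.hasSum fun n ↦ ?_
  have h : ‖((n : ℂ) + 1) ^ s‖ = ((n : ℝ) + 1) ^ s.re := by
    have := norm_natCast_cpow_of_pos (n := n + 1) (Nat.succ_pos n) s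
    push_cast at this
    exact this
  rw [norm_div, norm_one, h]
  have : (0 : ℝ) ≤ n := n.cast_nonneg
  gcongr
  linarith

/-- Exponential growth of `ζ` in half-planes, away from the real axis. -/
lemma exists_norm_riemannZeta_le_exp (A : ℝ) :
    ∃ C, 0 ≤ C ∧ ∀ s : ℂ, A ≤ s.re → 1 ≤ s.im → ‖riemannZeta s‖ ≤ Real.exp (C * s.im) := by
  obtain ⟨M₁, hM₁⟩ := exists_norm_completedRiemannZeta₀_le A (3 / 2)
  obtain ⟨M₂, hM₂⟩ := exists_norm_inv_Gammaℝ_le A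
  set M₃ := ∑' n : ℕ, 1 / ((n : ℝ) + 1) ^ (3 / 2 : ℝ) with hM₃
  have hM₃0 : 0 ≤ M₃ := tsum_nonneg fun n ↦ by positivity
  have hpi := Real.pi_pos
  set C := (|M₁| + 2) * |M₂| + M₃ + Real.pi with hC
  have hC0 : 0 ≤ C := by positivity
  refine ⟨C, hC0, fun s hA ht ↦ ?_⟩
  have hlin : ∀ x : ℝ, x ≤ Real.exp x := fun x ↦ by linarith [Real.add_one_le_exp x]
  rcases le_total s.re (3 / 2) with h | h
  · have hs0 : s ≠ 0 := by rintro rfl; norm_num at ht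
    have hs1 : 1 ≤ ‖s‖ := ht.trans ((le_abs_self _).trans (abs_im_le_norm s))
    have hs2 : 1 ≤ ‖1 - s‖ := by
      have := abs_im_le_norm (1 - s)
      rw [sub_im, one_im, zero_sub, abs_neg] at this
      exact ht.trans ((le_abs_self _).trans this)
    have hnum : ‖completedRiemannZeta s‖ ≤ |M₁| + 2 := by
      rw [completedRiemannZeta_eq]
      refine (norm_sub_le _ _).trans ?_
      have h1 : ‖1 / (1 - s)‖ ≤ 1 := by
        rw [norm_div, norm_one]; exact div_le_one_of_le₀ hs2 (by positivity)
      have h2 : ‖1 / s‖ ≤ 1 := by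
        rw [norm_div, norm_one]; exact div_le_one_of_le₀ hs1 (by positivity)
      have h3 := norm_sub_le (completedRiemannZeta₀ s) (1 / s)
      have h4 := (hM₁ s hA h).trans (le_abs_self M₁)
      linarith
    rw [riemannZeta_def_of_ne_zero hs0, div_eq_mul_inv, norm_mul]
    have h5 := hM₂ s hA h
    rw [abs_of_pos (by linarith : 0 < s.im)] at h5
    calc _ ≤ (|M₁| + 2) * (|M₂| * Real.exp (Real.pi * s.im)) := by
          gcongr
          exact h5.trans (by gcongr; exact le_abs_self _)
      _ = ((|M₁| + 2) * |M₂|) * Real.exp (Real.pi * s.im) := by ring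
      _ ≤ Real.exp ((|M₁| + 2) * |M₂|) * Real.exp (Real.pi * s.im) := by
          gcongr; exact hlin _
      _ = Real.exp ((|M₁| + 2) * |M₂| + Real.pi * s.im) := (Real.exp_add _ _).symm
      _ ≤ _ := by
          refine Real.exp_le_exp.2 ?_
          have : 0 ≤ (|M₁| + 2) * |M₂| := by positivity
          rw [hC]
          nlinarith
  · refine (norm_riemannZeta_le_tsum (by norm_num) h).trans ((hlin _).trans (Real.exp_le_exp.2 ?_))
    rw [← hM₃]
    have : M₃ ≤ C := by rw [hC]; have : 0 ≤ (|M₁| + 2) * |M₂| := by positivity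
                        linarith
    nlinarith

end

section

open ArithmeticFunction

/-- The Dirichlet coefficients of `ζ` times the derivative of `ζ' / ζ`. -/
noncomputable def vonMangoldtLogSum (n : ℕ) : ℝ := ∑ m ∈ n.divisors, Λ m * Real.log m

lemma vonMangoldtLogSum_nonneg (n : ℕ) : 0 ≤ vonMangoldtLogSum n :=
  Finset.sum_nonneg fun m _ ↦ mul_nonneg vonMangoldt_nonneg (Real.log_natCast_nonneg m)

lemma log_mul_sub_le_vonMangoldtLogSum {M : ℕ} (hM : 1 ≤ M) (n : ℕ) :
    Real.log M * (Real.log n - ∑ m ∈ Finset.range M, Λ m) ≤ vonMangoldtLogSum n := by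
  have hlogM : 0 ≤ Real.log M := Real.log_natCast_nonneg M
  have hterm : ∀ m ∈ n.divisors,
      Real.log M * Λ m - Real.log M * (if m ∈ Finset.range M then Λ m else 0) ≤
        Λ m * Real.log m := by
    intro m hm
    have hΛ : 0 ≤ Λ m := vonMangoldt_nonneg
    split_ifs with h
    · rw [sub_self]
      exact mul_nonneg hΛ (Real.log_natCast_nonneg m)
    · rw [Finset.mem_range, not_lt] at h
      have : Real.log M ≤ Real.log m :=
        Real.log_le_log (by exact_mod_cast hM) (by exact_mod_cast h)
      rw [mul_zero, sub_zero, mul_comm]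
      gcongr
  have hsum : ∑ m ∈ n.divisors, (if m ∈ Finset.range M then Λ m else 0) ≤
      ∑ m ∈ Finset.range M, Λ m := by
    rw [← Finset.sum_filter]
    refine Finset.sum_le_sum_of_subset_of_nonneg (fun m hm ↦ (Finset.mem_filter.1 hm).2)
      fun m _ _ ↦ vonMangoldt_nonneg
  have h := Finset.sum_le_sum hterm
  rw [Finset.sum_sub_distrib, ← Finset.mul_sum, ← Finset.mul_sum, vonMangoldt_sum] at h
  refine le_trans ?_ h
  rw [← mul_sub]
  gcongr

lemma exists_lt_sum_vonMangoldtLogSum_mul_exp (C : ℝ) :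
    ∃ N : ℕ, 1 ≤ N ∧ C * (1 + Real.log N) * N <
      ∑ n ∈ Finset.Ico N (2 * N), vonMangoldtLogSum n * Real.exp (-(n / N)) := by
  set C' := |C| + 1 with hC'
  have hC'0 : 0 < C' := by positivity
  obtain ⟨M, hM⟩ := exists_nat_ge (Real.exp (4 * C' * Real.exp 2))
  have hM0 : (0 : ℝ) < M := (Real.exp_pos _).trans_le hM
  have hM1 : 1 ≤ M := by exact_mod_cast hM0
  have hlogM : 4 * C' * Real.exp 2 ≤ Real.log M := by
    rwa [Real.le_log_iff_exp_le hM0]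
  set K := ∑ m ∈ Finset.range M, Λ m with hK
  have hK0 : 0 ≤ K := Finset.sum_nonneg fun m _ ↦ vonMangoldt_nonneg
  obtain ⟨N, hN⟩ := exists_nat_ge (Real.exp (2 * K + 1))
  have hN0 : (0 : ℝ) < N := (Real.exp_pos _).trans_le hN
  have hN1 : 1 ≤ N := by exact_mod_cast hN0
  have hlogN : 2 * K + 1 ≤ Real.log N := by
    rwa [Real.le_log_iff_exp_le hN0]
  refine ⟨N, hN1, ?_⟩
  have hterm : ∀ n ∈ Finset.Ico N (2 * N), 2 * C' * Real.log N ≤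
      vonMangoldtLogSum n * Real.exp (-(n / N)) := by
    intro n hn
    rw [Finset.mem_Ico] at hn
    have h1 : Real.log N ≤ Real.log n := Real.log_le_log hN0 (by exact_mod_cast hn.1)
    have h2 : Real.exp (-2) ≤ Real.exp (-(n / N)) := by
      refine Real.exp_le_exp.2 (neg_le_neg ?_)
      rw [div_le_iff₀ hN0]
      exact_mod_cast hn.2.le
    have h3 := log_mul_sub_le_vonMangoldtLogSum hM1 n
    have h4 : (4 * C' * Real.exp 2) * (Real.log N / 2) ≤ vonMangoldtLogSum n := by
      refine le_trans ?_ h3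
      gcongr
      linarith
    calc 2 * C' * Real.log N
        = ((4 * C' * Real.exp 2) * (Real.log N / 2)) * Real.exp (-2) := by
          rw [Real.exp_neg]
          field_simp
          ring
      _ ≤ _ := by
          refine mul_le_mul h4 h2 (Real.exp_nonneg _) (vonMangoldtLogSum_nonneg n)
  have h := Finset.card_nsmul_le_sum _ _ _ hterm
  rw [Nat.card_Ico, nsmul_eq_mul, show 2 * N - N = N by omega] at h
  refine lt_of_lt_of_le ?_ h
  rw [mul_comm]
  refine mul_lt_mul_of_pos_left ?_ hN0
  have h5 : C < C' := by rw [hC']; linarith [le_abs_self C]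
  nlinarith

end

section

open MeasureTheory Set Filter Topology

lemma integrable_exp_neg_mul_abs {c : ℝ} (hc : 0 < c) :
    Integrable fun t : ℝ ↦ Real.exp (-c * |t|) := by
  rw [← integrableOn_univ, ← Iic_union_Ioi (a := (0 : ℝ))]
  refine IntegrableOn.union ?_ ?_
  · refine (integrableOn_exp_mul_Iic hc 0).congr_fun (fun t ht ↦ ?_) measurableSet_Iic
    rw [abs_of_nonpos ht]; simp
  · refine (integrableOn_exp_mul_Ioi (neg_lt_zero.2 hc) 0).congr_fun (fun t ht ↦ ?_)
      measurableSet_Ioi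
    rw [abs_of_pos ht]

lemma integrable_sq_mul_exp_neg_mul_abs {c : ℝ} (hc : 0 < c) :
    Integrable fun t : ℝ ↦ (1 + |t|) ^ 2 * Real.exp (-c * |t|) := by
  have hb : 0 < c / 2 := by positivity
  refine ((integrable_exp_neg_mul_abs hb).const_mul (1 + 2 / (c / 2) + 2 / (c / 2) ^ 2)).mono'
    (Continuous.aestronglyMeasurable (by fun_prop)) (Eventually.of_forall fun t ↦ ?_)
  have h1 := Real.quadratic_le_exp_of_nonneg (show 0 ≤ c / 2 * |t| by positivity)
  have h2 : (1 + |t|) ^ 2 ≤ (1 + 2 / (c / 2) + 2 / (c / 2) ^ 2) * Real.exp (c / 2 * |t|) := by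
    refine le_trans ?_ (mul_le_mul_of_nonneg_left h1 (by positivity))
    have ht := abs_nonneg t
    have e : (1 + 2 / (c / 2) + 2 / (c / 2) ^ 2) * (1 + c / 2 * |t| + (c / 2 * |t|) ^ 2 / 2)
        = (1 + |t|) ^ 2 + (2 / (c / 2) + 2 / (c / 2) ^ 2 + c / 2 * |t| + 2 / (c / 2) * |t|
          + (c / 2) ^ 2 * |t| ^ 2 / 2 + (c / 2) * |t| ^ 2) := by
      field_simp
      ring
    rw [e]
    have : 0 ≤ 2 / (c / 2) + 2 / (c / 2) ^ 2 + c / 2 * |t| + 2 / (c / 2) * |t|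
          + (c / 2) ^ 2 * |t| ^ 2 / 2 + (c / 2) * |t| ^ 2 := by positivity
    linarith
  rw [Real.norm_of_nonneg (by positivity)]
  calc _ ≤ (1 + 2 / (c / 2) + 2 / (c / 2) ^ 2) * Real.exp (c / 2 * |t|) * Real.exp (-c * |t|) := by
        gcongr
    _ = _ := by
        rw [mul_assoc, ← Real.exp_add]
        congr 2
        ring

lemma norm_Gamma_three_halves_sq (t : ℝ) :
    ‖Gamma (3 / 2 - t * I)‖ ^ 2 = (1 / 4 + t ^ 2) * Real.pi / Real.cosh (Real.pi * t) := by
  have hne : (1 / 2 - t * I : ℂ) ≠ 0 := by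
    intro h
    have := congrArg re h
    norm_num at this
  have h1 : Gamma (3 / 2 - t * I) = (1 / 2 - t * I) * Gamma (1 / 2 - t * I) := by
    rw [← Gamma_add_one _ hne]
    congr 1
    ring
  have h2 : (‖Gamma (1 / 2 - t * I)‖ ^ 2 : ℝ) = Real.pi / Real.cosh (Real.pi * t) := by
    have hc : (1 : ℂ) - (1 / 2 - t * I) = (starRingEnd ℂ) (1 / 2 - t * I) := by
      apply Complex.ext <;> norm_num
    have h := Gamma_mul_Gamma_one_sub (1 / 2 - t * I)
    rw [hc, Gamma_conj, mul_conj, normSq_eq_norm_sq] at h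
    have hs : sin (Real.pi * (1 / 2 - t * I)) = (Real.cosh (Real.pi * t) : ℂ) := by
      rw [show (Real.pi * (1 / 2 - t * I) : ℂ) = Real.pi / 2 - (Real.pi * t : ℝ) * I by
        push_cast; ring, sin_pi_div_two_sub, cos_mul_I, ofReal_cosh]
    rw [hs] at h
    exact_mod_cast h
  have h3 : ‖(1 / 2 - t * I : ℂ)‖ ^ 2 = 1 / 4 + t ^ 2 := by
    rw [← normSq_eq_norm_sq, normSq_apply]
    norm_num
    ring
  rw [h1, norm_mul, mul_pow, h2, h3]
  ring

lemma norm_Gamma_three_halves_le (t : ℝ) :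
    ‖Gamma (3 / 2 - t * I)‖ ≤ 3 * (1 + |t|) * Real.exp (-(Real.pi / 2) * |t|) := by
  refine le_of_sq_le_sq ?_ (by positivity)
  rw [norm_Gamma_three_halves_sq, div_le_iff₀ (Real.cosh_pos _)]
  have hpi := Real.pi_pos
  have h1 : Real.exp (Real.pi * |t|) / 2 ≤ Real.cosh (Real.pi * t) := by
    rw [← Real.cosh_abs, abs_mul, abs_of_pos hpi, Real.cosh_eq]
    have := Real.exp_pos (-(Real.pi * |t|))
    linarith
  have h2 : (Real.exp (-(Real.pi / 2) * |t|)) ^ 2 * Real.exp (Real.pi * |t|) = 1 := by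
    rw [← Real.exp_nat_mul, ← Real.exp_add]
    convert Real.exp_zero using 2
    push_cast
    ring
  calc (1 / 4 + t ^ 2) * Real.pi ≤ (1 + |t|) ^ 2 * (9 / 2) := by
        have := Real.pi_lt_d2
        have h3 := abs_nonneg t
        have h4 : 1 / 4 + t ^ 2 ≤ (1 + |t|) ^ 2 := by rw [← sq_abs t]; nlinarith
        nlinarith [sq_nonneg (1 + |t|)]
    _ = (3 * (1 + |t|)) ^ 2 * ((Real.exp (-(Real.pi / 2) * |t|)) ^ 2 *
          (Real.exp (Real.pi * |t|) / 2)) := by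
        linear_combination (-(9 / 2) * (1 + |t|) ^ 2) * h2
    _ ≤ _ := by
        rw [mul_pow _ (Real.exp _), mul_assoc]
        gcongr

lemma norm_exp_neg_three_halves_mul (t : ℝ) (l : ℂ) :
    ‖exp (-(3 / 2 - t * I) * l)‖ = Real.exp (-(3 / 2) * l.re - t * l.im) := by
  rw [norm_exp]
  congr 1
  simp

lemma continuous_Gamma_three_halves : Continuous fun t : ℝ ↦ Gamma (3 / 2 - t * I) := by
  refine continuous_iff_continuousAt.2 fun t ↦ ?_
  refine ContinuousAt.comp (g := Gamma) ?_ (by fun_prop)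
  refine (differentiableAt_Gamma _ fun m h ↦ ?_).continuousAt
  have := congrArg re h
  norm_num at this
  have : (0 : ℝ) ≤ m := m.cast_nonneg
  linarith

/-- The integrand of the Mellin–Barnes integral of `exp (-exp l)` along `Re z = 3 / 2`. -/
noncomputable def gammaKernel (l : ℂ) (t : ℝ) : ℂ :=
  Gamma (3 / 2 - t * I) * exp (-(3 / 2 - t * I) * l)

lemma continuous_gammaKernel (l : ℂ) : Continuous (gammaKernel l) :=
  continuous_Gamma_three_halves.mul (by fun_prop)

lemma norm_gammaKernel_le {l : ℂ} {ε m : ℝ} (hl : |l.im| ≤ Real.pi / 2 - ε) (hm : m ≤ l.re)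
    (t : ℝ) : ‖gammaKernel l t‖ ≤
      3 * Real.exp (-(3 / 2) * m) * ((1 + |t|) * Real.exp (-ε * |t|)) := by
  rw [gammaKernel, norm_mul, norm_exp_neg_three_halves_mul]
  have h1 : -t * l.im ≤ |t| * (Real.pi / 2 - ε) := by
    calc -t * l.im ≤ |-t * l.im| := le_abs_self _
      _ = |t| * |l.im| := by rw [abs_mul, abs_neg]
      _ ≤ _ := by gcongr
  calc _ ≤ 3 * (1 + |t|) * Real.exp (-(Real.pi / 2) * |t|) *
        (Real.exp (-(3 / 2) * m) * Real.exp (|t| * (Real.pi / 2 - ε))) := by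
        refine mul_le_mul (norm_Gamma_three_halves_le t) ?_ (Real.exp_nonneg _) (by positivity)
        rw [← Real.exp_add]
        refine Real.exp_le_exp.2 ?_
        linarith
    _ = 3 * Real.exp (-(3 / 2) * m) * ((1 + |t|) *
          (Real.exp (-(Real.pi / 2) * |t|) * Real.exp (|t| * (Real.pi / 2 - ε)))) := by ring
    _ = _ := by
        rw [← Real.exp_add]
        congr 4
        ring

lemma integrable_gammaKernel {l : ℂ} (hl : |l.im| < Real.pi / 2) :
    Integrable (gammaKernel l) := by
  have hε : 0 < Real.pi / 2 - |l.im| := by linarith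
  refine ((integrable_sq_mul_exp_neg_mul_abs hε).const_mul (3 * Real.exp (-(3 / 2) * l.re))).mono'
    (continuous_gammaKernel l).aestronglyMeasurable (Eventually.of_forall fun t ↦ ?_)
  refine (norm_gammaKernel_le (ε := Real.pi / 2 - |l.im|) (by linarith) le_rfl t).trans ?_
  gcongr
  nlinarith [abs_nonneg t]

lemma differentiableAt_integral_gammaKernel {l : ℂ} (hl : |l.im| < Real.pi / 2) :
    DifferentiableAt ℂ (fun l ↦ ∫ t, gammaKernel l t) l := by
  set ε := (Real.pi / 2 - |l.im|) / 2 with hε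
  have hε0 : 0 < ε := by rw [hε]; linarith
  have h := hasDerivAt_integral_of_dominated_loc_of_deriv_le (μ := volume)
    (F := gammaKernel) (F' := fun l t ↦ gammaKernel l t * (-(3 / 2 - t * I))) (x₀ := l)
    (bound := fun t ↦ 6 * Real.exp (-(3 / 2) * (l.re - ε)) *
      ((1 + |t|) ^ 2 * Real.exp (-ε * |t|)))
    (Metric.ball_mem_nhds l hε0)
    (Eventually.of_forall fun w ↦ (continuous_gammaKernel w).aestronglyMeasurable)
    (integrable_gammaKernel hl)
    ((continuous_gammaKernel l).mul (by fun_prop)).aestronglyMeasurable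
    (Eventually.of_forall fun t w hw ↦ ?_)
    ((integrable_sq_mul_exp_neg_mul_abs hε0).const_mul _)
    (Eventually.of_forall fun t w _ ↦ ?_)
  · exact h.2.differentiableAt
  · rw [Metric.mem_ball, dist_eq_norm] at hw
    have h1 := (abs_re_le_norm (w - l)).trans hw.le
    have h2 := (abs_im_le_norm (w - l)).trans hw.le
    rw [sub_re, abs_le] at h1
    rw [sub_im] at h2
    have h3 : |w.im| ≤ Real.pi / 2 - ε := by
      have := abs_add_le l.im (w.im - l.im)
      rw [add_sub_cancel] at this
      linarith
    have h4 : ‖(-(3 / 2 - t * I) : ℂ)‖ ≤ 2 * (1 + |t|) := by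
      rw [norm_neg]
      refine (norm_sub_le _ _).trans ?_
      rw [norm_mul, norm_I, norm_real, Real.norm_eq_abs]
      norm_num
      linarith [abs_nonneg t]
    rw [norm_mul]
    calc _ ≤ _ := mul_le_mul (norm_gammaKernel_le h3 (m := l.re - ε) (by linarith) t) h4
          (norm_nonneg _) (by positivity)
      _ = _ := by ring
  · have h1 : HasDerivAt (fun w : ℂ ↦ -(3 / 2 - t * I) * w) (-(3 / 2 - t * I)) w := by
      simpa using (hasDerivAt_id w).const_mul (-(3 / 2 - t * I : ℂ))
    refine (h1.cexp.const_mul (Gamma (3 / 2 - t * I))).congr_deriv ?_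
    rw [gammaKernel]
    ring

lemma integral_gammaKernel_ofReal (l : ℝ) :
    ∫ t, gammaKernel l t = 2 * Real.pi * exp (-exp l) := by
  have hpi := Real.pi_pos
  have hmel : ∀ y : ℝ, mellin (fun x : ℝ ↦ (Real.exp (-x) : ℂ)) ((3 / 2 : ℝ) + y * I) =
      Gamma (3 / 2 - (-y : ℝ) * I) := by
    intro y
    rw [← GammaIntegral_eq_mellin, ← Gamma_eq_integral (by simp)]
    congr 1
    push_cast
    ring
  have hl : ∀ l : ℝ, |(l : ℂ).im| < Real.pi / 2 := fun l ↦ by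
    rw [ofReal_im, abs_zero]; positivity
  have hcpow : ∀ y : ℝ, (Real.exp l : ℂ) ^ (-((3 / 2 : ℝ) + y * I)) =
      exp (-(3 / 2 - (-y : ℝ) * I) * l) := by
    intro y
    rw [cpow_def_of_ne_zero (by exact_mod_cast (Real.exp_pos l).ne'), ← ofReal_log
      (Real.exp_pos l).le, Real.log_exp]
    congr 1
    push_cast
    ring
  have h := mellinInv_mellin_eq (3 / 2) (fun x : ℝ ↦ (Real.exp (-x) : ℂ)) (Real.exp_pos l)
    ?_ ?_ (by fun_prop)
  · simp only [mellinInv, hmel, hcpow] at h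
    have hneg := integral_neg_eq_self (gammaKernel l) volume
    simp only [gammaKernel] at hneg ⊢
    rw [← hneg]
    simp only [smul_eq_mul, mul_comm (exp _)] at h
    rw [real_smul] at h
    have hpi' : (Real.pi : ℂ) ≠ 0 := by exact_mod_cast hpi.ne'
    push_cast at h ⊢
    rw [← h, ← mul_assoc, mul_one_div_cancel (mul_ne_zero two_ne_zero hpi'), one_mul]
  · have := GammaIntegral_convergent (s := (3 / 2 : ℝ)) (by simp)
    refine this.congr_fun (fun x _ ↦ ?_) measurableSet_Ioi
    simp only [smul_eq_mul, mul_comm]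
  · have := (integrable_gammaKernel (hl 0)).comp_neg
    rw [VerticalIntegrable]
    simp only [hmel]
    simpa [gammaKernel] using this

lemma integral_gammaKernel {l : ℂ} (hl : |l.im| < Real.pi / 2) :
    ∫ t, gammaKernel l t = 2 * Real.pi * exp (-exp l) := by
  set U : Set ℂ := {l | |l.im| < Real.pi / 2} with hU
  have hUo : IsOpen U := isOpen_lt (by fun_prop) continuous_const
  have hUc : IsPreconnected U := by
    have : U = {l : ℂ | -(Real.pi / 2) < l.im} ∩ {l : ℂ | l.im < Real.pi / 2} := by
      ext z; simp [hU, abs_lt]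
    rw [this]
    exact ((convex_halfSpace_im_gt _).inter (convex_halfSpace_im_lt _)).isPreconnected
  have h1 : AnalyticOnNhd ℂ (fun l ↦ ∫ t, gammaKernel l t) U :=
    DifferentiableOn.analyticOnNhd
      (fun z hz ↦ (differentiableAt_integral_gammaKernel hz).differentiableWithinAt) hUo
  have h2 : AnalyticOnNhd ℂ (fun l ↦ 2 * Real.pi * exp (-exp l)) U :=
    (Differentiable.differentiableOn (by fun_prop)).analyticOnNhd hUo
  have h0 : (0 : ℂ) ∈ U := by
    have := Real.pi_pos
    simp only [hU, mem_ofPred_eq, zero_im, abs_zero]; positivity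
  refine h1.eqOn_of_preconnected_of_frequently_eq h2 hUc h0 ?_ hl
  have ht : Tendsto (fun x : ℝ ↦ (x : ℂ)) (𝓝[≠] 0) (𝓝[≠] 0) := by
    refine tendsto_nhdsWithin_of_tendsto_nhds_of_eventually_within _ ?_ ?_
    · exact (continuous_ofReal.tendsto' 0 0 (by simp)).mono_left nhdsWithin_le_nhds
    · filter_upwards [self_mem_nhdsWithin] with x hx
      simpa using hx
  exact ht.frequently (Eventually.frequently (Eventually.of_forall integral_gammaKernel_ofReal))

end

section

open MeasureTheory Set Filter Topology

lemma exists_norm_LSeries_le {f : ℕ → ℂ} {s₀ : ℂ} (hf : LSeriesSummable f s₀) :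
    ∃ C, 0 ≤ C ∧ ∀ s : ℂ, s₀.re ≤ s.re → ‖LSeries f s‖ ≤ C :=
  ⟨∑' n, ‖LSeries.term f s₀ n‖, tsum_nonneg fun _ ↦ norm_nonneg _, fun _ hs ↦
    tsum_of_norm_bounded hf.norm.hasSum fun n ↦ LSeries.norm_term_le_of_re_le_re f hs n⟩

lemma abscissaOfAbsConv_vonMangoldt_lt {s : ℂ} (hs : 1 < s.re) :
    LSeries.abscissaOfAbsConv (fun n ↦ (ArithmeticFunction.vonMangoldt n : ℂ)) < s.re := by
  refine lt_of_le_of_lt (LSeries.abscissaOfAbsConv_le_of_forall_lt_LSeriesSummable (x := 1)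
    fun y hy ↦ ArithmeticFunction.LSeriesSummable_vonMangoldt (by simpa using hy)) ?_
  exact_mod_cast hs

lemma vonMangoldtLogSum_eq_convolution :
    (fun n ↦ (vonMangoldtLogSum n : ℂ)) =
      LSeries.convolution (LSeries.logMul fun n ↦ (ArithmeticFunction.vonMangoldt n : ℂ)) 1 := by
  ext n
  rw [LSeries.convolution_def, vonMangoldtLogSum]
  simp only [Pi.one_apply, mul_one]
  rw [Nat.sum_divisorsAntidiagonal
    (fun m _ ↦ LSeries.logMul (fun n ↦ (ArithmeticFunction.vonMangoldt n : ℂ)) m)]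
  push_cast
  exact Finset.sum_congr rfl fun m _ ↦ by simp [LSeries.logMul, mul_comm]

lemma LSeriesSummable_vonMangoldtLogSum {s : ℂ} (hs : 1 < s.re) :
    LSeriesSummable (fun n ↦ (vonMangoldtLogSum n : ℂ)) s := by
  rw [vonMangoldtLogSum_eq_convolution]
  exact (LSeriesSummable_logMul_of_lt_re (abscissaOfAbsConv_vonMangoldt_lt hs)).convolution
    (LSeriesSummable_one_iff.2 hs)

lemma hasDerivAt_logDeriv_riemannZeta {s : ℂ} (hs : 1 < s.re) :
    HasDerivAt (fun z ↦ deriv riemannZeta z / riemannZeta z)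
      (LSeries (fun n ↦ (vonMangoldtLogSum n : ℂ)) s / riemannZeta s) s := by
  have h0 : riemannZeta s ≠ 0 := riemannZeta_ne_zero_of_one_le_re hs.le
  have h1 := (LSeries_hasDerivAt (abscissaOfAbsConv_vonMangoldt_lt hs)).neg
  rw [vonMangoldtLogSum_eq_convolution,
    LSeries_convolution' (LSeriesSummable_logMul_of_lt_re (abscissaOfAbsConv_vonMangoldt_lt hs))
    (LSeriesSummable_one_iff.2 hs), LSeries_one_eq_riemannZeta hs, mul_div_cancel_right₀ _ h0]
  rw [neg_neg] at h1
  refine h1.congr_of_eventuallyEq ?_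
  filter_upwards [(isOpen_lt continuous_const continuous_re).mem_nhds hs] with z hz
  simp only [Pi.neg_apply]
  rw [ArithmeticFunction.LSeries_vonMangoldt_eq_deriv_riemannZeta_div hz]
  ring

lemma exists_riemannZeta_bounds : ∃ C : ℝ, 1 ≤ C ∧ ∀ s : ℂ, 3 / 2 ≤ s.re →
    ‖riemannZeta s‖ ≤ C ∧ 1 ≤ C * ‖riemannZeta s‖ ∧ ‖deriv riemannZeta s / riemannZeta s‖ ≤ C ∧
      ‖LSeries (fun n ↦ (vonMangoldtLogSum n : ℂ)) s‖ ≤ C := by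
  have h32 : 1 < ((3 / 2 : ℂ)).re := by norm_num
  have hre : ((3 / 2 : ℂ)).re = 3 / 2 := by norm_num
  obtain ⟨C₁, p1, h1⟩ := exists_norm_LSeries_le (LSeriesSummable_one_iff.2 h32)
  obtain ⟨C₂, p2, h2⟩ :=
    exists_norm_LSeries_le (ArithmeticFunction.LSeriesSummable_moebius_iff.2 h32)
  obtain ⟨C₃, p3, h3⟩ :=
    exists_norm_LSeries_le (ArithmeticFunction.LSeriesSummable_vonMangoldt h32)
  obtain ⟨C₄, p4, h4⟩ := exists_norm_LSeries_le (LSeriesSummable_vonMangoldtLogSum h32)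
  refine ⟨1 + (C₁ + C₂ + C₃ + C₄), by linarith, fun s hs ↦ ?_⟩
  have hs1 : 1 < s.re := by linarith
  have b1 := h1 s (hre.trans_le hs)
  have b2 := h2 s (hre.trans_le hs)
  have b3 := h3 s (hre.trans_le hs)
  have b4 := h4 s (hre.trans_le hs)
  have hmul := congrArg norm (LSeries_one_mul_Lseries_moebius hs1)
  rw [LSeries_one_eq_riemannZeta hs1] at b1 hmul
  rw [ArithmeticFunction.LSeries_vonMangoldt_eq_deriv_riemannZeta_div hs1, neg_div, norm_neg] at b3
  rw [norm_mul, norm_one] at hmul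
  refine ⟨by linarith, ?_, by linarith, by linarith⟩
  rw [← hmul, mul_comm]
  gcongr
  linarith

/-- The factor in the functional equation `ζ(1 - z) = X(z) ζ(z)`. -/
noncomputable def zetaFactor (z : ℂ) : ℂ :=
  2 * (2 * Real.pi) ^ (-z) * Gamma z * cos (Real.pi * z / 2)

lemma zetaFactor_mul_exp (l : ℂ) (t : ℝ) :
    zetaFactor (3 / 2 - t * I) * exp (l * (1 - (3 / 2 - t * I))) =
      exp l * (gammaKernel (Real.log (2 * Real.pi) + l - Real.pi / 2 * I) t +
        gammaKernel (Real.log (2 * Real.pi) + l + Real.pi / 2 * I) t) := by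
  have h2 : (2 * Real.pi : ℂ) ≠ 0 := by simp [Real.pi_ne_zero]
  have hl : Complex.log (2 * Real.pi) = Real.log (2 * Real.pi) := by
    rw [ofReal_log (by positivity)]; push_cast; rfl
  set z : ℂ := 3 / 2 - t * I
  simp only [gammaKernel, zetaFactor]
  rw [cpow_def_of_ne_zero h2, hl, cos]
  set L : ℂ := ((Real.log (2 * Real.pi) : ℝ) : ℂ)
  have e1 : exp (-z * (L + l - Real.pi / 2 * I)) * exp l =
    exp (L * -z) * exp (Real.pi * z / 2 * I) * exp (l * (1 - z)) := by
    simp only [← exp_add]; congr 1; ring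
  have e2 : exp (-z * (L + l + Real.pi / 2 * I)) * exp l =
    exp (L * -z) * exp (-(Real.pi * z / 2) * I) * exp (l * (1 - z)) := by
    simp only [← exp_add]; congr 1; ring
  linear_combination -Gamma z * e1 - Gamma z * e2

lemma gammaKernel_add_log (l : ℂ) (t : ℝ) {n : ℕ} (hn : n ≠ 0) :
    gammaKernel (l + Real.log n) t = gammaKernel l t / (n : ℂ) ^ (3 / 2 - t * I : ℂ) := by
  rw [cpow_def_of_ne_zero (by exact_mod_cast hn), div_eq_mul_inv, ← exp_neg, natCast_log.symm]
  simp only [gammaKernel, mul_assoc, ← exp_add]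
  congr 2; ring

lemma hasSum_integral_gammaKernel {f : ℕ → ℂ} {l : ℂ} (hl : |l.im| < Real.pi / 2)
    (hf : LSeriesSummable f (3 / 2)) (hf0 : f 0 = 0) :
    HasSum (fun n : ℕ ↦ f n * (2 * Real.pi * exp (-(n * exp l))))
      (∫ t : ℝ, gammaKernel l t * LSeries f (3 / 2 - t * I)) := by
  have hterm (n : ℕ) (t : ℝ) : gammaKernel l t * LSeries.term f (3 / 2 - t * I) n =
      if n = 0 then 0 else f n * gammaKernel (l + Real.log n) t := by
    split_ifs with h
    · simp [h]
    · rw [LSeries.term_of_ne_zero h, gammaKernel_add_log l t h]; ring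
  have hlim (n : ℕ) : |(l + Real.log n : ℂ).im| < Real.pi / 2 := by
    rw [add_im, ofReal_im, add_zero]; exact hl
  have hre (t : ℝ) : (3 / 2 - t * I : ℂ).re = 3 / 2 := by simp
  have key := hasSum_integral_of_summable_integral_norm (μ := volume)
    (F := fun n (t : ℝ) ↦ gammaKernel l t * LSeries.term f (3 / 2 - t * I) n) ?_ ?_
  · simp only [tsum_mul_left] at key
    refine (congrArg (HasSum · _) (funext fun n ↦ ?_)).mp key
    simp only [hterm]
    split_ifs with h
    · simp [h, hf0]
    · rw [integral_const_mul, integral_gammaKernel (hlim n), exp_add, ← ofReal_exp,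
        Real.exp_log (by positivity)]
      push_cast
      ring_nf
  · intro n
    simp only [hterm]
    split_ifs with h
    · simp
    · exact (integrable_gammaKernel (hlim n)).const_mul _
  · have : (fun n ↦ ∫ t : ℝ, ‖gammaKernel l t * LSeries.term f (3 / 2 - t * I) n‖) =
        fun n ↦ (∫ t : ℝ, ‖gammaKernel l t‖) * ‖LSeries.term f (3 / 2) n‖ := by
      ext n
      rw [← integral_mul_const]
      congr 1
      ext t
      rw [norm_mul, LSeries.norm_term_eq, LSeries.norm_term_eq, hre]
      norm_num
    rw [this]
    exact hf.norm.mul_left _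

lemma log_two_mul_one_add_I_bounds {δ : ℝ} (hδ : 0 < δ) (hδ1 : δ ≤ 1) :
    δ / 2 ≤ (log (2 * (1 + δ * I))).im ∧ (log (2 * (1 + δ * I))).im ≤ Real.pi / 4 ∧
      Real.log 2 ≤ (log (2 * (1 + δ * I))).re ∧ exp (log (2 * (1 + δ * I))) = 2 * (1 + δ * I) := by
  have hre : ((2 : ℂ) * (1 + δ * I)).re = 2 := by simp
  have him : ((2 : ℂ) * (1 + δ * I)).im = 2 * δ := by simp
  have hne : (2 : ℂ) * (1 + δ * I) ≠ 0 := fun h ↦ by simp [h] at hre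
  rw [log_im, log_re]
  have hlt : |arg (2 * (1 + δ * I))| < Real.pi / 2 :=
    abs_arg_lt_pi_div_two_iff.2 (Or.inl (by rw [hre]; norm_num))
  have harg : arg (2 * (1 + δ * I)) = Real.arctan δ := by
    rw [← Real.arctan_tan (abs_lt.1 hlt).1 (abs_lt.1 hlt).2, tan_arg, hre, him]
    congr 1; field_simp
  refine ⟨?_, ?_, ?_, exp_log hne⟩
  · refine le_trans ?_ (Real.sin_le (arg_nonneg_iff.2 (by rw [him]; positivity)))
    rw [sin_arg, him, le_div_iff₀ (norm_pos_iff.2 hne)]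
    have : ‖(2 : ℂ) * (1 + δ * I)‖ ≤ 4 := by
      rw [norm_mul]
      have := norm_add_le (1 : ℂ) (δ * I)
      simp only [norm_mul, norm_one, norm_real, norm_I, mul_one, Real.norm_eq_abs,
        abs_of_pos hδ] at this
      norm_num
      linarith
    nlinarith
  · rw [harg, ← Real.arctan_one]
    exact Real.arctan_strictMono.monotone hδ1
  · refine Real.log_le_log (by norm_num) ?_
    calc (2 : ℝ) = |((2 : ℂ) * (1 + δ * I)).re| := by rw [hre]; norm_num
      _ ≤ _ := abs_re_le_norm _

lemma continuous_LSeries_three_halves {f : ℕ → ℂ} (hf : LSeriesSummable f (3 / 2)) :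
    Continuous fun t : ℝ ↦ LSeries f (3 / 2 - t * I) := by
  refine continuous_tsum (fun n ↦ ?_) hf.norm fun n t ↦
    LSeries.norm_term_le_of_re_le_re f (by simp) n
  rcases eq_or_ne n 0 with rfl | hn
  · simpa using continuous_const
  · simp only [LSeries.term_of_ne_zero hn]
    have hn' : (n : ℂ) ≠ 0 := by exact_mod_cast hn
    refine continuous_const.div ?_ fun t ↦ by simp [cpow_eq_zero_iff, hn']
    exact Continuous.const_cpow (by fun_prop) (Or.inl hn')

lemma norm_gammaKernel_le_of_le {l : ℂ} {T t : ℝ} (hl0 : 0 ≤ l.re) (hT : 0 ≤ T)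
    (h1 : -(Real.pi / 2) ≤ l.im) (h2 : t ≤ T ∧ l.im ≤ -(Real.pi / 4) ∨ 0 ≤ t ∧ 0 ≤ l.im) :
    ‖gammaKernel l t‖ ≤ 3 * Real.exp (Real.pi * T) *
      ((1 + |t|) ^ 2 * Real.exp (-(Real.pi / 2) * |t|)) := by
  have hpi := Real.pi_pos
  rw [gammaKernel, norm_mul, norm_exp_neg_three_halves_mul]
  have hA : Real.exp (-(3 / 2) * l.re - t * l.im) ≤ Real.exp (Real.pi * T) := by
    refine Real.exp_le_exp.2 ?_
    rcases h2 with ⟨h2, h3⟩ | ⟨h2, h3⟩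
    · rcases le_total 0 t with h | h <;> nlinarith
    · nlinarith [mul_nonneg h2 h3]
  calc _ ≤ 3 * (1 + |t|) * Real.exp (-(Real.pi / 2) * |t|) * Real.exp (Real.pi * T) := by
        gcongr
        exact norm_Gamma_three_halves_le t
    _ = 3 * Real.exp (Real.pi * T) * ((1 + |t|) * Real.exp (-(Real.pi / 2) * |t|)) := by ring
    _ ≤ _ := by
        gcongr
        nlinarith [abs_nonneg t]

lemma exists_sum_vonMangoldtLogSum_le {T : ℝ} (hT : 0 ≤ T) :
    ∃ K : ℝ, ∀ δ : ℝ, 0 < δ → δ ≤ 1 → ∀ s : Finset ℕ,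
      ∑ n ∈ s, vonMangoldtLogSum n * Real.exp (-(4 * Real.pi * δ * n)) ≤
        K + ‖∫ t in Ioi T, zetaFactor (3 / 2 - t * I) *
          LSeries (fun n ↦ (vonMangoldtLogSum n : ℂ)) (3 / 2 - t * I) *
          exp (log (2 * (1 + δ * I)) * (1 - (3 / 2 - t * I)))‖ := by
  obtain ⟨C, hC1, hC⟩ := exists_riemannZeta_bounds
  have hpi := Real.pi_pos
  set E : ℝ → ℂ := fun t ↦ LSeries (fun n ↦ (vonMangoldtLogSum n : ℂ)) (3 / 2 - t * I) with hE
  have hsum : LSeriesSummable (fun n ↦ (vonMangoldtLogSum n : ℂ)) (3 / 2) :=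
    LSeriesSummable_vonMangoldtLogSum (by norm_num)
  have hEc : Continuous E := continuous_LSeries_three_halves hsum
  have hEC (t : ℝ) : ‖E t‖ ≤ C := (hC _ (by simp)).2.2.2
  set g : ℝ → ℝ := fun t ↦ 3 * Real.exp (Real.pi * T) *
      ((1 + |t|) ^ 2 * Real.exp (-(Real.pi / 2) * |t|)) * C with hg
  have hgi : Integrable g :=
    ((integrable_sq_mul_exp_neg_mul_abs (half_pos hpi)).const_mul _).mul_const _
  have hg0 (t : ℝ) : 0 ≤ g t := by positivity
  refine ⟨2 * ∫ t, g t, fun δ hδ hδ1 s ↦ ?_⟩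
  obtain ⟨hθ1, hθ2, hre, hexp⟩ := log_two_mul_one_add_I_bounds hδ hδ1
  set l := log (2 * (1 + δ * I))
  have hlre : 0 ≤ l.re := (Real.log_nonneg (by norm_num)).trans hre
  have hlogpi : 0 ≤ Real.log (2 * Real.pi) := Real.log_nonneg (by linarith [Real.pi_gt_three])
  set l₁ : ℂ := Real.log (2 * Real.pi) + l - Real.pi / 2 * I with hl₁
  set l₂ : ℂ := Real.log (2 * Real.pi) + l + Real.pi / 2 * I with hl₂
  have i1 : l₁.im = l.im - Real.pi / 2 := by simp [hl₁]
  have i2 : l₂.im = l.im + Real.pi / 2 := by simp [hl₂]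
  have r1 : 0 ≤ l₁.re := by simp [hl₁]; positivity
  have r2 : 0 ≤ l₂.re := by simp [hl₂]; positivity
  have hl₁lt : |l₁.im| < Real.pi / 2 := by rw [i1, abs_lt]; constructor <;> linarith
  have hk₁ : Integrable fun t ↦ gammaKernel l₁ t * E t :=
    (integrable_gammaKernel hl₁lt).mul_bdd (c := C) hEc.aestronglyMeasurable
      (Eventually.of_forall hEC)
  have b₁ : ∀ t ≤ T, ‖gammaKernel l₁ t * E t‖ ≤ g t := fun t ht ↦ by
    rw [norm_mul]
    refine mul_le_mul (norm_gammaKernel_le_of_le r1 hT ?_ (Or.inl ⟨ht, ?_⟩)) (hEC t)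
      (norm_nonneg _) (by positivity) <;> linarith
  have b₂ : ∀ t ∈ Ioi T, ‖gammaKernel l₂ t * E t‖ ≤ g t := fun t ht ↦ by
    rw [norm_mul]
    refine mul_le_mul (norm_gammaKernel_le_of_le r2 hT ?_ (Or.inr ⟨hT.trans (le_of_lt ht), ?_⟩))
      (hEC t) (norm_nonneg _) (by positivity) <;> linarith
  have hk₂ : IntegrableOn (fun t ↦ gammaKernel l₂ t * E t) (Ioi T) :=
    hgi.integrableOn.mono' ((continuous_gammaKernel l₂).mul hEc).aestronglyMeasurable
      (ae_restrict_of_forall_mem measurableSet_Ioi b₂)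
  have n₁ : ‖∫ t in Iic T, gammaKernel l₁ t * E t‖ ≤ ∫ t, g t :=
    (norm_integral_le_of_norm_le hgi.integrableOn
      (ae_restrict_of_forall_mem measurableSet_Iic b₁)).trans
      (setIntegral_le_integral hgi (Eventually.of_forall hg0))
  have n₂ : ‖∫ t in Ioi T, gammaKernel l₂ t * E t‖ ≤ ∫ t, g t :=
    (norm_integral_le_of_norm_le hgi.integrableOn
      (ae_restrict_of_forall_mem measurableSet_Ioi b₂)).trans
      (setIntegral_le_integral hgi (Eventually.of_forall hg0))
  have hX : ∫ t in Ioi T, zetaFactor (3 / 2 - t * I) * E t * exp (l * (1 - (3 / 2 - t * I))) =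
      exp l * ((∫ t in Ioi T, gammaKernel l₁ t * E t) + ∫ t in Ioi T, gammaKernel l₂ t * E t) := by
    rw [← integral_add hk₁.integrableOn hk₂, ← integral_const_mul]
    congr 1
    ext t
    rw [mul_right_comm, zetaFactor_mul_exp]
    ring
  rw [hX, norm_mul]
  have hexp2 : 1 ≤ ‖exp l‖ := by
    rw [norm_exp]; exact Real.one_le_exp hlre
  have hexpl : exp l₁ = 4 * Real.pi * (δ - I) := by
    rw [hl₁, exp_sub, exp_add, hexp, ← ofReal_exp, Real.exp_log (by positivity),
      exp_pi_div_two_mul_I]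
    push_cast
    rw [div_eq_iff I_ne_zero]
    linear_combination (4 * Real.pi : ℂ) * I_sq
  have hHS := hasSum_integral_gammaKernel hl₁lt hsum (by simp [vonMangoldtLogSum])
  have hterm (n : ℕ) : (vonMangoldtLogSum n : ℂ) * (2 * Real.pi * exp (-(n * exp l₁))) =
      ((2 * Real.pi * (vonMangoldtLogSum n * Real.exp (-(4 * Real.pi * δ * n))) : ℝ) : ℂ) := by
    have : exp (-(n * exp l₁)) = exp (-(4 * Real.pi * δ * n)) := by
      rw [hexpl, show (-(n * (4 * Real.pi * (δ - I))) : ℂ) =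
        -(4 * Real.pi * δ * n) + ((2 * n : ℕ) : ℂ) * (2 * Real.pi * I) by push_cast; ring, exp_add,
        exp_nat_mul_two_pi_mul_I, mul_one]
    rw [this]
    push_cast
    ring
  simp only [hterm] at hHS
  have hle := sum_le_hasSum s (fun n _ ↦ by
    rw [ofReal_re]; have := vonMangoldtLogSum_nonneg n; positivity) (hasSum_re hHS)
  simp only [ofReal_re, ← Finset.mul_sum] at hle
  replace hle := hle.trans (re_le_norm _)
  have hsplit := (intervalIntegral.integral_Iic_add_Ioi (b := T) hk₁.integrableOn
    hk₁.integrableOn).symm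
  have hJ : ‖∫ t, gammaKernel l₁ t * E t‖ ≤ (∫ t, g t) +
      (‖(∫ t in Ioi T, gammaKernel l₁ t * E t) + ∫ t in Ioi T, gammaKernel l₂ t * E t‖ +
        ∫ t, g t) := by
    rw [hsplit]
    refine (norm_add_le _ _).trans (add_le_add n₁ ?_)
    refine le_trans ?_ (add_le_add_right n₂ _)
    have := norm_sub_le ((∫ t in Ioi T, gammaKernel l₁ t * E t) +
      ∫ t in Ioi T, gammaKernel l₂ t * E t) (∫ t in Ioi T, gammaKernel l₂ t * E t)
    rwa [add_sub_cancel_right] at this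
  have hS : 0 ≤ ∑ n ∈ s, vonMangoldtLogSum n * Real.exp (-(4 * Real.pi * δ * n)) :=
    Finset.sum_nonneg fun n _ ↦ mul_nonneg (vonMangoldtLogSum_nonneg n) (Real.exp_pos _).le
  have hpi3 := Real.pi_gt_three
  nlinarith [norm_nonneg ((∫ t in Ioi T, gammaKernel l₁ t * E t) +
    ∫ t in Ioi T, gammaKernel l₂ t * E t)]

end

section

open MeasureTheory Set Filter Topology

lemma riemannZeta_one_sub_eq_zetaFactor_mul {z : ℂ} (hz : 1 < z.re) :
    riemannZeta (1 - z) = zetaFactor z * riemannZeta z := by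
  rw [riemannZeta_one_sub (fun n hn ↦ ?_) (fun h ↦ ?_), zetaFactor]
  · rw [hn] at hz
    have : (0 : ℝ) ≤ n := n.cast_nonneg
    simp at hz
    linarith
  · simp [h] at hz

/-- The logarithmic derivative of `zetaFactor`. -/
noncomputable def zetaFactorLogDeriv (z : ℂ) : ℂ :=
  -Real.log (2 * Real.pi) + digamma z - Real.pi / 2 * tan (Real.pi * z / 2)

lemma hasDerivAt_zetaFactor {z : ℂ} (hz : 0 < z.re) (hc : cos (Real.pi * z / 2) ≠ 0) :
    HasDerivAt zetaFactor (zetaFactor z * zetaFactorLogDeriv z) z := by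
  have h2 : (2 * Real.pi : ℂ) ≠ 0 := by simp [Real.pi_ne_zero]
  have hl : Complex.log (2 * Real.pi) = Real.log (2 * Real.pi) := by
    rw [ofReal_log (by positivity)]; push_cast; rfl
  have hpole : ∀ m : ℕ, z ≠ -m := fun m hm ↦ by
    rw [hm] at hz
    have : (0 : ℝ) ≤ m := m.cast_nonneg
    simp at hz
    linarith
  have hG := (differentiableAt_Gamma z hpole).hasDerivAt
  have hG0 : Gamma z ≠ 0 := Gamma_ne_zero hpole
  have hcos : HasDerivAt (fun w : ℂ ↦ cos (Real.pi * w / 2))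
      (-sin (Real.pi * z / 2) * (Real.pi / 2)) z := by
    refine HasDerivAt.ccos ?_
    simpa using ((hasDerivAt_id z).const_mul (Real.pi : ℂ)).div_const 2
  have hpow : HasDerivAt (fun w : ℂ ↦ (2 * Real.pi : ℂ) ^ (-w))
      ((2 * Real.pi : ℂ) ^ (-z) * log (2 * Real.pi) * (-1)) z :=
    (hasDerivAt_id z).neg.const_cpow (Or.inl h2)
  refine (((hpow.const_mul 2).mul hG).mul hcos).congr_deriv ?_
  simp only [zetaFactor, zetaFactorLogDeriv, digamma_def, logDeriv_apply, tan, hl, Pi.mul_apply]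
  field_simp
  ring

lemma hasDerivAt_zetaFactorLogDeriv {z : ℂ} (hz : 0 < z.re) (hc : cos (Real.pi * z / 2) ≠ 0) :
    HasDerivAt zetaFactorLogDeriv ((∑' j : ℕ, ((j + 1 + z : ℂ) ^ 2)⁻¹ + (z ^ 2)⁻¹) -
      (Real.pi / 2) ^ 2 / cos (Real.pi * z / 2) ^ 2) z := by
  have htan : HasDerivAt (fun w : ℂ ↦ tan (Real.pi * w / 2))
      (1 / cos (Real.pi * z / 2) ^ 2 * (Real.pi / 2)) z := by
    have hlin : HasDerivAt (fun w : ℂ ↦ Real.pi * w / 2) (Real.pi / 2) z := by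
      simpa using ((hasDerivAt_id z).const_mul (Real.pi : ℂ)).div_const 2
    exact (hasDerivAt_tan hc).comp z hlin
  refine (((hasDerivAt_digamma hz).const_add (-(Real.log (2 * Real.pi) : ℂ))).sub
    (htan.const_mul (Real.pi / 2 : ℂ))).congr_deriv ?_
  ring

lemma cos_pi_mul_div_two_ne_zero {z : ℂ} (hz : z.im ≠ 0) : cos (Real.pi * z / 2) ≠ 0 := by
  rw [Complex.cos_ne_zero_iff]
  intro k hk
  have hz' : z = ((2 * k + 1 : ℤ) : ℂ) := by
    have hpi : (Real.pi : ℂ) ≠ 0 := by simp [Real.pi_ne_zero]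
    refine mul_left_cancel₀ hpi ?_
    push_cast
    linear_combination 2 * hk
  exact hz (by rw [hz', intCast_im])

lemma riemannZeta_derivs_one_sub {z : ℂ} (hz : 1 < z.re) (hz0 : z.im ≠ 0) :
    deriv riemannZeta (1 - z) = -(riemannZeta (1 - z) *
        (zetaFactorLogDeriv z + deriv riemannZeta z / riemannZeta z)) ∧
    deriv (deriv riemannZeta) (1 - z) = riemannZeta (1 - z) *
        ((zetaFactorLogDeriv z + deriv riemannZeta z / riemannZeta z) ^ 2 +
          deriv zetaFactorLogDeriv z) +
        zetaFactor z * LSeries (fun n ↦ (vonMangoldtLogSum n : ℂ)) z := by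
  set R : ℂ → ℂ := fun w ↦ zetaFactorLogDeriv w + deriv riemannZeta w / riemannZeta w with hR
  have hone (w : ℂ) (hw : 1 < w.re) : w ≠ 1 := fun h ↦ by simp [h] at hw
  have h1 (w : ℂ) (hw : 1 < w.re) (hw0 : w.im ≠ 0) :
      deriv riemannZeta (1 - w) = -(riemannZeta (1 - w) * R w) := by
    have h0 : riemannZeta w ≠ 0 := riemannZeta_ne_zero_of_one_le_re hw.le
    have hd : HasDerivAt (fun v ↦ riemannZeta (1 - v)) (riemannZeta (1 - w) * R w) w := by
      have := (hasDerivAt_zetaFactor (zero_lt_one.trans hw) (cos_pi_mul_div_two_ne_zero hw0)).mul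
        (differentiableAt_riemannZeta (hone w hw)).hasDerivAt
      rw [riemannZeta_one_sub_eq_zetaFactor_mul hw]
      refine (this.congr_of_eventuallyEq ?_).congr_deriv ?_
      rotate_left
      · simp only [hR]; field_simp
      · filter_upwards [(isOpen_lt continuous_const continuous_re).mem_nhds hw] with v hv
        exact riemannZeta_one_sub_eq_zetaFactor_mul hv
    have hne : (1 - w) ≠ 1 := fun h ↦ by
      have : w = 0 := by linear_combination -h
      simp [this] at hw0
    have hc : HasDerivAt (fun v ↦ riemannZeta (1 - v)) (deriv riemannZeta (1 - w) * (-1)) w :=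
      (differentiableAt_riemannZeta hne).hasDerivAt.comp w ((hasDerivAt_id w).const_sub 1)
    linear_combination -(hc.unique hd)
  refine ⟨h1 z hz hz0, ?_⟩
  have h0 : riemannZeta z ≠ 0 := riemannZeta_ne_zero_of_one_le_re hz.le
  have hne : (1 - z) ≠ 1 := fun h ↦ by
    have : z = 0 := by linear_combination -h
    simp [this] at hz0
  have hζ : HasDerivAt (fun v ↦ riemannZeta (1 - v)) (deriv riemannZeta (1 - z) * (-1)) z :=
    (differentiableAt_riemannZeta hne).hasDerivAt.comp z ((hasDerivAt_id z).const_sub 1)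
  have hRd : HasDerivAt R _ z := (hasDerivAt_zetaFactorLogDeriv (zero_lt_one.trans hz)
    (cos_pi_mul_div_two_ne_zero hz0)).differentiableAt.hasDerivAt.add
    (hasDerivAt_logDeriv_riemannZeta hz)
  have hd : HasDerivAt (fun v ↦ deriv riemannZeta (1 - v)) _ z :=
    (hζ.mul hRd).neg.congr_of_eventuallyEq (by
      filter_upwards [(isOpen_lt continuous_const continuous_re).mem_nhds hz,
        (isOpen_ne.preimage continuous_im).mem_nhds hz0] with v hv hv0
      exact h1 v hv hv0)
  have han : AnalyticAt ℂ riemannZeta (1 - z) := by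
    refine (analyticAt_iff_eventually_differentiableAt).2 ?_
    filter_upwards [isOpen_ne.mem_nhds hne] with v hv
    exact differentiableAt_riemannZeta hv
  have hc : HasDerivAt (fun v ↦ deriv riemannZeta (1 - v))
      (deriv (deriv riemannZeta) (1 - z) * (-1)) z :=
    han.deriv.differentiableAt.hasDerivAt.comp z ((hasDerivAt_id z).const_sub 1)
  have heq := hc.unique hd
  rw [h1 z hz hz0] at heq
  have hX := riemannZeta_one_sub_eq_zetaFactor_mul hz
  have hcan : riemannZeta (1 - z) * (LSeries (fun n ↦ (vonMangoldtLogSum n : ℂ)) z / riemannZeta z)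
      = zetaFactor z * LSeries (fun n ↦ (vonMangoldtLogSum n : ℂ)) z := by
    rw [hX]; field_simp
  rw [← hcan]
  simp only [hR] at heq ⊢
  linear_combination -heq

lemma norm_cos_three_halves_sq (t : ℝ) :
    ‖cos (Real.pi * (3 / 2 - t * I) / 2)‖ ^ 2 = Real.cosh (Real.pi * t) / 2 := by
  have h1 : (Real.pi * (3 / 2 - t * I) / 2 : ℂ) =
      ((3 * Real.pi / 4 : ℝ) : ℂ) + ((-(Real.pi * t / 2) : ℝ) : ℂ) * I := by push_cast; ring
  have hs : Real.sin (3 * Real.pi / 4) ^ 2 = 1 / 2 := by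
    rw [show 3 * Real.pi / 4 = Real.pi - Real.pi / 4 by ring, Real.sin_pi_sub, Real.sin_pi_div_four,
      div_pow, Real.sq_sqrt (by norm_num)]
    norm_num
  have hc : Real.cos (3 * Real.pi / 4) ^ 2 = 1 / 2 := by
    rw [Real.cos_sq', hs]; norm_num
  have hch : Real.cosh (Real.pi * t) = Real.cosh (Real.pi * t / 2) ^ 2 +
      Real.sinh (Real.pi * t / 2) ^ 2 := by
    rw [← Real.cosh_two_mul]; congr 1; ring
  rw [h1, cos_add_mul_I, ← ofReal_cos, ← ofReal_sin, ← ofReal_cosh, ← ofReal_sinh, ← ofReal_mul,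
    ← ofReal_mul, sub_eq_add_neg, ← neg_mul, ← ofReal_neg, ← normSq_eq_norm_sq,
    normSq_add_mul_I, Real.cosh_neg, Real.sinh_neg, hch]
  linear_combination Real.cosh (Real.pi * t / 2) ^ 2 * hc + Real.sinh (Real.pi * t / 2) ^ 2 * hs

lemma norm_zetaFactor_three_halves_sq (t : ℝ) :
    ‖zetaFactor (3 / 2 - t * I)‖ ^ 2 = (1 / 4 + t ^ 2) / (4 * Real.pi ^ 2) := by
  have hpi := Real.pi_pos
  have hpow : ‖(2 * Real.pi : ℂ) ^ (-(3 / 2 - t * I))‖ ^ 2 = ((2 * Real.pi) ^ 3)⁻¹ := by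
    have : (2 * Real.pi : ℂ) = ((2 * Real.pi : ℝ) : ℂ) := by push_cast; rfl
    rw [this, norm_cpow_eq_rpow_re_of_pos (by positivity), ← Real.rpow_natCast,
      ← Real.rpow_mul (by positivity), ← Real.rpow_natCast, ← Real.rpow_neg (by positivity)]
    norm_num
  have hcosh : Real.cosh (Real.pi * t) ≠ 0 := (Real.cosh_pos _).ne'
  rw [zetaFactor, norm_mul, norm_mul, norm_mul, mul_pow, mul_pow, mul_pow, hpow,
    norm_Gamma_three_halves_sq, norm_cos_three_halves_sq]
  norm_num
  field_simp
  norm_num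

lemma norm_zetaFactor_three_halves_bounds {t : ℝ} (ht : 1 ≤ t) :
    ‖zetaFactor (3 / 2 - t * I)‖ ≤ t ∧ t ≤ 2 * Real.pi * ‖zetaFactor (3 / 2 - t * I)‖ := by
  have hpi := Real.pi_gt_three
  have h := norm_zetaFactor_three_halves_sq t
  have h0 := norm_nonneg (zetaFactor (3 / 2 - t * I))
  constructor
  · refine le_of_sq_le_sq ?_ (by linarith)
    rw [h, div_le_iff₀ (by positivity)]
    nlinarith [mul_pos (sub_pos.2 hpi) (sub_pos.2 hpi), sq_nonneg t]
  · refine le_of_sq_le_sq ?_ (by positivity)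
    rw [mul_pow, h]
    field_simp
    nlinarith

lemma norm_deriv_zetaFactorLogDeriv_le {t : ℝ} (ht : 1 ≤ t) :
    ‖deriv zetaFactorLogDeriv (3 / 2 - t * I)‖ ≤ 5 / t := by
  have hpi := Real.pi_gt_three
  have hpi4 := Real.pi_le_four
  have hre : 0 < (3 / 2 - t * I : ℂ).re := by simp
  have him : (3 / 2 - t * I : ℂ).im = -t := by simp
  have hc : cos (Real.pi * (3 / 2 - t * I) / 2) ≠ 0 :=
    cos_pi_mul_div_two_ne_zero (by rw [him]; linarith)
  rw [(hasDerivAt_zetaFactorLogDeriv hre hc).deriv]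
  refine (norm_sub_le _ _).trans ?_
  have h1 := norm_deriv_digamma_le hre ht (by rw [him, abs_neg, abs_of_pos (by linarith)])
  have h2 : ‖((Real.pi : ℂ) / 2) ^ 2 / cos (Real.pi * (3 / 2 - t * I) / 2) ^ 2‖ ≤ 2 / t := by
    rw [norm_div, norm_pow, norm_pow, norm_cos_three_halves_sq, norm_div, norm_real]
    have hch : Real.pi * t ≤ Real.cosh (Real.pi * t) :=
      (Real.self_le_sinh_iff.2 (by positivity)).trans (Real.sinh_lt_cosh _).le
    have : 0 < Real.pi * t := by positivity
    rw [div_le_div_iff₀ (by linarith) (by linarith)]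
    rw [Real.norm_of_nonneg (by linarith)]
    norm_num
    nlinarith
  calc _ ≤ 3 / t + 2 / t := add_le_add h1 h2
    _ = 5 / t := by ring

lemma hasDerivAt_zetaFactorLogDeriv_three_halves {x : ℝ} (hx : 1 ≤ x) :
    HasDerivAt (fun x : ℝ ↦ zetaFactorLogDeriv (3 / 2 - x * I))
      (deriv zetaFactorLogDeriv (3 / 2 - x * I) * (-I)) x := by
  have hc : cos (Real.pi * (3 / 2 - x * I) / 2) ≠ 0 :=
    cos_pi_mul_div_two_ne_zero (by simp; linarith)
  have h := (hasDerivAt_zetaFactorLogDeriv (by simp) hc).differentiableAt.hasDerivAt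
  have hl : HasDerivAt (fun x : ℝ ↦ (3 / 2 - x * I : ℂ)) (-I) x := by
    simpa using ((hasDerivAt_id x).ofReal_comp.mul_const I).const_sub (3 / 2)
  exact h.comp x hl

lemma exists_norm_zetaFactorLogDeriv_le :
    ∃ C, 0 ≤ C ∧ ∀ t : ℝ, 1 ≤ t → ‖zetaFactorLogDeriv (3 / 2 - t * I)‖ ≤ C * (1 + Real.log t) := by
  refine ⟨‖zetaFactorLogDeriv (3 / 2 - (1 : ℝ) * I)‖ + 5, by positivity, fun t ht ↦ ?_⟩
  have hd (x : ℝ) (hx : 1 ≤ x) := hasDerivAt_zetaFactorLogDeriv_three_halves hx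
  have key := image_norm_le_of_norm_deriv_right_le_deriv_boundary' (a := 1) (b := t)
    (f := fun x : ℝ ↦ zetaFactorLogDeriv (3 / 2 - x * I))
    (B := fun x ↦ ‖zetaFactorLogDeriv (3 / 2 - (1 : ℝ) * I)‖ + 5 * Real.log x)
    (B' := fun x ↦ 5 / x)
    (fun x hx ↦ (hd x hx.1).continuousAt.continuousWithinAt)
    (fun x hx ↦ (hd x hx.1).hasDerivWithinAt) (by simp) ?_ ?_ ?_ (x := t) ⟨ht, le_rfl⟩
  · have := Real.log_nonneg ht
    nlinarith [norm_nonneg (zetaFactorLogDeriv (3 / 2 - (1 : ℝ) * I))]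
  · intro x hx
    exact (continuousAt_const.add (continuousAt_const.mul
      (Real.continuousAt_log (by linarith [hx.1])))).continuousWithinAt
  · intro x hx
    have := ((Real.hasDerivAt_log (x := x) (by linarith [hx.1])).const_mul 5).const_add
      ‖zetaFactorLogDeriv (3 / 2 - (1 : ℝ) * I)‖
    exact (this.congr_deriv (by rw [div_eq_mul_inv])).hasDerivWithinAt
  · intro x hx
    rw [norm_mul, norm_neg, norm_I, mul_one]
    exact norm_deriv_zetaFactorLogDeriv_le hx.1

end

section

open MeasureTheory Set Filter Topology

lemma one_add_log_le {t : ℝ} (ht : 0 < t) : 1 + Real.log t ≤ t := by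
  linarith [Real.log_le_sub_one_of_pos ht]

lemma exists_norm_remainder_le (a : ℂ) : ∃ K T₀ : ℝ, 0 ≤ K ∧ 1 ≤ T₀ ∧ ∀ t : ℝ, T₀ ≤ t → ∀ h : ℂ,
    (h + deriv (deriv riemannZeta) (1 - (3 / 2 - t * I))) *
      (riemannZeta (1 - (3 / 2 - t * I)) - a) = deriv riemannZeta (1 - (3 / 2 - t * I)) ^ 2 →
    ‖h + zetaFactor (3 / 2 - t * I) * LSeries (fun n ↦ (vonMangoldtLogSum n : ℂ)) (3 / 2 - t * I) -
      a * zetaFactorLogDeriv (3 / 2 - t * I) ^ 2‖ ≤ K * (1 + Real.log t) := by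
  obtain ⟨C, hC1, hC⟩ := exists_riemannZeta_bounds
  obtain ⟨B, hB0, hB⟩ := exists_norm_zetaFactorLogDeriv_le
  have hpi := Real.pi_pos
  refine ⟨5 * C + ‖a‖ * (2 * B * C + C ^ 2) + ‖a‖ ^ 2 * ((B + C) ^ 2 * (4 * Real.pi * C)),
    1 + 4 * Real.pi * C * ‖a‖, by positivity, ?_, ?_⟩
  · have : 0 ≤ 4 * Real.pi * C * ‖a‖ := by positivity
    linarith
  intro t ht h hh
  have hna := norm_nonneg a
  have ht1 : 1 ≤ t := le_trans (by
    have : 0 ≤ 4 * Real.pi * C * ‖a‖ := by positivity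
    linarith) ht
  have hz : 1 < (3 / 2 - t * I : ℂ).re := by norm_num
  have hz0 : (3 / 2 - t * I : ℂ).im ≠ 0 := by simp; linarith
  obtain ⟨hd1, hd2⟩ := riemannZeta_derivs_one_sub hz hz0
  have hX := riemannZeta_one_sub_eq_zetaFactor_mul hz
  obtain ⟨c1, c2, c3, -⟩ := hC (3 / 2 - t * I) (by simp)
  have hP := hB t ht1
  have hP' := norm_deriv_zetaFactorLogDeriv_le ht1
  obtain ⟨x1, x2⟩ := norm_zetaFactor_three_halves_bounds ht1
  have hL1 : 1 ≤ 1 + Real.log t := by linarith [Real.log_nonneg ht1]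
  have hL2 : 1 + Real.log t ≤ t := one_add_log_le (by linarith)
  set L := 1 + Real.log t
  set z : ℂ := 3 / 2 - t * I
  set w := riemannZeta (1 - z)
  set X := zetaFactor z
  set P := zetaFactorLogDeriv z
  set P' := deriv zetaFactorLogDeriv z
  set D := deriv riemannZeta z / riemannZeta z
  set E := LSeries (fun n ↦ (vonMangoldtLogSum n : ℂ)) z
  have hw : ‖w‖ = ‖X‖ * ‖riemannZeta z‖ := by rw [hX, norm_mul]
  have hw1 : ‖w‖ ≤ t * C := by rw [hw]; gcongr
  have hw2 : t ≤ 2 * Real.pi * C * ‖w‖ := by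
    rw [hw]
    calc t = t * 1 := (mul_one t).symm
      _ ≤ (2 * Real.pi * ‖X‖) * (C * ‖riemannZeta z‖) := by gcongr
      _ = _ := by ring
  have hwa : t ≤ 4 * Real.pi * C * ‖w - a‖ := by
    have h1 := norm_sub_norm_le w a
    have h2 : 4 * Real.pi * C * (‖w‖ - ‖a‖) ≤ 4 * Real.pi * C * ‖w - a‖ := by gcongr
    linarith
  have hwa0 : 0 < ‖w - a‖ := by
    by_contra! hcon
    have : 4 * Real.pi * C * ‖w - a‖ ≤ 0 := mul_nonpos_of_nonneg_of_nonpos (by positivity) hcon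
    linarith
  have hne : w - a ≠ 0 := norm_pos_iff.1 hwa0
  have hid : h + X * E - a * P ^ 2 =
      -(w * P') + a * (2 * P * D + D ^ 2) + a ^ 2 * ((P + D) ^ 2 / (w - a)) := by
    rw [hd1, hd2] at hh
    have hh' : h = (-(w * (P + D))) ^ 2 / (w - a) - (w * ((P + D) ^ 2 + P') + X * E) := by
      rw [eq_sub_iff_add_eq, eq_div_iff hne]; exact hh
    rw [hh']
    field_simp
    ring
  rw [hid]
  have e1 : ‖-(w * P')‖ ≤ 5 * C * L := by
    rw [norm_neg, norm_mul]
    calc ‖w‖ * ‖P'‖ ≤ t * C * (5 / t) := by gcongr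
      _ = 5 * C * 1 := by field_simp
      _ ≤ 5 * C * L := by gcongr
  have e2 : ‖a * (2 * P * D + D ^ 2)‖ ≤ ‖a‖ * (2 * B * C + C ^ 2) * L := by
    rw [norm_mul, mul_assoc ‖a‖]
    gcongr
    refine (norm_add_le _ _).trans ?_
    rw [norm_mul, norm_mul, norm_pow, Complex.norm_ofNat]
    calc 2 * ‖P‖ * ‖D‖ + ‖D‖ ^ 2 ≤ 2 * (B * L) * C + C ^ 2 * 1 := by
          rw [mul_one]; gcongr
      _ ≤ 2 * (B * L) * C + C ^ 2 * L := by gcongr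
      _ = _ := by ring
  have e3 : ‖a ^ 2 * ((P + D) ^ 2 / (w - a))‖ ≤
      ‖a‖ ^ 2 * ((B + C) ^ 2 * (4 * Real.pi * C)) * L := by
    rw [norm_mul, norm_pow, mul_assoc]
    gcongr
    rw [norm_div, norm_pow, div_le_iff₀ hwa0]
    have hR : ‖P + D‖ ≤ (B + C) * L := by
      refine (norm_add_le _ _).trans ?_
      nlinarith
    calc ‖P + D‖ ^ 2 ≤ ((B + C) * L) ^ 2 := by gcongr
      _ = (B + C) ^ 2 * L * L := by ring
      _ ≤ (B + C) ^ 2 * L * (4 * Real.pi * C * ‖w - a‖) := by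
          gcongr; exact hL2.trans hwa
      _ = _ := by ring
  calc _ ≤ _ := norm_add₃_le
    _ ≤ _ := add_le_add (add_le_add e1 e2) e3
    _ = _ := by ring

lemma integral_one_add_log_mul_exp_le {θ T : ℝ} (hθ : 0 < θ) (hT : 1 ≤ T) :
    IntegrableOn (fun t : ℝ ↦ (1 + Real.log t) * Real.exp (-(θ * t))) (Ioi T) ∧
    ∫ t in Ioi T, (1 + Real.log t) * Real.exp (-(θ * t)) ≤ (1 + |Real.log θ|) / θ := by
  set c := |Real.log θ|
  have hc : 0 ≤ c := abs_nonneg _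
  have hderiv (t : ℝ) : HasDerivAt (fun t ↦ -((c + 1 + θ * t) * Real.exp (-(θ * t)) / θ))
      ((c + θ * t) * Real.exp (-(θ * t))) t := by
    have h1 : HasDerivAt (fun t : ℝ ↦ θ * t) θ t := by simpa using (hasDerivAt_id t).const_mul θ
    refine (((h1.const_add (c + 1)).mul h1.neg.exp).div_const θ).neg.congr_deriv ?_
    simp only [Pi.neg_apply]
    field_simp
    ring
  have hpos : ∀ t ∈ Ioi T, 0 ≤ (c + θ * t) * Real.exp (-(θ * t)) := fun t ht ↦ by
    have : 0 < t := by linarith [mem_Ioi.1 ht]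
    positivity
  have hlim : Tendsto (fun t ↦ -((c + 1 + θ * t) * Real.exp (-(θ * t)) / θ)) atTop (𝓝 0) := by
    have h0 := tendsto_rpow_mul_exp_neg_mul_atTop_nhds_zero 0 θ hθ
    have h1 := tendsto_rpow_mul_exp_neg_mul_atTop_nhds_zero 1 θ hθ
    have h2 := (((h0.const_mul (c + 1)).add (h1.const_mul θ)).div_const θ).neg
    simp only [mul_zero, add_zero, zero_div, neg_zero] at h2
    refine h2.congr fun t ↦ ?_
    simp only [Real.rpow_zero, Real.rpow_one, neg_mul]
    ring
  have hgi := integrableOn_Ioi_deriv_of_nonneg' (fun t _ ↦ hderiv t) hpos hlim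
  have hle : ∀ t ∈ Ioi T, (1 + Real.log t) * Real.exp (-(θ * t)) ≤
      (c + θ * t) * Real.exp (-(θ * t)) := fun t ht ↦ by
    have ht0 : 0 < t := by linarith [mem_Ioi.1 ht]
    refine mul_le_mul_of_nonneg_right ?_ (Real.exp_pos _).le
    have h1 := Real.log_le_sub_one_of_pos (mul_pos hθ ht0)
    rw [Real.log_mul hθ.ne' ht0.ne'] at h1
    linarith [neg_abs_le (Real.log θ)]
  have hgi' : IntegrableOn (fun t : ℝ ↦ (1 + Real.log t) * Real.exp (-(θ * t))) (Ioi T) := by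
    refine hgi.mono' (by fun_prop) (ae_restrict_of_forall_mem measurableSet_Ioi fun t ht ↦ ?_)
    rw [Real.norm_of_nonneg]
    · exact hle t ht
    · have := Real.log_nonneg (hT.trans (le_of_lt ht))
      positivity
  refine ⟨hgi', (setIntegral_mono_on hgi' hgi measurableSet_Ioi hle).trans ?_⟩
  rw [integral_Ioi_of_hasDerivAt_of_nonneg' (fun t _ ↦ hderiv t) hpos hlim, zero_sub, neg_neg]
  have hx : 0 ≤ θ * T := by positivity
  gcongr
  have h2 : Real.exp (-(θ * T)) * (θ * T + 1) ≤ 1 := by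
    rw [Real.exp_neg, inv_mul_le_iff₀ (Real.exp_pos _), mul_one]
    exact Real.add_one_le_exp _
  have h3 : Real.exp (-(θ * T)) ≤ 1 := Real.exp_le_one_iff.2 (by linarith)
  nlinarith

lemma norm_exp_mul_neg_half_le {l : ℂ} (hl : 0 ≤ l.re) (t : ℝ) :
    ‖exp (l * (1 - (3 / 2 - t * I)))‖ ≤ Real.exp (-(l.im * t)) := by
  rw [norm_exp]
  refine Real.exp_le_exp.2 ?_
  simp
  linarith

lemma integrableOn_mul_exp {f : ℝ → ℂ} {T C : ℝ} {l : ℂ} (hl : 0 ≤ l.re) (hl0 : 0 < l.im)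
    (hT : 0 ≤ T) (hf : AEStronglyMeasurable f (volume.restrict (Ioi T)))
    (hfC : ∀ t ∈ Ioi T, ‖f t‖ ≤ C * (1 + t) ^ 2) :
    IntegrableOn (fun t ↦ f t * exp (l * (1 - (3 / 2 - t * I)))) (Ioi T) := by
  refine ((integrable_sq_mul_exp_neg_mul_abs hl0).const_mul C).integrableOn.mono'
    (hf.mul (by fun_prop)) (ae_restrict_of_forall_mem measurableSet_Ioi fun t ht ↦ ?_)
  have ht0 : 0 ≤ t := hT.trans (le_of_lt ht)
  rw [norm_mul, abs_of_nonneg ht0, ← mul_assoc, neg_mul]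
  exact mul_le_mul (hfC t ht) (norm_exp_mul_neg_half_le hl t) (norm_nonneg _)
    ((norm_nonneg _).trans (hfC t ht))

lemma exists_norm_integral_sq_le {T : ℝ} (hT : 1 ≤ T) : ∃ K : ℝ, 0 ≤ K ∧ ∀ l : ℂ, 0 < l.im →
    Real.log 2 ≤ l.re →
    IntegrableOn (fun t : ℝ ↦ zetaFactorLogDeriv (3 / 2 - t * I) ^ 2 *
      exp (l * (1 - (3 / 2 - t * I)))) (Ioi T) ∧
    ‖∫ t in Ioi T, zetaFactorLogDeriv (3 / 2 - t * I) ^ 2 * exp (l * (1 - (3 / 2 - t * I)))‖ ≤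
      K * (1 + 1 / l.im) := by
  obtain ⟨B, hB0, hB⟩ := exists_norm_zetaFactorLogDeriv_le
  have hlog2 : 0 < Real.log 2 := Real.log_pos one_lt_two
  refine ⟨(B ^ 2 * T ^ 2 + 10 * B) / Real.log 2, by positivity, fun l hl0 hl2 ↦ ?_⟩
  have hlre : 0 ≤ l.re := hlog2.le.trans hl2
  have hBt (t : ℝ) (ht : 1 ≤ t) : ‖zetaFactorLogDeriv (3 / 2 - t * I)‖ ≤ B * t :=
    (hB t ht).trans (by gcongr; exact one_add_log_le (by linarith))
  have hlI : l * I ≠ 0 := mul_ne_zero (fun h ↦ by simp [h] at hl0) I_ne_zero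
  have hnl : Real.log 2 ≤ ‖l * I‖ := by
    rw [norm_mul, norm_I, mul_one]; exact hl2.trans (re_le_norm l)
  set p : ℝ → ℂ := fun t ↦ zetaFactorLogDeriv (3 / 2 - t * I) with hp
  set p' : ℝ → ℂ := fun t ↦ 2 * p t * (deriv zetaFactorLogDeriv (3 / 2 - t * I) * (-I)) with hp'
  set V : ℝ → ℂ := fun t ↦ exp (l * (1 - (3 / 2 - t * I))) with hV
  have hpd (t : ℝ) (ht : 1 ≤ t) : HasDerivAt (fun t ↦ p t ^ 2) (p' t) t := by
    have := (hasDerivAt_zetaFactorLogDeriv_three_halves ht).pow 2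
    exact this.congr_deriv (by simp [hp', hp])
  have hVd (t : ℝ) : HasDerivAt (fun t ↦ V t / (l * I)) (V t) t := by
    have h1 : HasDerivAt (fun t : ℝ ↦ l * (1 - (3 / 2 - t * I))) (l * I) t := by
      simpa using (((((hasDerivAt_id t).ofReal_comp.mul_const I).const_sub (3 / 2)).const_sub
        1).const_mul l)
    exact (h1.cexp.div_const (l * I)).congr_deriv (mul_div_cancel_right₀ _ hlI)
  have hpcont : ContinuousOn p (Ioi T) := fun t ht ↦
    (hasDerivAt_zetaFactorLogDeriv_three_halves
      (hT.trans (le_of_lt ht))).continuousAt.continuousWithinAt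
  have hpm : AEStronglyMeasurable p (volume.restrict (Ioi T)) :=
    hpcont.aestronglyMeasurable measurableSet_Ioi
  have hp'm : AEStronglyMeasurable p' (volume.restrict (Ioi T)) := by
    refine (hpm.const_mul 2).mul (AEStronglyMeasurable.mul_const ?_ _)
    exact ((measurable_deriv zetaFactorLogDeriv).comp (by fun_prop)).aestronglyMeasurable
  have hp'b : ∀ t ∈ Ioi T, ‖p' t‖ ≤ 10 * B := fun t ht ↦ by
    have ht1 : 1 ≤ t := hT.trans (le_of_lt ht)
    simp only [hp', norm_mul, norm_neg, norm_I, mul_one, Complex.norm_ofNat]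
    calc 2 * ‖p t‖ * ‖deriv zetaFactorLogDeriv (3 / 2 - t * I)‖ ≤ 2 * (B * t) * (5 / t) := by
          gcongr
          · exact hBt t ht1
          · exact norm_deriv_zetaFactorLogDeriv_le ht1
      _ = 10 * B := by field_simp; ring
  have hi1 : IntegrableOn (fun t ↦ p t ^ 2 * V t) (Ioi T) := by
    refine integrableOn_mul_exp (C := B ^ 2) hlre hl0 (by linarith) (hpm.pow 2) fun t ht ↦ ?_
    have ht1 : 1 ≤ t := hT.trans (le_of_lt ht)
    rw [norm_pow, ← mul_pow]
    gcongr
    exact (hBt t ht1).trans (by gcongr; linarith)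
  have hi2 : IntegrableOn (fun t ↦ p' t * V t) (Ioi T) := by
    refine integrableOn_mul_exp (C := 10 * B) hlre hl0 (by linarith) hp'm fun t ht ↦ ?_
    refine (hp'b t ht).trans (le_mul_of_one_le_right (by positivity) ?_)
    have ht1 : 1 ≤ t := hT.trans (le_of_lt ht)
    nlinarith
  refine ⟨hi1, ?_⟩
  have hlim : Tendsto (fun t ↦ p t ^ 2 * (V t / (l * I))) atTop (𝓝 0) := by
    refine squeeze_zero_norm' (a := fun t : ℝ ↦ B ^ 2 / ‖l * I‖ *
      (t ^ (2 : ℝ) * Real.exp (-l.im * t))) ?_ ?_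
    · filter_upwards [eventually_ge_atTop 1] with t ht
      rw [norm_mul, norm_pow, norm_div]
      have h1 := hBt t ht
      have h2 := norm_exp_mul_neg_half_le hlre t
      calc ‖p t‖ ^ 2 * (‖V t‖ / ‖l * I‖) ≤ (B * t) ^ 2 * (Real.exp (-(l.im * t)) / ‖l * I‖) := by
            gcongr
        _ = _ := by rw [Real.rpow_two, neg_mul]; ring
    · simpa using (tendsto_rpow_mul_exp_neg_mul_atTop_nhds_zero 2 l.im hl0).const_mul
        (B ^ 2 / ‖l * I‖)
  have hparts := integral_Ioi_of_hasDerivAt_of_tendsto'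
    (fun t ht ↦ (hpd t (hT.trans ht)).mul (hVd t)) ((hi2.div_const (l * I)).add hi1 |>.congr (by
      refine Eventually.of_forall fun t ↦ ?_
      simp only [Pi.add_apply]
      ring)) hlim
  have hsplit : ∫ t in Ioi T, (p' t * (V t / (l * I)) + p t ^ 2 * V t) =
      (∫ t in Ioi T, p' t * V t) / (l * I) + ∫ t in Ioi T, p t ^ 2 * V t := by
    rw [← integral_div, ← integral_add (hi2.div_const _) hi1]
    simp only [mul_div_assoc]
  rw [hsplit, Pi.mul_apply] at hparts
  have hJ : ∫ t in Ioi T, p t ^ 2 * V t =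
      -(p T ^ 2 * V T) / (l * I) - (∫ t in Ioi T, p' t * V t) / (l * I) := by
    linear_combination hparts
  rw [hJ, ← sub_div, norm_div, div_mul_eq_mul_div]
  have hexp : ∫ t in Ioi T, Real.exp (-(l.im * t)) ≤ 1 / l.im := by
    have h := integral_exp_mul_Ioi (a := -l.im) (by linarith) T
    simp only [neg_mul] at h
    rw [h, neg_div_neg_eq]
    gcongr
    exact Real.exp_le_one_iff.2 (by simp; positivity)
  have hexpi : IntegrableOn (fun t ↦ Real.exp (-(l.im * t))) (Ioi T) := by
    simpa only [neg_mul] using integrableOn_exp_mul_Ioi (a := -l.im) (by linarith) T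
  have b1 : ‖∫ t in Ioi T, p' t * V t‖ ≤ 10 * B * (1 / l.im) := by
    refine (norm_integral_le_of_norm_le (hexpi.const_mul (10 * B))
      (ae_restrict_of_forall_mem measurableSet_Ioi fun t ht ↦ ?_)).trans ?_
    · rw [norm_mul]
      exact mul_le_mul (hp'b t ht) (norm_exp_mul_neg_half_le hlre t) (norm_nonneg _) (by positivity)
    · rw [integral_const_mul]
      gcongr
  have b2 : ‖p T ^ 2 * V T‖ ≤ B ^ 2 * T ^ 2 := by
    rw [norm_mul, norm_pow, ← mul_pow]
    have h1 := hBt T hT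
    have h2 : ‖V T‖ ≤ 1 :=
      (norm_exp_mul_neg_half_le hlre T).trans (Real.exp_le_one_iff.2 (by simp; positivity))
    calc ‖p T‖ ^ 2 * ‖V T‖ ≤ (B * T) ^ 2 * 1 := by gcongr
      _ = _ := mul_one _
  refine div_le_div₀ (by positivity) ?_ hlog2 hnl
  refine (norm_sub_le _ _).trans ?_
  rw [norm_neg]
  have : 0 < 1 / l.im := by positivity
  nlinarith [mul_nonneg (mul_nonneg (sq_nonneg B) (sq_nonneg T)) this.le]

lemma exists_norm_integral_zetaFactor_le (a : ℂ) : ∃ T₀ : ℝ, 1 ≤ T₀ ∧ ∀ T ≥ T₀, ∃ K : ℝ, 0 ≤ K ∧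
    ∀ H : ℝ → ℂ, ContinuousOn H (Ioi T) →
    (∀ t ∈ Ioi T, (H t + deriv (deriv riemannZeta) (1 - (3 / 2 - t * I))) *
      (riemannZeta (1 - (3 / 2 - t * I)) - a) = deriv riemannZeta (1 - (3 / 2 - t * I)) ^ 2) →
    ∀ l : ℂ, 0 < l.im → Real.log 2 ≤ l.re →
      IntegrableOn (fun t ↦ H t * exp (l * (1 - (3 / 2 - t * I)))) (Ioi T) ∧
      ‖∫ t in Ioi T, zetaFactor (3 / 2 - t * I) *
          LSeries (fun n ↦ (vonMangoldtLogSum n : ℂ)) (3 / 2 - t * I) *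
          exp (l * (1 - (3 / 2 - t * I)))‖ ≤
        ‖∫ t in Ioi T, H t * exp (l * (1 - (3 / 2 - t * I)))‖ +
          K * (1 + (1 + |Real.log l.im|) / l.im) := by
  obtain ⟨K₁, T₀, hK₁, hT₀, hrem⟩ := exists_norm_remainder_le a
  obtain ⟨C, hC1, hC⟩ := exists_riemannZeta_bounds
  refine ⟨T₀, hT₀, fun T hT ↦ ?_⟩
  have hT1 : 1 ≤ T := hT₀.trans hT
  obtain ⟨K₂, hK₂, hsq⟩ := exists_norm_integral_sq_le hT1
  refine ⟨‖a‖ * K₂ + K₁, by positivity, fun H hH hHeq l hl0 hl2 ↦ ?_⟩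
  have hlre : 0 ≤ l.re := (Real.log_pos one_lt_two).le.trans hl2
  obtain ⟨hi2, hb2⟩ := hsq l hl0 hl2
  obtain ⟨hi3, hb3⟩ := integral_one_add_log_mul_exp_le hl0 hT1
  set V : ℝ → ℂ := fun t ↦ exp (l * (1 - (3 / 2 - t * I))) with hV
  set P : ℝ → ℂ := fun t ↦ zetaFactorLogDeriv (3 / 2 - t * I) with hP
  set Y : ℝ → ℂ := fun t ↦ zetaFactor (3 / 2 - t * I) *
    LSeries (fun n ↦ (vonMangoldtLogSum n : ℂ)) (3 / 2 - t * I) with hY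
  have hYc : ContinuousOn Y (Ioi T) := by
    refine ContinuousOn.mul (fun t ht ↦ ?_) (continuous_LSeries_three_halves
      (LSeriesSummable_vonMangoldtLogSum (by norm_num))).continuousOn
    have ht1 : 1 < t := hT1.trans_lt ht
    have hc : cos (Real.pi * (3 / 2 - t * I) / 2) ≠ 0 :=
      cos_pi_mul_div_two_ne_zero (by simp; linarith)
    have h1 : ContinuousAt zetaFactor (3 / 2 - t * I) :=
      (hasDerivAt_zetaFactor (by simp) hc).continuousAt
    exact (ContinuousAt.comp (f := fun t : ℝ ↦ (3 / 2 - t * I : ℂ)) h1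
      (by fun_prop)).continuousWithinAt
  have hPc : ContinuousOn P (Ioi T) := fun t ht ↦
    (hasDerivAt_zetaFactorLogDeriv_three_halves
      (hT1.trans (le_of_lt ht))).continuousAt.continuousWithinAt
  have hi1 : IntegrableOn (fun t ↦ Y t * V t) (Ioi T) := by
    refine integrableOn_mul_exp (C := C) hlre hl0 (by linarith)
      (hYc.aestronglyMeasurable measurableSet_Ioi) fun t ht ↦ ?_
    have ht1 : 1 ≤ t := hT1.trans (le_of_lt ht)
    rw [norm_mul]
    have h1 := (norm_zetaFactor_three_halves_bounds ht1).1
    have h2 := (hC (3 / 2 - t * I) (by simp)).2.2.2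
    calc _ ≤ t * C := mul_le_mul h1 h2 (norm_nonneg _) (by linarith)
      _ = C * t := mul_comm _ _
      _ ≤ C * (1 + t) ^ 2 := by gcongr; nlinarith
  set Q : ℝ → ℂ := fun t ↦ H t + Y t - a * P t ^ 2 with hQ
  have hQb : ∀ t ∈ Ioi T, ‖Q t * V t‖ ≤ K₁ * ((1 + Real.log t) * Real.exp (-(l.im * t))) :=
    fun t ht ↦ by
    rw [norm_mul, ← mul_assoc]
    have h1 := hrem t (hT.trans (le_of_lt ht)) (H t) (hHeq t ht)
    exact mul_le_mul h1 (norm_exp_mul_neg_half_le hlre t) (norm_nonneg _)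
      ((norm_nonneg _).trans h1)
  have hi4 : IntegrableOn (fun t ↦ Q t * V t) (Ioi T) := by
    refine (hi3.const_mul K₁).mono' ?_ (ae_restrict_of_forall_mem measurableSet_Ioi hQb)
    refine ContinuousOn.aestronglyMeasurable ?_ measurableSet_Ioi
    exact ((hH.add hYc).sub (continuousOn_const.mul (hPc.pow 2))).mul
      (by fun_prop : Continuous V).continuousOn
  have hb4 : ‖∫ t in Ioi T, Q t * V t‖ ≤ K₁ * ((1 + |Real.log l.im|) / l.im) := by
    refine (norm_integral_le_of_norm_le (hi3.const_mul K₁)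
      (ae_restrict_of_forall_mem measurableSet_Ioi hQb)).trans ?_
    rw [integral_const_mul]
    gcongr
  have hi5 : IntegrableOn (fun t ↦ H t * V t) (Ioi T) := by
    refine ((hi4.sub hi1).add (hi2.const_mul a)).congr (Eventually.of_forall fun t ↦ ?_)
    simp only [Pi.add_apply, Pi.sub_apply, hQ]
    ring
  refine ⟨hi5, ?_⟩
  have hdec : ∫ t in Ioi T, Y t * V t = (∫ t in Ioi T, Q t * V t) - (∫ t in Ioi T, H t * V t) +
      a * ∫ t in Ioi T, P t ^ 2 * V t := by
    have hi2a : IntegrableOn (fun t ↦ a * (P t ^ 2 * V t)) (Ioi T) := hi2.const_mul a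
    have hi45 : IntegrableOn (fun t ↦ Q t * V t - H t * V t) (Ioi T) := hi4.sub hi5
    rw [← integral_const_mul, ← integral_sub hi4 hi5, ← integral_add hi45 hi2a]
    congr 1
    ext t
    simp only [hQ]
    ring
  rw [hdec]
  have hn := (norm_add_le ((∫ t in Ioi T, Q t * V t) - ∫ t in Ioi T, H t * V t)
    (a * ∫ t in Ioi T, P t ^ 2 * V t)).trans (add_le_add_left (norm_sub_le _ _) _)
  rw [norm_mul] at hn
  have hb2' := mul_le_mul_of_nonneg_left hb2 (norm_nonneg a)
  have h3 : 1 / l.im ≤ (1 + |Real.log l.im|) / l.im := by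
    gcongr; linarith [abs_nonneg (Real.log l.im)]
  have h4 := mul_le_mul_of_nonneg_left h3 (mul_nonneg (norm_nonneg a) hK₂)
  linarith

end

section

open MeasureTheory Set Filter Topology

/-- If all zeros of `g` are multiple, then `g' ^ 2 / g` extends analytically over them. -/
lemma exists_analyticOnNhd_mul_eq_deriv_sq {g : ℂ → ℂ} {U : Set ℂ} (hg : AnalyticOnNhd ℂ g U)
    (hfin : ∀ s ∈ U, ¬ ∀ᶠ z in 𝓝 s, g z = 0) (hmult : ∀ s ∈ U, g s = 0 → deriv g s = 0) :
    ∃ F : ℂ → ℂ, AnalyticOnNhd ℂ F U ∧ ∀ s ∈ U, F s * g s = deriv g s ^ 2 := by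
  set f : ℂ → ℂ := fun z ↦ deriv g z ^ 2 / g z with hf
  have hmer : MeromorphicOn f U := fun s hs ↦
    ((hg s hs).deriv.pow 2).meromorphicAt.div (hg s hs).meromorphicAt
  refine ⟨toMeromorphicNFOn f U, fun s hs ↦ ?_, fun s hs ↦ ?_⟩
  · have hNF : MeromorphicNFAt (toMeromorphicNFOn f U) s := meromorphicNFOn_toMeromorphicNFOn f U hs
    refine hNF.meromorphicOrderAt_nonneg_iff_analyticAt.1 ?_
    rw [meromorphicOrderAt_toMeromorphicNFOn hmer hs]
    obtain ⟨n, h, hh, hh0, heq⟩ := (hg s hs).exists_eventuallyEq_pow_smul_nonzero_iff.2 (hfin s hs)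
    simp only [smul_eq_mul] at heq
    rcases n with _ | n
    · have hgs : g s ≠ 0 := by simpa [heq.self_of_nhds] using hh0
      exact (((hg s hs).deriv.pow 2).div (hg s hs) hgs).meromorphicOrderAt_nonneg
    have hd : ∀ᶠ z in 𝓝 s, deriv g z = (z - s) ^ n * ((n + 1) * h z + (z - s) * deriv h z) := by
      filter_upwards [heq.eventually_nhds, hh.eventually_analyticAt] with z hz hhz
      rw [EventuallyEq.deriv_eq hz]
      refine (((((hasDerivAt_id z).sub_const s).pow (n + 1)).mul
        hhz.differentiableAt.hasDerivAt).congr_deriv ?_).deriv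
      simp
      ring
    rcases n with _ | n
    · have h1 := hmult s hs (by simp [heq.self_of_nhds])
      rw [hd.self_of_nhds] at h1
      simp [hh0] at h1
    have ha : AnalyticAt ℂ (fun z ↦ (z - s) ^ n *
        ((((n + 1 : ℕ) : ℂ) + 1) * h z + (z - s) * deriv h z) ^ 2 / h z) s := by
      have := hh.deriv
      fun_prop (disch := assumption)
    refine ha.meromorphicOrderAt_nonneg.trans_eq (meromorphicOrderAt_congr ?_)
    filter_upwards [heq.filter_mono nhdsWithin_le_nhds, hd.filter_mono nhdsWithin_le_nhds,
      (hh.continuousAt.eventually_ne hh0).filter_mono nhdsWithin_le_nhds,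
      self_mem_nhdsWithin] with z h1 h2 h3 h4
    have : z - s ≠ 0 := sub_ne_zero.2 h4
    simp only [hf, h1, h2]
    field_simp
    ring
  · by_cases h0 : g s = 0
    · simp [h0, hmult s hs h0]
    · have hfa : AnalyticAt ℂ f s := ((hg s hs).deriv.pow 2).div (hg s hs) h0
      rw [toMeromorphicNFOn_eq_toMeromorphicNFAt hmer hs,
        toMeromorphicNFAt_eq_self.2 hfa.meromorphicNFAt]
      simp only [hf]
      field_simp

/-- Every value `a` is avoided by `ζ`, uniformly, on some vertical line. -/
lemma exists_le_norm_riemannZeta_sub (a : ℂ) :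
    ∃ c m : ℝ, 4 ≤ c ∧ 0 < m ∧ ∀ s : ℂ, s.re = c → m ≤ ‖riemannZeta s - a‖ := by
  have hsum : Summable fun n : ℕ ↦ 1 / ((n : ℝ) + 3) ^ 2 := by
    have := (summable_nat_add_iff 3).2 (Real.summable_one_div_nat_pow.2 (one_lt_two))
    simpa using this
  set S : ℝ := ∑' n : ℕ, 1 / ((n : ℝ) + 3) ^ 2 with hS
  have key : ∀ k : ℕ, ∀ s : ℂ, s.re = (k + 2 : ℕ) →
      ‖riemannZeta s - 1 - 1 / 2 ^ s‖ ≤ S * (1 / 3) ^ k := by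
    intro k s hs
    have hs1 : 1 < s.re := by rw [hs]; push_cast; linarith [k.cast_nonneg (α := ℝ)]
    have hsm : Summable fun n : ℕ ↦ 1 / ((n : ℂ) + 1) ^ s := by
      have := (summable_nat_add_iff 1).2 (Complex.summable_one_div_nat_cpow.2 hs1)
      simpa using this
    have h1 := hsm.sum_add_tsum_nat_add 2
    rw [← zeta_eq_tsum_one_div_nat_add_one_cpow hs1] at h1
    have h2 : riemannZeta s - 1 - 1 / 2 ^ s =
        ∑' n : ℕ, 1 / (((n + 2 : ℕ) : ℂ) + 1) ^ s := by
      rw [← h1]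
      simp only [Finset.sum_range_succ, Finset.sum_range_zero, Nat.cast_zero, Nat.cast_one,
        zero_add, one_add_one_eq_two, one_cpow, div_one]
      ring
    rw [h2]
    refine tsum_of_norm_bounded (hsum.hasSum.mul_right _) fun n ↦ ?_
    have h3 : ((n + 2 : ℕ) : ℂ) + 1 = ((n + 3 : ℝ) : ℂ) := by push_cast; ring
    have hn : (0 : ℝ) < n + 3 := by positivity
    rw [h3, norm_div, norm_one, norm_cpow_eq_rpow_re_of_pos hn, hs, Real.rpow_natCast, pow_add,
      one_div_pow, ← one_div_mul_one_div, mul_comm]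
    gcongr
    linarith [n.cast_nonneg (α := ℝ)]
  have htwo : ∀ k : ℕ, ∀ s : ℂ, s.re = (k + 2 : ℕ) → ‖1 / (2 : ℂ) ^ s‖ = (1 / 4) * (1 / 2) ^ k := by
    intro k s hs
    have h3 : (2 : ℂ) = ((2 : ℝ) : ℂ) := by simp
    rw [h3, norm_div, norm_one, norm_cpow_eq_rpow_re_of_pos two_pos, hs, Real.rpow_natCast]
    rw [pow_add, one_div_pow]
    field_simp
    norm_num
  by_cases ha : a = 1
  · have hlim : Tendsto (fun k : ℕ ↦ 1 / 4 - S * (2 / 3 : ℝ) ^ k) atTop (𝓝 (1 / 4 - S * 0)) :=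
      tendsto_const_nhds.sub ((tendsto_pow_atTop_nhds_zero_of_lt_one (by norm_num)
        (by norm_num)).const_mul S)
    obtain ⟨k, hk, hk2⟩ := ((hlim.eventually_const_lt (u := 0) (by norm_num)).and
      (eventually_ge_atTop 2)).exists
    refine ⟨(k + 2 : ℕ), (1 / 2) ^ k * (1 / 4 - S * (2 / 3 : ℝ) ^ k), by exact_mod_cast by omega,
      by positivity, fun s hs ↦ ?_⟩
    have h1 := key k s hs
    have h2 := htwo k s hs
    have h3 := norm_sub_norm_le (1 / (2 : ℂ) ^ s) (-(riemannZeta s - 1 - 1 / 2 ^ s))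
    rw [norm_neg, h2] at h3
    have h4 : (1 / 2 : ℝ) ^ k * (2 / 3) ^ k = (1 / 3) ^ k := by rw [← mul_pow]; norm_num
    have h5 : (1 / (2 : ℂ) ^ s) - (-(riemannZeta s - 1 - 1 / 2 ^ s)) = riemannZeta s - a := by
      rw [ha]; ring
    rw [h5] at h3
    calc _ = 1 / 4 * (1 / 2) ^ k - S * ((1 / 2 : ℝ) ^ k * (2 / 3) ^ k) := by ring
      _ ≤ _ := by rw [h4]; linarith
  · have h0 : 0 < ‖1 - a‖ := norm_pos_iff.2 (sub_ne_zero.2 (Ne.symm ha))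
    have hlim : Tendsto (fun k : ℕ ↦ 1 / 4 * (1 / 2 : ℝ) ^ k + S * (1 / 3 : ℝ) ^ k) atTop
        (𝓝 (1 / 4 * 0 + S * 0)) :=
      ((tendsto_pow_atTop_nhds_zero_of_lt_one (by norm_num) (by norm_num)).const_mul _).add
        ((tendsto_pow_atTop_nhds_zero_of_lt_one (by norm_num) (by norm_num)).const_mul S)
    obtain ⟨k, hk, hk2⟩ := ((hlim.eventually_lt_const (u := ‖1 - a‖ / 2) (by simpa using h0)).and
      (eventually_ge_atTop 2)).exists
    refine ⟨(k + 2 : ℕ), ‖1 - a‖ / 2, by exact_mod_cast by omega, by positivity, fun s hs ↦ ?_⟩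
    have h1 := key k s hs
    have h2 := htwo k s hs
    have h3 := norm_sub_norm_le (1 - a) (-(riemannZeta s - 1))
    have h4 := norm_sub_norm_le (riemannZeta s - 1) (1 / 2 ^ s)
    have h5 : 1 - a - (-(riemannZeta s - 1)) = riemannZeta s - a := by ring
    rw [h5, norm_neg] at h3
    linarith

lemma differentiableOn_riemannZeta_im_pos : DifferentiableOn ℂ riemannZeta {s | 0 < s.im} :=
  fun s hs ↦ (differentiableAt_riemannZeta (by rintro rfl; simp at hs)).differentiableWithinAt

lemma analyticOnNhd_riemannZeta_im_pos : AnalyticOnNhd ℂ riemannZeta {s | 0 < s.im} :=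
  differentiableOn_riemannZeta_im_pos.analyticOnNhd (isOpen_lt continuous_const continuous_im)

lemma norm_deriv_le_of_norm_le_ball_one {f : ℂ → ℂ} {s : ℂ} {C : ℝ}
    (hf : DifferentiableOn ℂ f (Metric.closedBall s 1))
    (hC : ∀ z ∈ Metric.closedBall s 1, ‖f z‖ ≤ C) : ‖deriv f s‖ ≤ C := by
  have := norm_deriv_le_of_forall_mem_sphere_norm_le one_pos
    ((hf.mono Metric.closure_ball_subset_closedBall).diffContOnCl)
    fun z hz ↦ hC z (Metric.sphere_subset_closedBall hz)
  simpa using this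

lemma abs_re_sub_le_and_abs_im_sub_le {s z : ℂ} {r : ℝ} (hz : z ∈ Metric.closedBall s r) :
    |z.re - s.re| ≤ r ∧ |z.im - s.im| ≤ r := by
  rw [mem_closedBall_iff_norm] at hz
  exact ⟨(abs_re_le_norm (z - s)).trans hz, (abs_im_le_norm (z - s)).trans hz⟩

lemma closedBall_subset_im_pos {s : ℂ} {r : ℝ} (h : r < s.im) :
    Metric.closedBall s r ⊆ {s | 0 < s.im} := fun z hz ↦ by
  have := abs_le.1 (abs_re_sub_le_and_abs_im_sub_le hz).2
  simp only [mem_ofPred_eq]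
  linarith

lemma exists_norm_riemannZeta_derivs_le_exp (A : ℝ) : ∃ C : ℝ, 0 ≤ C ∧ ∀ s : ℂ, A ≤ s.re →
    3 ≤ s.im → ‖riemannZeta s‖ ≤ Real.exp (C * s.im) ∧
      ‖deriv riemannZeta s‖ ≤ Real.exp (C * s.im) ∧
      ‖deriv (deriv riemannZeta) s‖ ≤ Real.exp (C * s.im) := by
  obtain ⟨C, hC, h⟩ := exists_norm_riemannZeta_le_exp (A - 2)
  have h1 : ∀ s : ℂ, A - 1 ≤ s.re → 2 ≤ s.im →
      ‖deriv riemannZeta s‖ ≤ Real.exp (C * (s.im + 1)) := by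
    intro s hs1 hs2
    refine norm_deriv_le_of_norm_le_ball_one (differentiableOn_riemannZeta_im_pos.mono
      (closedBall_subset_im_pos (by linarith))) fun z hz ↦ ?_
    obtain ⟨hr, hi⟩ := abs_re_sub_le_and_abs_im_sub_le hz
    rw [abs_le] at hr hi
    refine (h z (by linarith) (by linarith)).trans ?_
    gcongr
    linarith
  have h2 : ∀ s : ℂ, A ≤ s.re → 3 ≤ s.im →
      ‖deriv (deriv riemannZeta) s‖ ≤ Real.exp (C * (s.im + 2)) := by
    intro s hs1 hs2
    refine norm_deriv_le_of_norm_le_ball_one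
      (analyticOnNhd_riemannZeta_im_pos.deriv.differentiableOn.mono
        (closedBall_subset_im_pos (by linarith))) fun z hz ↦ ?_
    obtain ⟨hr, hi⟩ := abs_re_sub_le_and_abs_im_sub_le hz
    rw [abs_le] at hr hi
    refine (h1 z (by linarith) (by linarith)).trans (Real.exp_le_exp.2 ?_)
    exact mul_le_mul_of_nonneg_left (by linarith) hC
  refine ⟨2 * C, by positivity, fun s hs1 hs2 ↦ ⟨(h s (by linarith) (by linarith)).trans ?_,
    (h1 s (by linarith) (by linarith)).trans ?_, (h2 s hs1 hs2).trans ?_⟩⟩ <;>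
  · rw [Real.exp_le_exp]
    nlinarith

lemma exists_norm_riemannZeta_derivs_le {c : ℝ} (hc : 4 ≤ c) : ∃ C : ℝ, 0 ≤ C ∧ ∀ s : ℂ, c ≤ s.re →
    3 ≤ s.im → ‖deriv riemannZeta s‖ ≤ C ∧ ‖deriv (deriv riemannZeta) s‖ ≤ C := by
  set C : ℝ := ∑' n : ℕ, 1 / ((n : ℝ) + 1) ^ (2 : ℝ) with hCdef
  have h1 : ∀ s : ℂ, 3 ≤ s.re → 2 ≤ s.im → ‖deriv riemannZeta s‖ ≤ C := by
    intro s hs1 hs2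
    refine norm_deriv_le_of_norm_le_ball_one (differentiableOn_riemannZeta_im_pos.mono
      (closedBall_subset_im_pos (by linarith))) fun z hz ↦ ?_
    obtain ⟨hr, hi⟩ := abs_re_sub_le_and_abs_im_sub_le hz
    rw [abs_le] at hr hi
    exact norm_riemannZeta_le_tsum one_lt_two (by linarith)
  refine ⟨C, tsum_nonneg fun n ↦ by positivity, fun s hs1 hs2 ↦
    ⟨h1 s (by linarith) (by linarith), ?_⟩⟩
  refine norm_deriv_le_of_norm_le_ball_one
      (analyticOnNhd_riemannZeta_im_pos.deriv.differentiableOn.mono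
        (closedBall_subset_im_pos (by linarith))) fun z hz ↦ ?_
  obtain ⟨hr, hi⟩ := abs_re_sub_le_and_abs_im_sub_le hz
  rw [abs_le] at hr hi
  exact h1 z (by linarith) (by linarith)

end

section

open MeasureTheory Set Filter Topology

lemma norm_exp_mul_add_mul_I_le {l : ℂ} {b x y : ℝ} (hl : 0 ≤ l.re) (hx : x ≤ b) :
    ‖exp (l * (x + y * I))‖ ≤ Real.exp (l.re * b - l.im * y) := by
  rw [norm_exp, Real.exp_le_exp]
  simp
  gcongr

lemma exists_norm_le_exp_of_mul_eq_deriv_sq {a : ℂ} {F : ℂ → ℂ} {T₀ c m : ℝ} (hT₀ : 0 ≤ T₀)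
    (hF : AnalyticOnNhd ℂ F {s | T₀ < s.im})
    (hFeq : ∀ s : ℂ, T₀ < s.im → F s * (riemannZeta s - a) = deriv riemannZeta s ^ 2)
    (hc : 0 ≤ c) (hm : 0 < m) (hcm : ∀ s : ℂ, s.re = c → m ≤ ‖riemannZeta s - a‖) :
    ∃ K : ℝ, 0 ≤ K ∧ ∀ s : ℂ, -1 / 2 ≤ s.re → s.re ≤ c → T₀ + c + 6 ≤ s.im →
      ‖F s‖ ≤ Real.exp (K * (1 + s.im)) := by
  obtain ⟨C, hC0, hC⟩ := exists_norm_riemannZeta_derivs_le_exp (-2)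
  set R : ℝ := c + 3 / 2 with hR
  set D : ℝ := 2 * C + 2 * C * R + ‖a‖ with hD
  have hD0 : 0 ≤ D := by positivity
  refine ⟨D + (R ^ 2 * (D + |Real.log m|) + 1), by positivity, fun s hs1 hs2 hs3 ↦ ?_⟩
  set s₀ : ℂ := c + s.im * I with hs₀
  have hs₀re : s₀.re = c := by simp [hs₀]
  have hs₀im : s₀.im = s.im := by simp [hs₀]
  have hball : ∀ z ∈ Metric.closedBall s₀ R, -2 ≤ z.re ∧ 3 ≤ z.im ∧ z.im ≤ s.im + R ∧
      T₀ < z.im := by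
    intro z hz
    obtain ⟨hr, hi⟩ := abs_re_sub_le_and_abs_im_sub_le hz
    rw [abs_le, hs₀re] at hr
    rw [abs_le, hs₀im] at hi
    refine ⟨?_, ?_, ?_, ?_⟩ <;> linarith
  have hsub : Metric.closedBall s 1 ⊆ Metric.closedBall s₀ R := by
    refine Metric.closedBall_subset_closedBall' ?_
    have : s - s₀ = ((s.re - c : ℝ) : ℂ) := by
      apply Complex.ext <;> simp [hs₀]
    rw [dist_eq_norm, this, norm_real, Real.norm_eq_abs]
    have : |s.re - c| ≤ c + 1 / 2 := abs_le.2 ⟨by linarith, by linarith⟩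
    linarith
  have hMle : ∀ z ∈ Metric.closedBall s₀ R, 2 * (C * z.im) + ‖a‖ ≤ D * (1 + s.im) := fun z hz ↦ by
    have h1 := (hball z hz).2.2.1
    have h2 : C * z.im ≤ C * (s.im + R) := by gcongr
    have h3 : 0 ≤ (2 * C * R + ‖a‖) * s.im := mul_nonneg (by positivity) (by linarith)
    rw [hD]
    nlinarith
  have him : 0 ≤ s.im := by linarith
  have key := norm_le_exp_of_norm_mul_le (f := fun z ↦ riemannZeta z - a) (g := F) (s₀ := s₀)
    (s := s) (R := R) (r := 1) (M := D * (1 + s.im)) (by positivity) one_pos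
    (fun z hz ↦ ((analyticOnNhd_riemannZeta_im_pos z (by
      have := (hball z hz).2.1
      simp only [mem_ofPred_eq]; linarith)).sub analyticAt_const))
    (fun z hz ↦ hF z (hball z hz).2.2.2) hsub
    (fun z hz ↦ by
      obtain ⟨h1, h2, -⟩ := hball z hz
      have hCz : 0 ≤ C * z.im := mul_nonneg hC0 (by linarith)
      refine (norm_sub_le _ _).trans ?_
      refine le_trans ?_ (Real.exp_le_exp.2 (hMle z hz))
      have h3 := (hC z h1 h2).1
      have h4 : 1 ≤ Real.exp (C * z.im) := Real.one_le_exp hCz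
      calc ‖riemannZeta z‖ + ‖a‖ ≤ Real.exp (C * z.im) * (‖a‖ + 1) := by
            nlinarith [norm_nonneg a]
        _ ≤ Real.exp (C * z.im) * Real.exp ‖a‖ := by gcongr; exact Real.add_one_le_exp _
        _ = Real.exp (C * z.im + ‖a‖) := (Real.exp_add _ _).symm
        _ ≤ _ := Real.exp_le_exp.2 (by linarith))
    (fun z hz ↦ by
      obtain ⟨h1, h2, -, h3⟩ := hball z hz
      rw [hFeq z h3, norm_pow]
      refine le_trans ?_ (Real.exp_le_exp.2 (hMle z hz))
      calc ‖deriv riemannZeta z‖ ^ 2 ≤ Real.exp (C * z.im) ^ 2 := by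
            gcongr; exact (hC z h1 h2).2.1
        _ = Real.exp (2 * (C * z.im)) := by rw [← Real.exp_nat_mul]; norm_num
        _ ≤ _ := Real.exp_le_exp.2 (by linarith [norm_nonneg a]))
    (norm_pos_iff.1 (hm.trans_le (hcm s₀ hs₀re)))
  refine key.trans (Real.exp_le_exp.2 ?_)
  have h1 : -|Real.log m| ≤ Real.log ‖riemannZeta s₀ - a‖ :=
    (neg_abs_le _).trans (Real.log_le_log hm (hcm s₀ hs₀re))
  have h2 : D * (1 + s.im) - Real.log ‖riemannZeta s₀ - a‖ ≤ (D + |Real.log m|) * (1 + s.im) := by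
    nlinarith [abs_nonneg (Real.log m)]
  have h3 := mul_le_mul_of_nonneg_left h2 (sq_nonneg R)
  simp only [one_pow, div_one]
  nlinarith

/-- Moving the line of integration of `(F - ζ'') exp (l s)` from `Re s = -1 / 2` to `Re s = c`. -/
lemma exists_norm_integral_left_le {a : ℂ} {F : ℂ → ℂ} {T₀ c m : ℝ} (hT₀ : 0 ≤ T₀)
    (hF : AnalyticOnNhd ℂ F {s | T₀ < s.im})
    (hFeq : ∀ s : ℂ, T₀ < s.im → F s * (riemannZeta s - a) = deriv riemannZeta s ^ 2)
    (hc : 4 ≤ c) (hm : 0 < m) (hcm : ∀ s : ℂ, s.re = c → m ≤ ‖riemannZeta s - a‖)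
    {T : ℝ} (hT : T₀ + c + 6 ≤ T) :
    ∃ K : ℝ, 0 ≤ K ∧ ∀ l : ℂ, 0 ≤ l.re → l.re ≤ 3 → 0 < l.im →
      IntegrableOn (fun t : ℝ ↦ (F ((-1 / 2 : ℝ) + t * I) -
        deriv (deriv riemannZeta) ((-1 / 2 : ℝ) + t * I)) * exp (l * ((-1 / 2 : ℝ) + t * I)))
        (Ioi T) →
      ‖∫ t in Ioi T, (F ((-1 / 2 : ℝ) + t * I) -
        deriv (deriv riemannZeta) ((-1 / 2 : ℝ) + t * I)) * exp (l * ((-1 / 2 : ℝ) + t * I))‖ ≤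
        K * (1 + 1 / l.im) := by
  obtain ⟨K₁, hK₁, hgrow⟩ := exists_norm_le_exp_of_mul_eq_deriv_sq hT₀ hF hFeq (by linarith) hm hcm
  obtain ⟨C, hC0, hC⟩ := exists_norm_riemannZeta_derivs_le_exp (-1 / 2)
  obtain ⟨B, hB0, hB⟩ := exists_norm_riemannZeta_derivs_le hc
  set H : ℂ → ℂ := fun s ↦ F s - deriv (deriv riemannZeta) s with hH
  have hHa : AnalyticOnNhd ℂ H {s | T₀ < s.im} := fun s hs ↦ (hF s hs).sub
    (analyticOnNhd_riemannZeta_im_pos.deriv.deriv s (hT₀.trans_lt hs))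
  set B' : ℝ := B ^ 2 / m + B with hB'
  have hright : ∀ t : ℝ, T ≤ t → ‖H (c + t * I)‖ ≤ B' := by
    intro t ht
    have him : T₀ < ((c : ℂ) + t * I).im := by simp; linarith
    obtain ⟨h1, h2⟩ := hB (c + t * I) (by simp) (by simp; linarith)
    have h3 := hcm (c + t * I) (by simp)
    have h4 := congrArg norm (hFeq _ him)
    rw [norm_mul, norm_pow] at h4
    refine (norm_sub_le _ _).trans (add_le_add ?_ h2)
    rw [le_div_iff₀ hm]
    calc _ ≤ ‖F (c + t * I)‖ * ‖riemannZeta (c + t * I) - a‖ := by gcongr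
      _ ≤ _ := by rw [h4]; gcongr
  obtain ⟨E, hE⟩ := (isCompact_Icc (a := (-1 / 2 : ℝ)) (b := c)).exists_bound_of_continuousOn
    (f := fun x : ℝ ↦ H (x + T * I)) (fun x _ ↦ by
      have h1 : ContinuousAt H (x + T * I) := (hHa _ (by simp; linarith)).continuousAt
      exact (ContinuousAt.comp (f := fun x : ℝ ↦ (x + T * I : ℂ)) h1
        (by fun_prop)).continuousWithinAt)
  have hE0 : 0 ≤ E := (norm_nonneg _).trans (hE c ⟨by linarith, le_rfl⟩)
  have hTpos : 0 < T := by linarith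
  have hB'0 : 0 ≤ B' := by positivity
  refine ⟨(B' + E * (c + 1 / 2)) * Real.exp (3 * c), by positivity, fun l hl0 hl3 hli hgi ↦ ?_⟩
  have hV : ∀ x y : ℝ, x ≤ c → ‖exp (l * (x + y * I))‖ ≤
      Real.exp (3 * c) * Real.exp (-l.im * y) := fun x y hx ↦ by
    refine (norm_exp_mul_add_mul_I_le hl0 hx).trans ?_
    rw [← Real.exp_add, Real.exp_le_exp]
    nlinarith
  have hdom : IntegrableOn (fun t : ℝ ↦ B' * (Real.exp (3 * c) * Real.exp (-l.im * t))) (Ioi T) :=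
    ((integrableOn_exp_mul_Ioi (neg_neg_of_pos hli) T).const_mul _).const_mul _
  have hbd : ∀ t ∈ Ioi T, ‖H (c + t * I) * exp (l * (c + t * I))‖ ≤
      B' * (Real.exp (3 * c) * Real.exp (-l.im * t)) := fun t ht ↦ by
    rw [norm_mul]
    exact mul_le_mul (hright t (le_of_lt ht)) (hV c t le_rfl) (norm_nonneg _) hB'0
  have hrint : IntegrableOn (fun t : ℝ ↦ H (c + t * I) * exp (l * (c + t * I))) (Ioi T) := by
    refine hdom.mono' (ContinuousOn.aestronglyMeasurable (fun t ht ↦ ?_) measurableSet_Ioi)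
      (ae_restrict_of_forall_mem measurableSet_Ioi hbd)
    have ht' : T < t := ht
    have h1 : ContinuousAt H (c + t * I) := (hHa _ (by simp; linarith)).continuousAt
    exact ((ContinuousAt.comp (f := fun t : ℝ ↦ (c + t * I : ℂ)) h1
      (by fun_prop)).mul (by fun_prop)).continuousWithinAt
  have hmain := norm_integral_half_line_le (G := fun s ↦ H s * exp (l * s)) (a := -1 / 2) (b := c)
    (T := T) (K := K₁ + 1 + C + 3 * c) (by linarith)
    (fun s hs ↦ by
      have hs2 : T ≤ s.im := hs.2
      exact ((hHa s (by simp only [mem_ofPred_eq]; linarith)).differentiableAt.mul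
        (by fun_prop)).differentiableWithinAt)
    (fun x hx y hy ↦ by
      have hre : ((x : ℂ) + y * I).re = x := by simp
      have him : ((x : ℂ) + y * I).im = y := by simp
      have h1 := hgrow (x + y * I) (by rw [hre]; exact hx.1) (by rw [hre]; exact hx.2)
        (by rw [him]; linarith)
      have h2 := (hC (x + y * I) (by rw [hre]; exact hx.1) (by rw [him]; linarith)).2.2
      rw [him] at h1 h2
      have h3 : ‖exp (l * (x + y * I))‖ ≤ Real.exp (3 * c) := by
        refine (norm_exp_mul_add_mul_I_le hl0 hx.2).trans (Real.exp_le_exp.2 ?_)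
        nlinarith
      have hy0 : 0 ≤ y := by linarith
      have e1 : 1 ≤ Real.exp (K₁ * (1 + y)) := Real.one_le_exp (by positivity)
      have e2 : 1 ≤ Real.exp (C * y) := Real.one_le_exp (by positivity)
      have e3 : 2 ≤ Real.exp 1 := by linarith [Real.add_one_le_exp (1 : ℝ)]
      calc ‖H (x + y * I) * exp (l * (x + y * I))‖
          ≤ (Real.exp (K₁ * (1 + y)) + Real.exp (C * y)) * Real.exp (3 * c) := by
            rw [norm_mul]
            exact mul_le_mul ((norm_sub_le _ _).trans (add_le_add h1 h2)) h3 (norm_nonneg _)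
              (by positivity)
        _ ≤ (Real.exp (K₁ * (1 + y)) * Real.exp (C * y) * Real.exp 1) * Real.exp (3 * c) := by
            gcongr
            have := mul_nonneg (sub_nonneg.2 e1) (sub_nonneg.2 e2)
            have := mul_le_mul_of_nonneg_left e3 (by positivity :
              0 ≤ Real.exp (K₁ * (1 + y)) * Real.exp (C * y))
            nlinarith
        _ = Real.exp (K₁ * (1 + y) + C * y + 1 + 3 * c) := by simp only [Real.exp_add]
        _ ≤ _ := Real.exp_le_exp.2 (by nlinarith [mul_nonneg (by linarith : 0 ≤ c) hy0]))
    hgi hrint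
  refine hmain.trans ?_
  have hr : ‖∫ t in Ioi T, H (c + t * I) * exp (l * (c + t * I))‖ ≤
      B' * Real.exp (3 * c) * (1 / l.im) := by
    refine (norm_integral_le_of_norm_le hdom
      (ae_restrict_of_forall_mem measurableSet_Ioi hbd)).trans ?_
    rw [integral_const_mul, integral_const_mul, integral_exp_mul_Ioi (neg_neg_of_pos hli),
      neg_div_neg_eq, mul_assoc]
    gcongr
    exact Real.exp_le_one_iff.2 (by nlinarith)
  have hbot : ‖∫ x in (-1 / 2 : ℝ)..c, H (x + T * I) * exp (l * (x + T * I))‖ ≤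
      E * Real.exp (3 * c) * (c + 1 / 2) := by
    refine (intervalIntegral.norm_integral_le_of_norm_le_const (C := E * Real.exp (3 * c))
      fun x hx ↦ ?_).trans_eq ?_
    · rw [uIoc_of_le (by linarith)] at hx
      rw [norm_mul]
      refine mul_le_mul (hE x ⟨hx.1.le, hx.2⟩) ((hV x T hx.2).trans ?_) (norm_nonneg _) hE0
      exact mul_le_of_le_one_right (Real.exp_pos _).le (Real.exp_le_one_iff.2 (by nlinarith))
    · rw [abs_of_nonneg (by linarith)]
      ring
  refine (add_le_add hr hbot).trans ?_
  have h1 : 0 ≤ E * (c + 1 / 2) * Real.exp (3 * c) * (1 / l.im) := by positivity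
  have h2 : 0 ≤ B' * Real.exp (3 * c) := by positivity
  nlinarith

end

section

open MeasureTheory Set Filter Topology

/-- The `a`-values of `ζ` in an upper half-plane cannot all be multiple. -/
lemma not_forall_a_value_multiple (a : ℂ) {T₀ : ℝ} (hT₀ : 0 ≤ T₀)
    (hmult : ∀ s : ℂ, T₀ < s.im → riemannZeta s = a → deriv riemannZeta s = 0) : False := by
  obtain ⟨c, m, hc, hm, hcm⟩ := exists_le_norm_riemannZeta_sub a
  have han : AnalyticOnNhd ℂ (fun s ↦ riemannZeta s - a) {s | T₀ < s.im} := fun s hs ↦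
    (analyticOnNhd_riemannZeta_im_pos s (hT₀.trans_lt hs)).sub analyticAt_const
  obtain ⟨F, hF, hFeq⟩ := exists_analyticOnNhd_mul_eq_deriv_sq han
    (fun s hs hev ↦ by
      have h1 := han.eqOn_zero_of_preconnected_of_eventuallyEq_zero
        (convex_halfSpace_im_gt T₀).isPreconnected hs hev
        (show T₀ < (c + (T₀ + 1 : ℝ) * I : ℂ).im by simp)
      have h2 := hcm (c + (T₀ + 1 : ℝ) * I) (by simp)
      simp only [Pi.zero_apply] at h1
      rw [h1, norm_zero] at h2
      linarith)
    (fun s hs h0 ↦ by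
      rw [deriv_sub_const]
      exact hmult s hs (sub_eq_zero.1 h0))
  simp only [deriv_sub_const_fun, mem_ofPred_eq] at hFeq
  obtain ⟨T₁, hT₁, hleft⟩ := exists_norm_integral_zetaFactor_le a
  set T : ℝ := max T₁ (T₀ + c + 6)
  have hT : 1 ≤ T := hT₁.trans (le_max_left _ _)
  have hTc : T₀ + c + 6 ≤ T := le_max_right _ _
  obtain ⟨K₁, hsum⟩ := exists_sum_vonMangoldtLogSum_le (zero_le_one.trans hT)
  obtain ⟨K₂, hK₂, hleft⟩ := hleft T (le_max_left _ _)
  obtain ⟨K₃, hK₃, hcontour⟩ := exists_norm_integral_left_le hT₀ hF hFeq hc hm hcm hTc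
  have hpt : ∀ t : ℝ, ((-1 / 2 : ℝ) : ℂ) + t * I = 1 - (3 / 2 - t * I) := fun t ↦ by
    push_cast; ring
  simp only [hpt] at hcontour
  have him : ∀ t ∈ Ioi T, T₀ < (1 - (3 / 2 - t * I) : ℂ).im := fun t ht ↦ by
    have : T < t := ht
    simp
    linarith
  have hleft := hleft (fun t ↦ F (1 - (3 / 2 - t * I)) -
    deriv (deriv riemannZeta) (1 - (3 / 2 - t * I)))
    (fun t ht ↦ by
      have h1 : ContinuousAt (fun s ↦ F s - deriv (deriv riemannZeta) s) (1 - (3 / 2 - t * I)) :=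
        ((hF _ (him t ht)).sub (analyticOnNhd_riemannZeta_im_pos.deriv.deriv _
          (hT₀.trans_lt (him t ht)))).continuousAt
      exact (ContinuousAt.comp (f := fun t : ℝ ↦ (1 - (3 / 2 - t * I) : ℂ)) h1
        (by fun_prop)).continuousWithinAt)
    (fun t ht ↦ by rw [sub_add_cancel]; exact hFeq _ (him t ht))
  obtain ⟨N, hN, hlt⟩ := exists_lt_sum_vonMangoldtLogSum_mul_exp
    (|K₁| + 27 * K₃ + (1 + 26 * 27) * K₂)
  have hN1 : (1 : ℝ) ≤ N := by exact_mod_cast hN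
  have hπ := Real.pi_gt_three
  have hπ' := Real.pi_lt_d2
  set δ : ℝ := 1 / (4 * Real.pi * N) with hδ
  have hδ0 : 0 < δ := by positivity
  have hδ1 : δ ≤ 1 := by
    rw [hδ, div_le_one (by positivity)]
    nlinarith
  obtain ⟨hl1, hl2, hl3, hl4⟩ := log_two_mul_one_add_I_bounds hδ0 hδ1
  have hsum := hsum δ hδ0 hδ1 (Finset.Ico N (2 * N))
  set l : ℂ := log (2 * (1 + δ * I))
  have hlre : l.re ≤ 3 := by
    have h1 := Real.add_one_le_exp l.re
    rw [← norm_exp, hl4] at h1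
    have h2 : ‖(2 * (1 + δ * I) : ℂ)‖ ≤ 2 * (1 + 1) := by
      rw [norm_mul, RCLike.norm_two]
      refine mul_le_mul_of_nonneg_left ((norm_add_le _ _).trans ?_) zero_le_two
      simpa [abs_of_pos hδ0] using hδ1
    linarith
  have hli : 0 < l.im := by linarith
  obtain ⟨hgi, hleft⟩ := hleft l hli hl3
  have hcontour := hcontour l ((Real.log_pos one_lt_two).le.trans hl3) hlre hli hgi
  have hinv : 1 / l.im ≤ 26 * N := by
    rw [div_le_iff₀ hli]
    have : 4 * Real.pi * N * δ = 1 := by rw [hδ]; field_simp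
    nlinarith [mul_le_mul_of_nonneg_left hl1 (by positivity : (0 : ℝ) ≤ 26 * N),
      mul_pos (zero_lt_one.trans_le hN1) hδ0]
  have hlog : |Real.log l.im| ≤ 26 + Real.log N := by
    rw [abs_of_nonpos (Real.log_nonpos hli.le (by linarith)), ← Real.log_inv, ← one_div]
    refine (Real.log_le_log (by positivity) hinv).trans ?_
    rw [Real.log_mul (by norm_num) (by positivity)]
    linarith [Real.log_le_sub_one_of_pos (by norm_num : (0 : ℝ) < 26)]
  have hexp : ∀ n : ℕ, 4 * Real.pi * δ * n = n / N := fun n ↦ by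
    rw [hδ]; field_simp
  simp only [hexp] at hsum
  set L : ℝ := Real.log N
  have hL : 0 ≤ L := Real.log_nonneg hN1
  have hdiv : (1 + |Real.log l.im|) / l.im ≤ (27 + L) * (26 * N) := by
    rw [← mul_one_div]
    exact mul_le_mul (by linarith) hinv (by positivity) (by linarith)
  have h1 := mul_le_mul_of_nonneg_left (add_le_add_right hinv 1) hK₃
  have h2 := mul_le_mul_of_nonneg_left (add_le_add_right hdiv 1) hK₂
  have hLN : (1 : ℝ) ≤ (1 + L) * N := one_le_mul_of_one_le_of_one_le (by linarith) hN1
  have hNL : (N : ℝ) ≤ (1 + L) * N := le_mul_of_one_le_left (by linarith) (by linarith)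
  have b1 : K₁ ≤ |K₁| * ((1 + L) * N) :=
    (le_abs_self _).trans (le_mul_of_one_le_right (abs_nonneg _) hLN)
  have b2 : K₃ * (1 + 26 * N) ≤ K₃ * (27 * ((1 + L) * N)) :=
    mul_le_mul_of_nonneg_left (by linarith) hK₃
  have b3 : K₂ * (1 + (27 + L) * (26 * N)) ≤ K₂ * ((1 + 26 * 27) * ((1 + L) * N)) := by
    refine mul_le_mul_of_nonneg_left ?_ hK₂
    nlinarith [mul_nonneg hL (zero_le_one.trans hN1)]
  linarith

end

/-- For every complex number `a` there exist infinitely many simple `a`-values of the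
Riemann zeta function with arbitrarily large imaginary part: for every real `T` there is
`s ∈ ℂ` with `Im s > T`, `ζ(s) = a` and `ζ'(s) ≠ 0`. -/
theorem exists_simple_a_value_of_riemannZeta (a : ℂ) :
    ∀ T : ℝ, ∃ s : ℂ, T < s.im ∧ riemannZeta s = a ∧ deriv riemannZeta s ≠ 0 := by
  intro T
  by_contra! h
  exact not_forall_a_value_multiple a (le_max_right T 0) fun s hs ↦
    h s ((le_max_left _ _).trans_lt hs)
end
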